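/- Let 0 < p < ∞ and β ∈ {1,2}. Then lim_{n→∞} n^{1/p + 1/2} · vol_{β,n}(B^n_{p,β})^{2/(β n²)} = (p√π Γ(p/2) / (√e Γ((p+1)/2)))^{1/p} · (π/β)^{1/2} · e^{3/4}. -/

import Mathlib

open MeasureTheory Filter ENNReal Matrix
open scoped RealInnerProductSpace

set_option maxHeartbeats 1000000
set_option autoImplicit false
set_option synthInstance.maxHeartbeats 1000000

noncomputable section

/-- The real dimension of `𝕜` over `ℝ` plays the role of `β ∈ {1,2}`. -/
instance rclikeStarModule (𝕜 : Type) [RCLike 𝕜] : StarModule ℝ 𝕜 :=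
  ⟨fun r a => by
    simp [Algebra.smul_def, StarMul.star_mul, RCLike.star_def, RCLike.conj_ofReal, mul_comm]⟩

instance matrixMeasurableSpace {𝕜 : Type} [MeasurableSpace 𝕜] (n : ℕ) :
    MeasurableSpace (Matrix (Fin n) (Fin n) 𝕜) :=
  inferInstanceAs (MeasurableSpace (Fin n → Fin n → 𝕜))

/-- The space `H_n(F_β)` of self-adjoint `n × n` matrices over `𝕜 = F_β`. -/
abbrev HMat (𝕜 : Type) [RCLike 𝕜] (n : ℕ) := selfAdjoint (Matrix (Fin n) (Fin n) 𝕜)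

/-- The real eigenvalues (with multiplicity, in some order) of a self-adjoint matrix. -/
def eigs {𝕜 : Type} [RCLike 𝕜] {n : ℕ} (A : HMat 𝕜 n) : Fin n → ℝ :=
  Matrix.IsHermitian.eigenvalues A.prop

/-- The matrix unit ball `B^n_{p,β} = {A : Σ_j |λ_j(A)|^p ≤ 1}`. -/
def matBall (𝕜 : Type) [RCLike 𝕜] (n : ℕ) (p : ℝ) : Set (HMat 𝕜 n) :=
  {A | ∑ j, |eigs A j| ^ p ≤ 1}

/-- The integral `∫₁^∞ t^{-p} (t² - 1)^{-1/2} dt`, in closed form. -/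
def ullmanConst (p : ℝ) : ℝ :=
  Real.sqrt Real.pi * Real.Gamma (p / 2) / (2 * Real.Gamma ((p + 1) / 2))

lemma ullmanConst_pos {p : ℝ} (hp : 0 < p) : 0 < ullmanConst p := by
  have h1 := Real.Gamma_pos_of_pos (half_pos hp)
  have h2 : 0 < Real.Gamma ((p + 1) / 2) := Real.Gamma_pos_of_pos (by linarith)
  have := Real.pi_pos
  unfold ullmanConst
  positivity

lemma ullmanConst_eq_half_beta (p : ℝ) :
    ullmanConst p = ProbabilityTheory.beta (p / 2) (1 / 2) / 2 := by
  rw [ullmanConst, ProbabilityTheory.beta, Real.Gamma_one_half_eq, show p / 2 + 1 / 2 = (p + 1) / 2 by ring]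
  field_simp

lemma half_beta_eq {p : ℝ} (hp : 0 < p) :
    ProbabilityTheory.beta ((p + 1) / 2) (1 / 2) / 2 = Real.pi / (2 * (p * ullmanConst p)) := by
  have h1 := Real.Gamma_pos_of_pos (half_pos hp)
  have h2 : 0 < Real.Gamma ((p + 1) / 2) := Real.Gamma_pos_of_pos (by linarith)
  have h3 := Real.pi_pos
  have h4 : Real.Gamma ((p + 1) / 2 + 1 / 2) = p / 2 * Real.Gamma (p / 2) := by
    rw [← Real.Gamma_add_one (by positivity)]
    congr 1; ring
  rw [ullmanConst, ProbabilityTheory.beta, Real.Gamma_one_half_eq, h4]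
  have h5 : Real.sqrt Real.pi * Real.sqrt Real.pi = Real.pi := Real.mul_self_sqrt h3.le
  have h6 : 0 < Real.sqrt Real.pi := Real.sqrt_pos.2 h3
  field_simp
  nlinarith [h5]

lemma lintegral_beta {a b : ℝ} (ha : 0 < a) (hb : 0 < b) :
    ∫⁻ u in Set.Ioo (0 : ℝ) 1, ENNReal.ofReal (u ^ (a - 1) * (1 - u) ^ (b - 1)) =
      ENNReal.ofReal (ProbabilityTheory.beta a b) := by
  have h := ProbabilityTheory.lintegral_betaPDF_eq_one ha hb
  rw [ProbabilityTheory.lintegral_betaPDF] at h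
  have hB := ProbabilityTheory.beta_pos ha hb
  have h1 : ∀ x : ℝ, ENNReal.ofReal (1 / ProbabilityTheory.beta a b * x ^ (a - 1) * (1 - x) ^ (b - 1))
      = ENNReal.ofReal (1 / ProbabilityTheory.beta a b) *
        ENNReal.ofReal (x ^ (a - 1) * (1 - x) ^ (b - 1)) := by
    intro x
    rw [mul_assoc, ENNReal.ofReal_mul (by positivity)]
  simp_rw [h1] at h
  rw [lintegral_const_mul _ (by fun_prop)] at h
  rw [one_div, ENNReal.ofReal_inv_of_pos hB] at h
  have h0 : ENNReal.ofReal (ProbabilityTheory.beta a b) ≠ 0 := by simpa using hB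
  calc _ = ENNReal.ofReal (ProbabilityTheory.beta a b) * ((ENNReal.ofReal (ProbabilityTheory.beta a b))⁻¹ *
        ∫⁻ u in Set.Ioo (0 : ℝ) 1, ENNReal.ofReal (u ^ (a - 1) * (1 - u) ^ (b - 1))) := by
        rw [← mul_assoc, ENNReal.mul_inv_cancel h0 ENNReal.ofReal_ne_top, one_mul]
    _ = _ := by rw [h, mul_one]

lemma lintegral_rpow_neg_mul_inv_sqrt {p : ℝ} (hp : 0 < p) :
    ∫⁻ t in Set.Ioi (1 : ℝ), ENNReal.ofReal (t ^ (-p) * (Real.sqrt (t ^ 2 - 1))⁻¹) =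
      ENNReal.ofReal (ullmanConst p) := by
  have himg : (fun u : ℝ => u ^ (-(1 / 2) : ℝ)) '' Set.Ioo 0 1 = Set.Ioi 1 := by
    ext t
    constructor
    · rintro ⟨u, ⟨h0, h1⟩, rfl⟩
      exact Real.one_lt_rpow_of_pos_of_lt_one_of_neg h0 h1 (by norm_num)
    · intro (ht : 1 < t)
      have ht0 : 0 < t := by linarith
      refine ⟨t ^ (-2 : ℝ), ⟨by positivity, Real.rpow_lt_one_of_one_lt_of_neg ht (by norm_num)⟩, ?_⟩
      simp only
      rw [← Real.rpow_mul ht0.le]; norm_num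
  have hinj : Set.InjOn (fun u : ℝ => u ^ (-(1 / 2) : ℝ)) (Set.Ioo 0 1) := by
    intro u hu v hv h
    have := congrArg (fun z : ℝ => z ^ (-2 : ℝ)) h
    simp only at this
    rw [← Real.rpow_mul hu.1.le, ← Real.rpow_mul hv.1.le] at this
    norm_num at this
    exact this
  have hder : ∀ u ∈ Set.Ioo (0 : ℝ) 1, HasDerivWithinAt (fun u : ℝ => u ^ (-(1 / 2) : ℝ))
      ((-(1 / 2) : ℝ) * u ^ ((-(1 / 2) : ℝ) - 1)) (Set.Ioo 0 1) u := fun u hu =>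
    (Real.hasDerivAt_rpow_const (Or.inl hu.1.ne')).hasDerivWithinAt
  rw [← himg, lintegral_image_eq_lintegral_abs_deriv_mul measurableSet_Ioo hder hinj,
    ullmanConst_eq_half_beta, div_eq_inv_mul (ProbabilityTheory.beta _ _) 2, ENNReal.ofReal_mul (by norm_num),
    ← lintegral_beta (half_pos hp) (by norm_num : (0 : ℝ) < 1 / 2), ← lintegral_const_mul _ (by fun_prop)]
  refine setLIntegral_congr_fun measurableSet_Ioo fun u hu => ?_
  obtain ⟨h0, h1⟩ := hu
  rw [← ENNReal.ofReal_mul (abs_nonneg _), ← ENNReal.ofReal_mul (by norm_num)]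
  congr 1
  have hs : (u ^ (-(1 / 2) : ℝ)) ^ 2 - 1 = (1 - u) * u ^ (-1 : ℝ) := by
    rw [← Real.rpow_natCast, ← Real.rpow_mul h0.le]
    norm_num
    rw [Real.rpow_neg_one]; field_simp
  rw [hs, Real.sqrt_eq_rpow, Real.mul_rpow (by linarith) (by positivity), ← Real.rpow_mul h0.le,
    mul_inv, ← Real.rpow_neg (by linarith), ← Real.rpow_mul h0.le, ← Real.rpow_neg h0.le, abs_mul, abs_of_pos (Real.rpow_pos_of_pos h0 _)]
  norm_num
  have : u ^ (p / 2 - 1) = u ^ (-(3 / 2) : ℝ) * u ^ (p / 2) * u ^ (1 / 2 : ℝ) := by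
    rw [← Real.rpow_add h0, ← Real.rpow_add h0]; congr 1; ring
  rw [this, show (1 / 2 : ℝ) * p = p / 2 by ring]
  ring

lemma integral_abs_cos_rpow {p : ℝ} (hp : 0 < p) :
    ∫ θ in (0 : ℝ)..Real.pi, |Real.cos θ| ^ p = Real.pi / (p * ullmanConst p) := by
  have hc : Continuous fun θ : ℝ => |Real.cos θ| ^ p := by
    refine Continuous.rpow_const (by fun_prop) fun _ => Or.inr hp.le
  have hpi := Real.pi_pos
  have h1 : ∫ θ in (0 : ℝ)..Real.pi, |Real.cos θ| ^ p = 2 * ∫ θ in (0 : ℝ)..(Real.pi / 2), |Real.cos θ| ^ p := by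
    rw [← intervalIntegral.integral_add_adjacent_intervals (b := Real.pi / 2) (hc.intervalIntegrable _ _)
      (hc.intervalIntegrable _ _)]
    have : ∫ θ in (Real.pi / 2)..Real.pi, |Real.cos θ| ^ p = ∫ θ in (0 : ℝ)..(Real.pi / 2), |Real.cos θ| ^ p := by
      have := intervalIntegral.integral_comp_sub_left (fun θ : ℝ => |Real.cos θ| ^ p) Real.pi
        (a := 0) (b := Real.pi / 2)
      simp only [Real.cos_pi_sub, abs_neg, sub_zero] at this
      rw [this]; congr 1; ring
    rw [this]; ring
  have h2 : ∫⁻ θ in Set.Ioo (0 : ℝ) (Real.pi / 2), ENNReal.ofReal (|Real.cos θ| ^ p) =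
      ENNReal.ofReal (Real.pi / (2 * (p * ullmanConst p))) := by
    have hpos : ∀ θ ∈ Set.Ioo (0 : ℝ) (Real.pi / 2), 0 < Real.cos θ ∧ 0 < Real.sin θ := fun θ hθ =>
      ⟨Real.cos_pos_of_mem_Ioo ⟨by linarith [hθ.1], hθ.2⟩, Real.sin_pos_of_pos_of_lt_pi hθ.1 (by linarith [hθ.2])⟩
    have himg : (fun θ : ℝ => Real.cos θ ^ 2) '' Set.Ioo 0 (Real.pi / 2) = Set.Ioo 0 1 := by
      ext u
      constructor
      · rintro ⟨θ, hθ, rfl⟩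
        obtain ⟨h, h'⟩ := hpos θ hθ
        exact ⟨by positivity, by nlinarith [Real.sin_sq_add_cos_sq θ, mul_pos h' h']⟩
      · intro ⟨hu0, hu1⟩
        have hs0 : 0 < Real.sqrt u := Real.sqrt_pos.2 hu0
        have hs1 : Real.sqrt u < 1 := by rw [Real.sqrt_lt' one_pos]; simpa using hu1
        refine ⟨Real.arccos (Real.sqrt u), ⟨Real.arccos_pos.2 hs1, Real.arccos_lt_pi_div_two.2 hs0⟩, ?_⟩
        simp only
        rw [Real.cos_arccos (by linarith) hs1.le, Real.sq_sqrt hu0.le]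
    have hinj : Set.InjOn (fun θ : ℝ => Real.cos θ ^ 2) (Set.Ioo 0 (Real.pi / 2)) := by
      intro θ hθ φ hφ h
      have h' : Real.cos θ = Real.cos φ := by
        have := (sq_eq_sq₀ (hpos θ hθ).1.le (hpos φ hφ).1.le).1 h
        exact this
      exact Real.injOn_cos ⟨hθ.1.le, by linarith [hθ.2]⟩ ⟨hφ.1.le, by linarith [hφ.2]⟩ h'
    have hder : ∀ θ ∈ Set.Ioo (0 : ℝ) (Real.pi / 2), HasDerivWithinAt (fun θ : ℝ => Real.cos θ ^ 2)
        (2 * Real.cos θ * (-Real.sin θ)) (Set.Ioo 0 (Real.pi / 2)) θ := fun θ hθ => by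
      have := ((Real.hasDerivAt_cos θ).fun_pow 2).hasDerivWithinAt (s := Set.Ioo 0 (Real.pi / 2))
      simpa using this
    rw [← half_beta_eq hp, div_eq_inv_mul (ProbabilityTheory.beta _ _) 2, ENNReal.ofReal_mul (by norm_num),
      ← lintegral_beta (by linarith : 0 < (p + 1) / 2) (by norm_num : (0 : ℝ) < 1 / 2), ← himg,
      lintegral_image_eq_lintegral_abs_deriv_mul measurableSet_Ioo hder hinj,
      ← lintegral_const_mul _ (by fun_prop)]
    refine setLIntegral_congr_fun measurableSet_Ioo fun θ hθ => ?_
    obtain ⟨h, h'⟩ := hpos θ hθ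
    rw [← ENNReal.ofReal_mul (abs_nonneg _), ← ENNReal.ofReal_mul (by norm_num)]
    congr 1
    have e1 : (1 - Real.cos θ ^ 2 : ℝ) ^ ((1 / 2 : ℝ) - 1) = (Real.sin θ)⁻¹ := by
      rw [← Real.sin_sq, ← Real.rpow_natCast, ← Real.rpow_mul h'.le, ← Real.rpow_neg_one]
      congr 1; norm_num
    have e2 : (Real.cos θ ^ 2) ^ ((p + 1) / 2 - 1) = Real.cos θ ^ p * (Real.cos θ)⁻¹ := by
      rw [← Real.rpow_natCast, ← Real.rpow_mul h.le, ← Real.rpow_neg_one, ← Real.rpow_add h]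
      congr 1; push_cast; ring
    rw [e1, e2, abs_of_pos h, abs_mul, abs_neg, abs_of_pos h', abs_mul, abs_of_pos h]
    norm_num
    field_simp
  rw [h1, intervalIntegral.integral_of_le (by positivity), integral_Ioc_eq_integral_Ioo,
    integral_eq_lintegral_of_nonneg_ae (Eventually.of_forall fun θ => by positivity)
      hc.aestronglyMeasurable, h2, ENNReal.toReal_ofReal]
  · field_simp
  · have := ullmanConst_pos hp
    positivity

lemma ofReal_arcosh_le (r : ℝ) :
    ENNReal.ofReal (Real.arcosh (max r 1)) ≤
      ∫⁻ t in Set.Ioi (1 : ℝ), ENNReal.ofReal (if t < r then (Real.sqrt (t ^ 2 - 1))⁻¹ else 0) := by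
  rcases le_or_gt r 1 with hr | hr
  · simp [max_eq_right hr]
  rw [max_eq_left hr.le]
  have hcont : ContinuousOn Real.arcosh (Set.Icc 1 r) :=
    Real.continuousOn_arcosh.mono Set.Icc_subset_Ici_self
  have hder : ∀ t ∈ Set.Ioo 1 r, HasDerivAt Real.arcosh ((Real.sqrt (t ^ 2 - 1))⁻¹) t :=
    fun t ht => Real.hasDerivAt_arcosh ht.1
  have hInt := intervalIntegral.integrableOn_deriv_of_nonneg hcont hder
    fun t _ => by positivity
  have h := intervalIntegral.integral_eq_sub_of_hasDerivAt_of_le hr.le hcont hder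
    ((intervalIntegrable_iff_integrableOn_Ioc_of_le hr.le).2 hInt)
  rw [Real.arcosh_zero, sub_zero] at h
  rw [← h, intervalIntegral.integral_of_le hr.le, integral_Ioc_eq_integral_Ioo,
    ofReal_integral_eq_lintegral_ofReal (hInt.mono_set Set.Ioo_subset_Ioc_self)
      (Eventually.of_forall fun t => by positivity)]
  refine le_trans (le_of_eq ?_) (lintegral_mono_set (Set.Ioo_subset_Ioi_self : Set.Ioo 1 r ⊆ Set.Ioi 1))
  refine setLIntegral_congr_fun measurableSet_Ioo fun t ht => ?_
  simp only [if_pos ht.2]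

lemma sum_arcosh_le {p c : ℝ} (hp : 0 < p) (hc : 0 < c) (x : ℝ) (J : ℕ) :
    ∑ j ∈ Finset.range J, Real.arcosh (max (|x| / (c * (j + 1)) ^ (1 / p)) 1) ≤
      ullmanConst p * (|x| ^ p / c) := by
  have hg := ullmanConst_pos hp
  rw [← ENNReal.ofReal_le_ofReal_iff (by positivity),
    ENNReal.ofReal_sum_of_nonneg fun j _ => Real.arcosh_nonneg (le_max_right _ _)]
  refine (Finset.sum_le_sum fun j _ => ofReal_arcosh_le _).trans ?_
  rw [← lintegral_finsetSum' _ fun j _ => by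
      refine (Measurable.ennreal_ofReal ?_).aemeasurable
      exact Measurable.ite measurableSet_Iio (by fun_prop) measurable_const,
    mul_comm, ENNReal.ofReal_mul (by positivity), ← lintegral_rpow_neg_mul_inv_sqrt hp,
    ← lintegral_const_mul _ (by fun_prop)]
  refine setLIntegral_mono' measurableSet_Ioi fun t (ht : 1 < t) => ?_
  have ht0 : 0 < t := by linarith
  rw [← ENNReal.ofReal_sum_of_nonneg (fun j _ => by split_ifs <;> positivity),
    ← ENNReal.ofReal_mul (by positivity)]
  refine ENNReal.ofReal_le_ofReal ?_
  rw [← Finset.sum_filter, Finset.sum_const, nsmul_eq_mul, ← mul_assoc]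
  refine mul_le_mul_of_nonneg_right ?_ (by positivity)
  have hy : 0 ≤ |x| ^ p / c * t ^ (-p) := by positivity
  refine le_trans ?_ (Nat.floor_le hy)
  norm_cast
  rw [← Finset.card_range ⌊|x| ^ p / c * t ^ (-p)⌋₊]
  refine Finset.card_le_card fun j hj => ?_
  rw [Finset.mem_filter] at hj
  have hj' := hj.2
  rw [Finset.mem_range, Nat.lt_iff_add_one_le, Nat.le_floor_iff hy]
  rw [lt_div_iff₀ (by positivity)] at hj'
  have h1 := Real.rpow_lt_rpow (by positivity) hj' hp
  rw [Real.mul_rpow ht0.le (by positivity), ← Real.rpow_mul (by positivity), one_div_mul_cancel hp.ne',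
    Real.rpow_one] at h1
  rw [Real.rpow_neg ht0.le, ← div_eq_mul_inv, le_div_iff₀ (by positivity), le_div_iff₀ hc]
  push_cast at h1 ⊢
  nlinarith [h1]

lemma exists_monic_le_exp_arcosh {s : ℝ} (hs : 0 < s) (m : ℕ) :
    ∃ P : Polynomial ℝ, P.Monic ∧ P.natDegree = m ∧ ∀ x,
      |P.eval x| ≤ 2 * (s / 2) ^ m * Real.exp (m * Real.arcosh (max (|x| / s) 1)) := by
  rcases Nat.eq_zero_or_pos m with rfl | hm
  · exact ⟨1, Polynomial.monic_one, by simp, fun x => by norm_num⟩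
  set Q : Polynomial ℝ := (Polynomial.Chebyshev.T ℝ m).comp (Polynomial.C s⁻¹ * Polynomial.X)
  have hX : (Polynomial.C s⁻¹ * Polynomial.X : Polynomial ℝ).natDegree = 1 :=
    Polynomial.natDegree_C_mul_X _ (by positivity)
  have hQd : Q.natDegree = m := by
    rw [Polynomial.natDegree_comp, hX, Polynomial.Chebyshev.natDegree_T]; simp
  have hQl : Q.leadingCoeff = 2 ^ (m - 1) * s⁻¹ ^ m := by
    rw [Polynomial.leadingCoeff_comp (by rw [hX]; exact one_ne_zero),
      Polynomial.Chebyshev.leadingCoeff_T, Polynomial.Chebyshev.natDegree_T,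
      Polynomial.leadingCoeff_C_mul_X]
    simp
  have hcne : 2 * (s / 2) ^ m ≠ 0 := by positivity
  refine ⟨Polynomial.C (2 * (s / 2) ^ m) * Q, ?_, ?_, fun x => ?_⟩
  · rw [Polynomial.Monic, Polynomial.leadingCoeff_mul, Polynomial.leadingCoeff_C, hQl]
    obtain ⟨k, rfl⟩ := Nat.exists_eq_succ_of_ne_zero hm.ne'
    simp only [Nat.succ_eq_add_one, Nat.add_sub_cancel, div_pow, inv_pow]
    field_simp
    ring
  · rw [Polynomial.natDegree_C_mul hcne, hQd]
  · rw [Polynomial.eval_mul, Polynomial.eval_C, abs_mul, abs_of_pos (by positivity)]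
    refine mul_le_mul_of_nonneg_left ?_ (by positivity)
    have hev : Q.eval x = (Polynomial.Chebyshev.T ℝ m).eval (x / s) := by
      simp [Q, Polynomial.eval_comp, div_eq_inv_mul]
    rw [hev]
    have habs : |x / s| = |x| / s := by rw [abs_div, abs_of_pos hs]
    rcases le_or_gt (|x / s|) 1 with h | h
    · rw [← habs, max_eq_right h, Real.arcosh_zero]
      simpa using Polynomial.Chebyshev.abs_eval_T_real_le_one m h
    · rw [← habs, max_eq_left h.le]
      have hpos : ∀ y : ℝ, 1 < y → |(Polynomial.Chebyshev.T ℝ m).eval y| ≤ Real.exp (m * Real.arcosh y) := by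
        intro y hy
        have h0 := Real.arcosh_nonneg hy.le
        conv_lhs => rw [← Real.cosh_arcosh hy.le]
        rw [Polynomial.Chebyshev.T_real_cosh, abs_of_pos (Real.cosh_pos _), Real.cosh_eq]
        push_cast
        have : Real.exp (-(m * Real.arcosh y)) ≤ Real.exp (m * Real.arcosh y) :=
          Real.exp_le_exp.2 (by nlinarith [mul_nonneg (Nat.cast_nonneg (α := ℝ) m) h0])
        linarith
      rcases lt_abs.1 h with h' | h'
      · rw [abs_of_pos (by linarith : 0 < x / s)]
        exact hpos _ h'
      · rw [abs_of_neg (by linarith : x / s < 0)]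
        have := hpos _ h'
        rw [Polynomial.Chebyshev.T_eval_neg, abs_mul] at this
        have hu : |((m : ℤ).negOnePow : ℝ)| = 1 := by
          rcases Int.units_eq_one_or ((m : ℤ).negOnePow) with h | h <;> simp [h]
        rwa [hu, one_mul] at this

lemma exists_monic_blocks_le {p c : ℝ} (hp : 0 < p) (hc : 0 < c) {m : ℕ} (hm : 0 < m) (J : ℕ) :
    ∃ P : Polynomial ℝ, P.Monic ∧ P.natDegree = m * J ∧ ∀ x, |P.eval x| ≤
      2 ^ J * (∏ i ∈ Finset.range (m * J), (c * ((i + m) / m)) ^ (1 / p) / 2) *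
        Real.exp (m * ∑ j ∈ Finset.range J, Real.arcosh (max (|x| / (c * (j + 1)) ^ (1 / p)) 1)) := by
  induction J with
  | zero => exact ⟨1, Polynomial.monic_one, by simp, fun x => by simp⟩
  | succ J ih =>
    obtain ⟨P, hP, hPd, hPb⟩ := ih
    have hs : 0 < (c * ((J : ℝ) + 1)) ^ (1 / p) := by positivity
    obtain ⟨Q, hQ, hQd, hQb⟩ := exists_monic_le_exp_arcosh hs m
    refine ⟨P * Q, hP.mul hQ, by rw [hP.natDegree_mul hQ, hPd, hQd, mul_add, mul_one], fun x => ?_⟩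
    rw [Polynomial.eval_mul, abs_mul, Finset.sum_range_succ, mul_add (m : ℝ), Real.exp_add, mul_add m J 1, mul_one,
      Finset.prod_range_add, pow_succ]
    have hb : ((c * ((J : ℝ) + 1)) ^ (1 / p) / 2) ^ m ≤
        ∏ l ∈ Finset.range m, (c * ((((m * J + l : ℕ) : ℝ) + m) / m)) ^ (1 / p) / 2 := by
      rw [show ((c * ((J : ℝ) + 1)) ^ (1 / p) / 2) ^ m =
        ∏ _l ∈ Finset.range m, (c * ((J : ℝ) + 1)) ^ (1 / p) / 2 by
          rw [Finset.prod_const, Finset.card_range]]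
      refine Finset.prod_le_prod (fun _ _ => by positivity) fun l _ => ?_
      have : (J : ℝ) + 1 ≤ (((m * J + l : ℕ) : ℝ) + m) / m := by
        rw [le_div_iff₀ (by positivity)]
        push_cast
        nlinarith [Nat.cast_nonneg (α := ℝ) l]
      gcongr
    calc |P.eval x| * |Q.eval x| ≤ _ * _ := mul_le_mul (hPb x) (hQb x) (abs_nonneg _) (by positivity)
      _ = 2 ^ J * 2 * ((∏ i ∈ Finset.range (m * J), (c * ((i + m) / m)) ^ (1 / p) / 2) *
          ((c * ((J : ℝ) + 1)) ^ (1 / p) / 2) ^ m) *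
          (Real.exp (m * ∑ j ∈ Finset.range J, Real.arcosh (max (|x| / (c * (j + 1)) ^ (1 / p)) 1)) *
          Real.exp (m * Real.arcosh (max (|x| / (c * (J + 1)) ^ (1 / p)) 1))) := by ring
      _ ≤ _ := by gcongr

/-- A weighted sup-norm bound attained by products of Chebyshev polynomials of several scales. -/
def chebBound (p b : ℝ) (m k : ℕ) : ℝ :=
  2 ^ (k / m + 1) * ∏ i ∈ Finset.range k, (b * ullmanConst p * (i + m)) ^ (1 / p) / 2

lemma chebBound_pos {p b : ℝ} (hp : 0 < p) (hb : 0 < b) {m : ℕ} (hm : 0 < m) (k : ℕ) :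
    0 < chebBound p b m k := by
  have := ullmanConst_pos hp
  unfold chebBound
  positivity

lemma exists_monic_le_chebBound {p b : ℝ} (hp : 0 < p) (hb : 0 < b) {m : ℕ} (hm : 0 < m) (k : ℕ) :
    ∃ P : Polynomial ℝ, P.Monic ∧ P.natDegree = k ∧ ∀ x,
      |P.eval x| ≤ chebBound p b m k * Real.exp (|x| ^ p / b) := by
  have hg := ullmanConst_pos hp
  have hm' : (0 : ℝ) < m := by exact_mod_cast hm
  set c : ℝ := b * ullmanConst p * m with hcdef
  have hc : 0 < c := by positivity
  set J := k / m with hJ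
  have hk : m * J + k % m = k := Nat.div_add_mod k m
  obtain ⟨P, hP, hPd, hPb⟩ := exists_monic_blocks_le hp hc hm J
  have hs : 0 < (c * ((J : ℝ) + 1)) ^ (1 / p) := by positivity
  obtain ⟨Q, hQ, hQd, hQb⟩ := exists_monic_le_exp_arcosh hs (k % m)
  refine ⟨P * Q, hP.mul hQ, by rw [hP.natDegree_mul hQ, hPd, hQd, hk], fun x => ?_⟩
  have hcb : ∀ i : ℕ, (c * (((i : ℝ) + m) / m)) = b * ullmanConst p * (i + m) := fun i => by
    rw [hcdef]; field_simp
  have hbd : ((c * ((J : ℝ) + 1)) ^ (1 / p) / 2) ^ (k % m) ≤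
      ∏ l ∈ Finset.range (k % m), (c * ((((m * J + l : ℕ) : ℝ) + m) / m)) ^ (1 / p) / 2 := by
    rw [show ((c * ((J : ℝ) + 1)) ^ (1 / p) / 2) ^ (k % m) =
      ∏ _l ∈ Finset.range (k % m), (c * ((J : ℝ) + 1)) ^ (1 / p) / 2 by
        rw [Finset.prod_const, Finset.card_range]]
    refine Finset.prod_le_prod (fun _ _ => by positivity) fun l _ => ?_
    have : (J : ℝ) + 1 ≤ (((m * J + l : ℕ) : ℝ) + m) / m := by
      rw [le_div_iff₀ (by positivity)]
      push_cast
      nlinarith [Nat.cast_nonneg (α := ℝ) l]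
    gcongr
  have hprod : ∏ i ∈ Finset.range k, (b * ullmanConst p * (i + m)) ^ (1 / p) / 2 =
      (∏ i ∈ Finset.range (m * J), (c * ((i + m) / m)) ^ (1 / p) / 2) *
      ∏ l ∈ Finset.range (k % m), (c * ((((m * J + l : ℕ) : ℝ) + m) / m)) ^ (1 / p) / 2 := by
    conv_lhs => rw [← hk]
    rw [Finset.prod_range_add]
    simp only [hcb]
  have hexp : Real.exp (m * ∑ j ∈ Finset.range J, Real.arcosh (max (|x| / (c * (j + 1)) ^ (1 / p)) 1)) *
      Real.exp ((k % m : ℕ) * Real.arcosh (max (|x| / (c * (J + 1)) ^ (1 / p)) 1)) ≤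
      Real.exp (|x| ^ p / b) := by
    rw [← Real.exp_add, Real.exp_le_exp]
    have h0 : 0 ≤ Real.arcosh (max (|x| / (c * (J + 1)) ^ (1 / p)) 1) :=
      Real.arcosh_nonneg (le_max_right _ _)
    have h1 : ((k % m : ℕ) : ℝ) ≤ m := by exact_mod_cast (Nat.mod_lt k hm).le
    have h2 := sum_arcosh_le hp hc x (J + 1)
    rw [Finset.sum_range_succ] at h2
    have h3 : m * (ullmanConst p * (|x| ^ p / c)) = |x| ^ p / b := by
      rw [hcdef]; field_simp
    nlinarith [mul_le_mul_of_nonneg_right h1 h0, mul_le_mul_of_nonneg_left h2 hm'.le]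
  rw [Polynomial.eval_mul, abs_mul, chebBound, hprod]
  calc |P.eval x| * |Q.eval x| ≤ _ * _ := mul_le_mul (hPb x) (hQb x) (abs_nonneg _) (by positivity)
    _ = 2 ^ (J + 1) * ((∏ i ∈ Finset.range (m * J), (c * ((i + m) / m)) ^ (1 / p) / 2) *
        ((c * ((J : ℝ) + 1)) ^ (1 / p) / 2) ^ (k % m)) *
        (Real.exp (m * ∑ j ∈ Finset.range J, Real.arcosh (max (|x| / (c * (j + 1)) ^ (1 / p)) 1)) *
        Real.exp ((k % m : ℕ) * Real.arcosh (max (|x| / (c * (J + 1)) ^ (1 / p)) 1))) := by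
      rw [pow_succ]; ring
    _ ≤ _ := by gcongr

lemma abs_det_vandermonde_le {p b : ℝ} (hp : 0 < p) (hb : 0 < b) {m : ℕ} (hm : 0 < m) {n : ℕ}
    (x : Fin n → ℝ) : |(vandermonde x).det| ≤
      n.factorial * (∏ k ∈ Finset.range n, chebBound p b m k) * Real.exp ((∑ i, |x i| ^ p) / b) := by
  choose P hP hPd hPb using exists_monic_le_chebBound hp hb hm
  rw [det_eval_matrixOfPolynomials_eq_det_vandermonde x (fun k : Fin n => P k) (fun i => hPd i)
    fun i => hP i, det_apply]
  refine (Finset.abs_sum_le_sum_abs _ _).trans ?_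
  have : ∀ σ ∈ (Finset.univ : Finset (Equiv.Perm (Fin n))),
      |Equiv.Perm.sign σ • ∏ i, (Matrix.of fun i j : Fin n => (P j).eval (x i)) (σ i) i| ≤
      (∏ k ∈ Finset.range n, chebBound p b m k) * Real.exp ((∑ i, |x i| ^ p) / b) := by
    intro σ _
    have h1 : |Equiv.Perm.sign σ • ∏ i, (Matrix.of fun i j : Fin n => (P j).eval (x i)) (σ i) i| =
        ∏ i : Fin n, |(P i).eval (x (σ i))| := by
      rcases Int.units_eq_one_or (Equiv.Perm.sign σ) with h | h <;>
        simp [h, Finset.abs_prod, Units.smul_def]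
    rw [h1, ← Fin.prod_univ_eq_prod_range, Finset.sum_div, Real.exp_sum,
      ← Equiv.prod_comp σ (fun i => Real.exp (|x i| ^ p / b)), ← Finset.prod_mul_distrib]
    exact Finset.prod_le_prod (fun _ _ => abs_nonneg _) fun i _ => hPb i _
  refine (Finset.sum_le_sum this).trans (le_of_eq ?_)
  rw [Finset.sum_const, Finset.card_univ, Fintype.card_perm, Fintype.card_fin, nsmul_eq_mul, mul_assoc]

lemma det_vandermonde_smul {n : ℕ} (c : ℝ) (x : Fin n → ℝ) :
    (vandermonde (c • x)).det = c ^ (n * (n - 1) / 2) * (vandermonde x).det := by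
  have : vandermonde (c • x) = Matrix.of fun i j : Fin n => c ^ (j : ℕ) * vandermonde x i j := by
    ext i j
    simp [vandermonde_apply, mul_pow]
  rw [this, det_mul_row, Finset.prod_pow_eq_pow_sum, Fin.sum_univ_eq_sum_range (fun i => i) n,
    Finset.sum_range_id]

lemma abs_det_vandermonde_rpow_le {p b τ : ℝ} (hp : 0 < p) (hb : 0 < b) (hτ : 0 < τ) {m : ℕ} (hm : 0 < m)
    {n : ℕ} (x : Fin n → ℝ) (hx : ∑ i, |x i| ^ p ≤ 1) : |(vandermonde x).det| ^ b ≤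
      (n.factorial * ∏ k ∈ Finset.range n, chebBound p b m k) ^ b * Real.exp τ *
        τ ^ (-(b * (n * (n - 1) / 2 : ℕ) / p)) := by
  have hM : 0 < ∏ k ∈ Finset.range n, chebBound p b m k :=
    Finset.prod_pos fun k _ => chebBound_pos hp hb hm k
  have h := abs_det_vandermonde_le hp hb hm (τ ^ (1 / p) • x)
  have hs : ∑ i, |(τ ^ (1 / p) • x) i| ^ p = τ * ∑ i, |x i| ^ p := by
    rw [Finset.mul_sum]
    refine Finset.sum_congr rfl fun i _ => ?_
    rw [Pi.smul_apply, smul_eq_mul, abs_mul, abs_of_pos (by positivity), Real.mul_rpow (by positivity)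
      (abs_nonneg _), ← Real.rpow_mul hτ.le, one_div_mul_cancel hp.ne', Real.rpow_one]
  rw [hs, det_vandermonde_smul, abs_mul, abs_of_pos (by positivity)] at h
  have h2 := h.trans (mul_le_mul_of_nonneg_left (Real.exp_le_exp.2
    (div_le_div_of_nonneg_right (mul_le_of_le_one_right hτ.le hx) hb.le)) (by positivity))
  have h3 := Real.rpow_le_rpow (by positivity) h2 hb.le
  rw [Real.mul_rpow (by positivity) (abs_nonneg _), Real.mul_rpow (by positivity) (by positivity),
    ← Real.exp_mul, div_mul_cancel₀ _ hb.ne', ← Real.rpow_natCast, ← Real.rpow_mul hτ.le,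
    ← Real.rpow_mul hτ.le] at h3
  have e : τ ^ (1 / p * (n * (n - 1) / 2 : ℕ) * b) = (τ ^ (-(b * (n * (n - 1) / 2 : ℕ) / p)))⁻¹ := by
    rw [← Real.rpow_neg hτ.le]; congr 1; ring
  rw [e, inv_mul_le_iff₀ (by positivity)] at h3
  linarith

lemma exists_mul_eq_one_add_eq (u : ℝ) : ∃ a b : ℂ, a * b = 1 ∧ a + b = 2 * u := by
  obtain ⟨w, hw⟩ := IsAlgClosed.exists_pow_nat_eq ((u : ℂ) ^ 2 - 1) (n := 2) (by norm_num)
  exact ⟨u + w, u - w, by linear_combination -hw, by ring⟩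

lemma log_norm_sub_add_log_norm_sub {a b : ℂ} {u : ℝ} (hab : a * b = 1) (hs : a + b = 2 * u) {θ : ℝ}
    (ha : circleMap 0 1 θ ≠ a) (hb : circleMap 0 1 θ ≠ b) :
    Real.log ‖circleMap 0 1 θ - a‖ + Real.log ‖circleMap 0 1 θ - b‖ =
      Real.log 2 + Real.log |u - Real.cos θ| := by
  have h1 : (circleMap 0 1 θ - a) * (circleMap 0 1 θ - b) =
      circleMap 0 1 θ * (2 * (Real.cos θ - u : ℝ)) := by
    have hz : circleMap 0 1 θ = Complex.cos θ + Complex.sin θ * Complex.I := by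
      simp [circleMap, Complex.exp_mul_I]
    push_cast
    rw [hz]
    linear_combination (Complex.cos θ + Complex.sin θ * Complex.I) * (-hs) + hab
      - Complex.sin_sq_add_cos_sq θ + Complex.sin θ ^ 2 * Complex.I_sq
  have h2 : ‖circleMap 0 1 θ - a‖ * ‖circleMap 0 1 θ - b‖ = 2 * |u - Real.cos θ| := by
    rw [← norm_mul, h1, norm_mul, norm_circleMap_zero, norm_mul, Complex.norm_real, Real.norm_eq_abs,
      abs_sub_comm]
    simp
  have ha' : ‖circleMap 0 1 θ - a‖ ≠ 0 := norm_ne_zero_iff.2 (sub_ne_zero.2 ha)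
  have hb' : ‖circleMap 0 1 θ - b‖ ≠ 0 := norm_ne_zero_iff.2 (sub_ne_zero.2 hb)
  have h3 : |u - Real.cos θ| ≠ 0 := fun h => (mul_ne_zero ha' hb') (by rw [h2, h, mul_zero])
  rw [← Real.log_mul ha' hb', h2, Real.log_mul two_ne_zero h3]

lemma ae_log_norm_sub_add_log_norm_sub {a b : ℂ} {u : ℝ} (hab : a * b = 1) (hs : a + b = 2 * u) :
    ∀ᵐ θ : ℝ, Real.log ‖circleMap 0 1 θ - a‖ + Real.log ‖circleMap 0 1 θ - b‖ =
      Real.log 2 + Real.log |u - Real.cos θ| := by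
  have h : ∀ c : ℂ, ∀ᵐ θ : ℝ, circleMap 0 1 θ ≠ c := fun c =>
    ((Set.countable_singleton c).preimage_circleMap 0 one_ne_zero).ae_notMem volume
  filter_upwards [h a, h b] with θ ha hb using log_norm_sub_add_log_norm_sub hab hs ha hb

lemma intervalIntegrable_log_abs_sub_cos (u : ℝ) :
    IntervalIntegrable (fun θ => Real.log |u - Real.cos θ|) volume 0 (2 * Real.pi) := by
  obtain ⟨a, b, hab, hs⟩ := exists_mul_eq_one_add_eq u
  have h := ((circleIntegrable_log_norm_sub_const (a := a) (c := 0) 1).add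
    (circleIntegrable_log_norm_sub_const (a := b) (c := 0) 1))
  have h2 : IntervalIntegrable (fun θ => Real.log 2 + Real.log |u - Real.cos θ|) volume 0 (2 * Real.pi) :=
    IntervalIntegrable.congr_ae h (ae_restrict_of_ae (ae_log_norm_sub_add_log_norm_sub hab hs))
  simpa using h2.sub (intervalIntegrable_const (c := Real.log 2))

lemma integral_log_abs_sub_cos_ge (u : ℝ) :
    -Real.log 2 * Real.pi ≤ ∫ θ in 0..Real.pi, Real.log |u - Real.cos θ| := by
  obtain ⟨a, b, hab, hs⟩ := exists_mul_eq_one_add_eq u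
  have hi := intervalIntegrable_log_abs_sub_cos u
  have hpi := Real.pi_pos
  have i1 : IntervalIntegrable (fun θ => Real.log |u - Real.cos θ|) volume 0 Real.pi :=
    hi.mono_set (by rw [Set.uIcc_of_le hpi.le, Set.uIcc_of_le (by linarith)]; exact Set.Icc_subset_Icc_right (by linarith))
  have i2 : IntervalIntegrable (fun θ => Real.log |u - Real.cos θ|) volume Real.pi (2 * Real.pi) :=
    hi.mono_set (by rw [Set.uIcc_of_le (by linarith), Set.uIcc_of_le (by linarith)]; exact Set.Icc_subset_Icc_left (by linarith))
  have h1 : ∫ θ in 0..(2 * Real.pi), Real.log |u - Real.cos θ| =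
      2 * ∫ θ in 0..Real.pi, Real.log |u - Real.cos θ| := by
    rw [← intervalIntegral.integral_add_adjacent_intervals i1 i2]
    have := intervalIntegral.integral_comp_sub_left (a := 0) (b := Real.pi)
      (fun θ => Real.log |u - Real.cos θ|) (2 * Real.pi)
    simp only [Real.cos_two_pi_sub, sub_zero] at this
    rw [show 2 * Real.pi - Real.pi = Real.pi by ring] at this
    rw [← this]; ring
  have h2 : Real.circleAverage (fun z => Real.log ‖z - a‖ + Real.log ‖z - b‖) 0 1 =
      Real.posLog ‖a‖ + Real.posLog ‖b‖ := by
    rw [← circleAverage_log_norm_sub_const_eq_posLog, ← circleAverage_log_norm_sub_const_eq_posLog]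
    exact Real.circleAverage_add (circleIntegrable_log_norm_sub_const 1) (circleIntegrable_log_norm_sub_const 1)
  have h3 : 0 ≤ Real.circleAverage (fun z => Real.log ‖z - a‖ + Real.log ‖z - b‖) 0 1 := by
    rw [h2]; exact add_nonneg Real.posLog_nonneg Real.posLog_nonneg
  rw [Real.circleAverage_def, intervalIntegral.integral_congr_ae
    (g := fun θ => Real.log 2 + Real.log |u - Real.cos θ|)
    (by filter_upwards [ae_log_norm_sub_add_log_norm_sub hab hs] with θ h _ using h),
    intervalIntegral.integral_add intervalIntegrable_const hi, h1, smul_eq_mul,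
    intervalIntegral.integral_const, smul_eq_mul] at h3
  have h4 := nonneg_of_mul_nonneg_right h3 (by positivity)
  linarith

lemma ofReal_integral_le_lintegral {α : Type*} [MeasurableSpace α] {μ : Measure α} {f : α → ℝ}
    (hf : Integrable f μ) : ENNReal.ofReal (∫ x, f x ∂μ) ≤ ∫⁻ x, ENNReal.ofReal (f x) ∂μ := by
  calc ENNReal.ofReal (∫ x, f x ∂μ) ≤ ENNReal.ofReal (∫ x, max (f x) 0 ∂μ) :=
        ENNReal.ofReal_le_ofReal (integral_mono hf hf.pos_part fun x => le_max_left _ _)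
    _ = ∫⁻ x, ENNReal.ofReal (max (f x) 0) ∂μ :=
        ofReal_integral_eq_lintegral_ofReal hf.pos_part (ae_of_all _ fun x => le_max_right _ _)
    _ = _ := by simp

/-- Jensen's inequality for the exponential, with the normalised Lebesgue measure of `[0, π]`. -/
lemma ofReal_exp_average_le {f : ℝ → ℝ} (hf : IntervalIntegrable f volume 0 Real.pi) {m : ℝ}
    (hm : m * Real.pi ≤ ∫ θ in 0..Real.pi, f θ) :
    ENNReal.ofReal (Real.pi * Real.exp m) ≤ ∫⁻ θ in Set.Ioo 0 Real.pi, ENNReal.ofReal (Real.exp (f θ)) := by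
  have hpi := Real.pi_pos
  have hInt : IntervalIntegrable (fun θ => Real.exp m * (1 + (f θ - m))) volume 0 Real.pi :=
    ((intervalIntegrable_const (c := (1 : ℝ))).add (hf.sub (intervalIntegrable_const (c := m)))).const_mul _
  have h1 : Real.pi * Real.exp m ≤ ∫ θ in 0..Real.pi, Real.exp m * (1 + (f θ - m)) := by
    rw [intervalIntegral.integral_const_mul, intervalIntegral.integral_add intervalIntegrable_const
      (hf.sub intervalIntegrable_const), intervalIntegral.integral_sub hf intervalIntegrable_const]
    simp only [intervalIntegral.integral_const, smul_eq_mul, sub_zero, mul_one]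
    nlinarith [Real.exp_pos m]
  rw [intervalIntegral.integral_of_le hpi.le, ← restrict_Ioo_eq_restrict_Ioc] at h1
  refine (ENNReal.ofReal_le_ofReal h1).trans ((ofReal_integral_le_lintegral ?_).trans ?_)
  · exact ((intervalIntegrable_iff_integrableOn_Ioo_of_le hpi.le).1 hInt)
  · refine lintegral_mono fun θ => ENNReal.ofReal_le_ofReal ?_
    calc Real.exp m * (1 + (f θ - m)) ≤ Real.exp m * Real.exp (f θ - m) := by
          gcongr; linarith [Real.add_one_le_exp (f θ - m)]
      _ = _ := by rw [← Real.exp_add]; congr 1; ring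

lemma lintegral_Ioo_comp_cos_le {s : ℝ} (hs : 0 < s) (F : ℝ → ℝ≥0∞) :
    ∫⁻ θ in Set.Ioo 0 Real.pi, ENNReal.ofReal (s * Real.sin θ) * F (s * Real.cos θ) ≤ ∫⁻ x, F x := by
  have h := lintegral_image_eq_lintegral_abs_deriv_mul (s := Set.Ioo 0 Real.pi) measurableSet_Ioo
    (f := fun θ => s * Real.cos θ) (f' := fun θ => s * (-Real.sin θ))
    (fun θ _ => ((Real.hasDerivAt_cos θ).const_mul s).hasDerivWithinAt)
    (fun a ha b hb hab => Real.injOn_cos (Set.Ioo_subset_Icc_self ha) (Set.Ioo_subset_Icc_self hb)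
      (mul_left_cancel₀ hs.ne' hab)) F
  calc _ = ∫⁻ θ in Set.Ioo 0 Real.pi, ENNReal.ofReal |s * (-Real.sin θ)| * F (s * Real.cos θ) := by
        refine setLIntegral_congr_fun measurableSet_Ioo fun θ hθ => ?_
        have := Real.sin_pos_of_mem_Ioo hθ
        rw [mul_neg, abs_neg, abs_of_pos (by positivity)]
    _ = _ := h.symm
    _ ≤ _ := setLIntegral_le_lintegral _ _

/-- One-dimensional lower bound obtained from the arcsine distribution on `[-s, s]`. -/
lemma ofReal_exp_le_lintegral {p b s : ℝ} (hp : 0 < p) (hb : 0 < b) (hs : 0 < s) {k : ℕ} (x : Fin k → ℝ) :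
    ENNReal.ofReal (Real.pi * Real.exp (b * (k * Real.log (s / 2)) - s ^ p / (p * ullmanConst p) +
      Real.log (s / 2))) ≤
    ∫⁻ y : ℝ, ENNReal.ofReal ((∏ i, |x i - y|) ^ b * Real.exp (-|y| ^ p)) := by
  have hpi := Real.pi_pos
  refine le_trans ?_ (lintegral_Ioo_comp_cos_le hs _)
  have hil : ∀ i, IntervalIntegrable (fun θ => Real.log |x i / s - Real.cos θ|) volume 0 Real.pi := fun i =>
    (intervalIntegrable_log_abs_sub_cos (x i / s)).mono_set (by
      rw [Set.uIcc_of_le hpi.le, Set.uIcc_of_le (by linarith)]; exact Set.Icc_subset_Icc_right (by linarith))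
  have hic : IntervalIntegrable (fun θ => |Real.cos θ| ^ p) volume 0 Real.pi :=
    (Continuous.rpow_const (by fun_prop) fun _ => Or.inr hp.le).intervalIntegrable _ _
  have his : IntervalIntegrable (fun θ => Real.log (Real.sin θ)) volume 0 Real.pi :=
    intervalIntegrable_log_sin
  set f : ℝ → ℝ := fun θ => (b * (∑ i, (Real.log s + Real.log |x i / s - Real.cos θ|)) - s ^ p * |Real.cos θ| ^ p)
    + (Real.log s + Real.log (Real.sin θ)) with hf
  have hisum : IntervalIntegrable (fun θ => ∑ i, (Real.log s + Real.log |x i / s - Real.cos θ|)) volume 0 Real.pi := by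
    have := IntervalIntegrable.sum Finset.univ (fun i (_ : i ∈ Finset.univ) =>
      (intervalIntegrable_const (c := Real.log s)).add (hil i))
    refine this.congr ?_
    intro θ _
    simp
  have hfi : IntervalIntegrable f volume 0 Real.pi :=
    ((hisum.const_mul b).sub (hic.const_mul _)).add (intervalIntegrable_const.add his)
  have hm : (b * (k * Real.log (s / 2)) - s ^ p / (p * ullmanConst p) + Real.log (s / 2)) * Real.pi ≤
      ∫ θ in 0..Real.pi, f θ := by
    rw [hf, intervalIntegral.integral_add ((hisum.const_mul b).sub (hic.const_mul _))
      (intervalIntegrable_const.add his), intervalIntegral.integral_sub (hisum.const_mul b) (hic.const_mul _),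
      intervalIntegral.integral_const_mul, intervalIntegral.integral_const_mul, integral_abs_cos_rpow hp,
      intervalIntegral.integral_add intervalIntegrable_const his, integral_log_sin_zero_pi,
      intervalIntegral.integral_finsetSum fun i _ => intervalIntegrable_const.add (hil i)]
    have : ∀ i, (Real.log s - Real.log 2) * Real.pi ≤
        ∫ θ in 0..Real.pi, (Real.log s + Real.log |x i / s - Real.cos θ|) := fun i => by
      rw [intervalIntegral.integral_add intervalIntegrable_const (hil i), intervalIntegral.integral_const,
        smul_eq_mul]
      linarith [integral_log_abs_sub_cos_ge (x i / s)]
    have h2 := Finset.sum_le_sum fun i (_ : i ∈ (Finset.univ : Finset (Fin k))) => this i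
    rw [Finset.sum_const, Finset.card_univ, Fintype.card_fin, nsmul_eq_mul] at h2
    have h3 := mul_le_mul_of_nonneg_left h2 hb.le
    rw [Real.log_div hs.ne' two_ne_zero, intervalIntegral.integral_const, smul_eq_mul]
    have e : s ^ p / (p * ullmanConst p) * Real.pi = s ^ p * (Real.pi / (p * ullmanConst p)) := by ring
    linarith
  refine (ofReal_exp_average_le hfi hm).trans ?_
  have hne : ∀ᵐ θ ∂(volume.restrict (Set.Ioo 0 Real.pi)), ∀ i, x i / s - Real.cos θ ≠ 0 := by
    rw [ae_all_iff]
    intro i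
    rw [ae_restrict_iff' measurableSet_Ioo]
    have hc : ({θ | θ ∈ Set.Ioo 0 Real.pi ∧ Real.cos θ = x i / s} : Set ℝ).Subsingleton :=
      fun a ha b hb => Real.injOn_cos (Set.Ioo_subset_Icc_self ha.1) (Set.Ioo_subset_Icc_self hb.1)
        (ha.2.trans hb.2.symm)
    filter_upwards [hc.countable.ae_notMem volume] with θ hθ hθ' h
    exact hθ ⟨hθ', (sub_eq_zero.1 h).symm⟩
  refine lintegral_mono_ae ?_
  filter_upwards [hne, ae_restrict_mem measurableSet_Ioo] with θ hθ hθ'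
  have hsin := Real.sin_pos_of_mem_Ioo hθ'
  rw [← ENNReal.ofReal_mul (by positivity)]
  refine ENNReal.ofReal_le_ofReal (le_of_eq ?_)
  have e1 : ∏ i, |x i - s * Real.cos θ| = Real.exp (∑ i, (Real.log s + Real.log |x i / s - Real.cos θ|)) := by
    rw [Real.exp_sum]
    refine Finset.prod_congr rfl fun i _ => ?_
    rw [Real.exp_add, Real.exp_log hs, Real.exp_log (abs_pos.2 (hθ i)), ← abs_of_pos hs, ← abs_mul,
      abs_of_pos hs]
    congr 1; field_simp
  rw [e1, ← Real.exp_mul, hf]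
  simp only
  rw [Real.exp_add, Real.exp_add, Real.exp_log hs, Real.exp_log hsin, sub_eq_add_neg, Real.exp_add, abs_mul,
    abs_of_pos hs, Real.mul_rpow hs.le (abs_nonneg _), mul_comm b]
  ring

/-- The integral of `|V|^b` over the unit ball of `ℓ_p^n`. -/
def vdmBall (p b : ℝ) (n : ℕ) : ℝ≥0∞ :=
  ∫⁻ x in {x : Fin n → ℝ | ∑ i, |x i| ^ p ≤ 1}, ENNReal.ofReal (|(vandermonde x).det| ^ b)

/-- The integral of `|V|^b` against the density `exp (-∑ |x i| ^ p)`. -/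
def vdmExp (p b : ℝ) (n : ℕ) : ℝ≥0∞ :=
  ∫⁻ x : Fin n → ℝ, ENNReal.ofReal (|(vandermonde x).det| ^ b * Real.exp (-∑ i, |x i| ^ p))

lemma det_vandermonde_cons {n : ℕ} (y : ℝ) (x : Fin n → ℝ) :
    (vandermonde (Fin.cons y x : Fin (n + 1) → ℝ)).det = (∏ i, (x i - y)) * (vandermonde x).det := by
  rw [det_vandermonde, det_vandermonde, Fin.prod_univ_succ]
  congr 1
  · rw [Fin.prod_Ioi_zero]; simp
  · refine Finset.prod_congr rfl fun i _ => ?_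
    rw [Fin.prod_Ioi_succ]; simp

lemma measurable_det_vandermonde {n : ℕ} : Measurable fun x : Fin n → ℝ => (vandermonde x).det := by
  simp only [det_vandermonde]
  fun_prop

lemma le_vdmExp_succ {p b s : ℝ} (hp : 0 < p) (hb : 0 < b) (hs : 0 < s) (n : ℕ) :
    ENNReal.ofReal (Real.pi * Real.exp (b * (n * Real.log (s / 2)) - s ^ p / (p * ullmanConst p) +
      Real.log (s / 2))) * vdmExp p b n ≤ vdmExp p b (n + 1) := by
  have hV := measurable_det_vandermonde (n := n + 1)
  have hV' := measurable_det_vandermonde (n := n)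
  have e := (volume_preserving_piFinSuccAbove (fun _ : Fin (n + 1) => ℝ) 0).symm
  rw [vdmExp, vdmExp, ← e.lintegral_comp (by fun_prop), Measure.volume_eq_prod,
    lintegral_prod_symm _ (Measurable.aemeasurable ?_), ← lintegral_const_mul _ (by fun_prop)]
  swap
  · exact (by fun_prop : Measurable fun x : Fin (n + 1) → ℝ =>
      ENNReal.ofReal (|(vandermonde x).det| ^ b * Real.exp (-∑ i, |x i| ^ p))).comp
      (MeasurableEquiv.measurable _)
  refine lintegral_mono fun x => ?_
  have h : ∀ y : ℝ, ENNReal.ofReal (|(vandermonde ((MeasurableEquiv.piFinSuccAbove (fun _ : Fin (n + 1) => ℝ) 0).symm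
      (y, x))).det| ^ b * Real.exp (-∑ i, |(MeasurableEquiv.piFinSuccAbove (fun _ : Fin (n + 1) => ℝ) 0).symm
      (y, x) i| ^ p)) = ENNReal.ofReal ((∏ i, |x i - y|) ^ b * Real.exp (-|y| ^ p)) *
      ENNReal.ofReal (|(vandermonde x).det| ^ b * Real.exp (-∑ i, |x i| ^ p)) := fun y => by
    have e1 : (MeasurableEquiv.piFinSuccAbove (fun _ : Fin (n + 1) => ℝ) 0).symm (y, x) =
        (Fin.cons y x : Fin (n + 1) → ℝ) := by
      simp [MeasurableEquiv.piFinSuccAbove, Fin.insertNthEquiv]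
    rw [e1, det_vandermonde_cons, Fin.sum_univ_succ, abs_mul, Finset.abs_prod,
      Real.mul_rpow (by positivity) (by positivity), ← ENNReal.ofReal_mul (by positivity), neg_add, Real.exp_add]
    simp only [Fin.cons_zero, Fin.cons_succ]
    congr 1; ring
  simp_rw [h]
  rw [lintegral_mul_const _ (by fun_prop)]
  gcongr
  exact ofReal_exp_le_lintegral hp hb hs x

lemma le_vdmExp {p b : ℝ} (hp : 0 < p) (hb : 0 < b) (n : ℕ) :
    ENNReal.ofReal (∏ k ∈ Finset.range n, (Real.pi * Real.exp ((b * k + 1) *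
      Real.log ((b * ullmanConst p * (k + 1)) ^ (1 / p) / 2) - b * (k + 1) / p))) ≤ vdmExp p b n := by
  have hg := ullmanConst_pos hp
  induction n with
  | zero =>
    rw [vdmExp, lintegral_unique]
    simp [volume_pi, Measure.pi_empty_univ]
  | succ n ih =>
    refine le_trans ?_ (le_vdmExp_succ hp hb (s := (b * ullmanConst p * (n + 1)) ^ (1 / p)) (by positivity) n)
    rw [Finset.prod_range_succ, mul_comm, ENNReal.ofReal_mul (by positivity)]
    refine mul_le_mul' (le_of_eq ?_) ih
    rw [← Real.rpow_mul (by positivity), one_div_mul_cancel hp.ne', Real.rpow_one]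
    congr 3
    field_simp
    ring

lemma setLIntegral_sum_rpow_le {p b r : ℝ} (hp : 0 < p) (hr : 0 < r) (n : ℕ) :
    ∫⁻ x in {x : Fin n → ℝ | ∑ i, |x i| ^ p ≤ r}, ENNReal.ofReal (|(vandermonde x).det| ^ b) =
      ENNReal.ofReal (r ^ ((b * (n * (n - 1) / 2 : ℕ) + n) / p)) * vdmBall p b n := by
  have hV' := measurable_det_vandermonde (n := n)
  have hR : 0 < r ^ (1 / p) := by positivity
  have hms : ∀ r : ℝ, MeasurableSet {x : Fin n → ℝ | ∑ i, |x i| ^ p ≤ r} := fun r =>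
    measurableSet_le (by fun_prop) measurable_const
  have hmap : Measure.map (fun x : Fin n → ℝ => r ^ (1 / p) • x) volume =
      ENNReal.ofReal ((r ^ (1 / p)) ^ n)⁻¹ • volume := by
    rw [Measure.map_addHaar_smul _ hR.ne', Module.finrank_fin_fun, abs_of_pos (by positivity)]
  have hvol : (volume : Measure (Fin n → ℝ)) = ENNReal.ofReal ((r ^ (1 / p)) ^ n) •
      Measure.map (fun x : Fin n → ℝ => r ^ (1 / p) • x) volume := by
    rw [hmap, smul_smul, ← ENNReal.ofReal_mul (by positivity), mul_inv_cancel₀ (by positivity),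
      ENNReal.ofReal_one, one_smul]
  rw [← lintegral_indicator (hms r), vdmBall, ← lintegral_indicator (hms 1)]
  conv_lhs => rw [hvol]
  rw [lintegral_smul_measure, lintegral_map ((by fun_prop : Measurable _).indicator (hms r)) (by fun_prop)]
  have : ∀ x : Fin n → ℝ, ({x : Fin n → ℝ | ∑ i, |x i| ^ p ≤ r}.indicator
      (fun x => ENNReal.ofReal (|(vandermonde x).det| ^ b)) (r ^ (1 / p) • x)) =
      ENNReal.ofReal (r ^ (b * (n * (n - 1) / 2 : ℕ) / p)) * ({x : Fin n → ℝ | ∑ i, |x i| ^ p ≤ 1}.indicator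
      (fun x => ENNReal.ofReal (|(vandermonde x).det| ^ b)) x) := fun x => by
    have hs : ∑ i, |(r ^ (1 / p) • x) i| ^ p = r * ∑ i, |x i| ^ p := by
      rw [Finset.mul_sum]
      refine Finset.sum_congr rfl fun i _ => ?_
      rw [Pi.smul_apply, smul_eq_mul, abs_mul, abs_of_pos (by positivity), Real.mul_rpow (by positivity)
        (abs_nonneg _), ← Real.rpow_mul hr.le, one_div_mul_cancel hp.ne', Real.rpow_one]
    by_cases hx : ∑ i, |x i| ^ p ≤ 1
    · rw [Set.indicator_of_mem, Set.indicator_of_mem (by exact hx), ← ENNReal.ofReal_mul (by positivity),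
        det_vandermonde_smul, abs_mul, abs_of_pos (by positivity), Real.mul_rpow (by positivity) (abs_nonneg _),
        ← Real.rpow_natCast, ← Real.rpow_mul hr.le, ← Real.rpow_mul hr.le]
      · congr 3; ring
      · rw [Set.mem_ofPred_eq, hs]; exact mul_le_of_le_one_right hr.le hx
    · rw [Set.indicator_of_notMem, Set.indicator_of_notMem (by exact hx), mul_zero]
      rw [Set.mem_ofPred_eq, hs, not_le]
      exact lt_mul_of_one_lt_right hr (not_le.1 hx)
  simp_rw [this]
  rw [lintegral_const_mul _ ((by fun_prop : Measurable _).indicator (hms 1)), smul_eq_mul, ← mul_assoc,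
    ← ENNReal.ofReal_mul (by positivity), ← Real.rpow_natCast, ← Real.rpow_mul hr.le, ← Real.rpow_add hr]
  congr 3; ring

lemma lintegral_exp_neg_mul_rpow {t : ℝ} (ht : 0 ≤ t) :
    ∫⁻ r in Set.Ioi (0 : ℝ), ENNReal.ofReal (Real.exp (-r)) * ENNReal.ofReal (r ^ t) =
      ENNReal.ofReal (Real.Gamma (t + 1)) := by
  have hc := Real.GammaIntegral_convergent (s := t + 1) (by linarith)
  rw [Real.Gamma_eq_integral (by linarith), ofReal_integral_eq_lintegral_ofReal hc]
  · refine setLIntegral_congr_fun measurableSet_Ioi fun r hr => ?_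
    rw [← ENNReal.ofReal_mul (by positivity), add_sub_cancel_right]
  · filter_upwards [ae_restrict_mem measurableSet_Ioi] with r (hr : 0 < r)
    positivity

lemma vdmExp_eq {p b : ℝ} (hp : 0 < p) (hb : 0 < b) (n : ℕ) :
    vdmExp p b n = vdmBall p b n * ENNReal.ofReal (Real.Gamma ((b * (n * (n - 1) / 2 : ℕ) + n) / p + 1)) := by
  have hV' := measurable_det_vandermonde (n := n)
  have h1 : ∀ S : ℝ, 0 ≤ S → ENNReal.ofReal (Real.exp (-S)) =
      ∫⁻ r in Set.Ioi (0 : ℝ), ({r | S ≤ r}.indicator 1 r) * ENNReal.ofReal (Real.exp (-r)) := fun S hS => by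
    have h2 : ∀ r : ℝ, ({r | S ≤ r}.indicator 1 r) * ENNReal.ofReal (Real.exp (-r)) =
        {r | S ≤ r}.indicator (fun r => ENNReal.ofReal (Real.exp (-r))) r := fun r => by
      by_cases h : S ≤ r <;> simp [Set.indicator, h]
    simp_rw [h2]
    rw [setLIntegral_indicator (s := {r | S ≤ r}) (measurableSet_le measurable_const measurable_id), ← integral_exp_neg_Ioi S,
      ofReal_integral_eq_lintegral_ofReal (integrableOn_exp_neg_Ioi S) (ae_of_all _ fun _ => (Real.exp_pos _).le)]
    refine setLIntegral_congr ?_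
    have h3 : ({r | S ≤ r} ∩ Set.Ioi 0 : Set ℝ) =ᵐ[volume] (Set.Ici S ∩ Set.Ici 0 : Set ℝ) :=
      (ae_eq_set_inter (ae_eq_refl (Set.Ici S)) Ioi_ae_eq_Ici)
    rw [Set.Ici_inter_Ici, max_eq_left hS] at h3
    exact (h3.trans Ioi_ae_eq_Ici.symm).symm
  have hm : Measurable fun z : (Fin n → ℝ) × ℝ => ({z : (Fin n → ℝ) × ℝ | ∑ i, |z.1 i| ^ p ≤ z.2}.indicator
      (1 : (Fin n → ℝ) × ℝ → ℝ≥0∞) z) :=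
    measurable_one.indicator (measurableSet_le (by fun_prop) (by fun_prop))
  calc vdmExp p b n = ∫⁻ x : Fin n → ℝ, ∫⁻ r in Set.Ioi (0 : ℝ), ENNReal.ofReal (|(vandermonde x).det| ^ b) *
        (({z : (Fin n → ℝ) × ℝ | ∑ i, |z.1 i| ^ p ≤ z.2}.indicator 1 (x, r)) *
          ENNReal.ofReal (Real.exp (-r))) := by
        refine lintegral_congr fun x => ?_
        rw [ENNReal.ofReal_mul (by positivity), h1 _ (Finset.sum_nonneg fun i _ => by positivity),
          lintegral_const_mul' _ _ ENNReal.ofReal_ne_top]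
        rfl
    _ = ∫⁻ r in Set.Ioi (0 : ℝ), ∫⁻ x : Fin n → ℝ, ENNReal.ofReal (|(vandermonde x).det| ^ b) *
        (({z : (Fin n → ℝ) × ℝ | ∑ i, |z.1 i| ^ p ≤ z.2}.indicator 1 (x, r)) *
          ENNReal.ofReal (Real.exp (-r))) := by
        refine lintegral_lintegral_swap (Measurable.aemeasurable ?_)
        have hV2 : Measurable fun z : (Fin n → ℝ) × ℝ => (vandermonde z.1).det := hV'.comp measurable_fst
        exact (by fun_prop : Measurable fun z : (Fin n → ℝ) × ℝ =>
          ENNReal.ofReal (|(vandermonde z.1).det| ^ b)).mul (hm.mul (by fun_prop))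
    _ = ∫⁻ r in Set.Ioi (0 : ℝ), (ENNReal.ofReal (Real.exp (-r)) *
          ENNReal.ofReal (r ^ ((b * (n * (n - 1) / 2 : ℕ) + n) / p))) * vdmBall p b n := by
        refine setLIntegral_congr_fun measurableSet_Ioi fun r (hr : 0 < r) => ?_
        rw [mul_assoc, ← setLIntegral_sum_rpow_le hp hr, ← lintegral_const_mul' _ _ ENNReal.ofReal_ne_top,
          ← lintegral_indicator (measurableSet_le (by fun_prop) measurable_const)]
        refine lintegral_congr fun x => ?_
        by_cases h : ∑ i, |x i| ^ p ≤ r <;> simp [Set.indicator, h, mul_comm]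
    _ = _ := by
        rw [lintegral_mul_const _ (by fun_prop), lintegral_exp_neg_mul_rpow (by positivity), mul_comm]

lemma vdmBall_le {p b τ : ℝ} (hp : 0 < p) (hb : 0 < b) (hτ : 0 < τ) {m : ℕ} (hm : 0 < m) (n : ℕ) :
    vdmBall p b n ≤ ENNReal.ofReal ((n.factorial * ∏ k ∈ Finset.range n, chebBound p b m k) ^ b * Real.exp τ *
        τ ^ (-(b * (n * (n - 1) / 2 : ℕ) / p)) * 2 ^ n) := by
  rw [ENNReal.ofReal_mul' (by positivity)]
  calc vdmBall p b n ≤ ∫⁻ x in {x : Fin n → ℝ | ∑ i, |x i| ^ p ≤ 1}, ENNReal.ofReal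
        ((n.factorial * ∏ k ∈ Finset.range n, chebBound p b m k) ^ b * Real.exp τ *
        τ ^ (-(b * (n * (n - 1) / 2 : ℕ) / p))) :=
        setLIntegral_mono measurable_const fun x hx => ENNReal.ofReal_le_ofReal
          (abs_det_vandermonde_rpow_le hp hb hτ hm x hx)
    _ ≤ _ := by
        rw [setLIntegral_const]
        gcongr
        calc volume {x : Fin n → ℝ | ∑ i, |x i| ^ p ≤ 1} ≤ volume (Set.Icc (-1 : Fin n → ℝ) 1) := by
              refine measure_mono fun x hx => ?_
              have : ∀ i, |x i| ≤ 1 := fun i => by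
                by_contra h
                have h1 : 1 < |x i| ^ p := Real.one_lt_rpow (not_le.1 h) hp
                have h2 := Finset.single_le_sum (f := fun i => |x i| ^ p) (fun i _ => by positivity)
                  (Finset.mem_univ i)
                exact absurd hx (not_le.2 (h1.trans_le h2))
              exact ⟨fun i => (abs_le.1 (this i)).1, fun i => (abs_le.1 (this i)).2⟩
          _ = _ := by
              rw [Real.volume_Icc_pi]
              norm_num [ENNReal.ofReal_pow]

lemma isLittleO_sum_sq {e : ℕ → ℝ} (he : e =o[atTop] fun n : ℕ => (n : ℝ)) :
    (fun n : ℕ => ∑ k ∈ Finset.range n, e k) =o[atTop] fun n : ℕ => (n : ℝ) ^ 2 := by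
  have he' : e =o[atTop] fun n : ℕ => ((n : ℝ) + 1) :=
    he.trans_isBigO (Asymptotics.IsBigO.of_bound 1 (Eventually.of_forall fun n => by
      rw [Real.norm_of_nonneg (by positivity), Real.norm_of_nonneg (by positivity)]; linarith))
  have hs : ∀ n : ℕ, ∑ k ∈ Finset.range n, ((k : ℝ) + 1) = n * (n + 1) / 2 := fun n => by
    induction n with
    | zero => simp
    | succ n ih => rw [Finset.sum_range_succ, ih]; push_cast; ring
  have h := he'.sum_range (fun n => by positivity) (by
    simp_rw [hs]
    refine tendsto_atTop_mono (f := fun n : ℕ => (n : ℝ) / 2) (fun n => ?_)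
      (tendsto_natCast_atTop_atTop.atTop_div_const two_pos)
    have : (0 : ℝ) ≤ n := n.cast_nonneg
    nlinarith)
  simp_rw [hs] at h
  refine h.trans_isBigO (Asymptotics.IsBigO.of_bound 1 (eventually_atTop.2 ⟨1, fun n hn => ?_⟩))
  have : (1 : ℝ) ≤ n := by exact_mod_cast hn
  rw [Real.norm_of_nonneg (by positivity), Real.norm_of_nonneg (by positivity)]
  nlinarith

lemma log_succ_isLittleO : (fun n : ℕ => Real.log ((n : ℝ) + 1) + 1) =o[atTop] fun n : ℕ => (n : ℝ) := by
  refine Asymptotics.IsLittleO.add ?_ (Asymptotics.isLittleO_const_left.2 (Or.inr ?_))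
  · have h := Real.isLittleO_log_id_atTop.comp_tendsto
      (tendsto_atTop_add_const_right atTop (1 : ℝ) tendsto_natCast_atTop_atTop)
    refine h.trans_isBigO (Asymptotics.IsBigO.of_bound 2 (eventually_atTop.2 ⟨1, fun n hn => ?_⟩))
    have : (1 : ℝ) ≤ n := by exact_mod_cast hn
    simp only [Function.comp_apply, id]
    rw [Real.norm_of_nonneg (by positivity), Real.norm_of_nonneg (by positivity)]
    linarith
  · exact tendsto_norm_atTop_atTop.comp tendsto_natCast_atTop_atTop

lemma abs_sub_le_of_deriv_mono {f g : ℝ → ℝ} {k : ℝ} (hf : ContinuousOn f (Set.Icc k (k + 1)))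
    (hd : ∀ x ∈ Set.Ioo k (k + 1), HasDerivAt f (g x) x)
    (hg : ∀ x ∈ Set.Ioo k (k + 1), g k ≤ g x ∧ g x ≤ g (k + 1)) :
    g k ≤ f (k + 1) - f k ∧ f (k + 1) - f k ≤ g (k + 1) := by
  obtain ⟨c, hc, h⟩ := exists_hasDerivAt_eq_slope f g (lt_add_one k) hf hd
  rw [add_sub_cancel_left, div_one] at h
  rw [← h]; exact hg c hc

lemma sum_mul_log_isLittleO : (fun n : ℕ => ∑ k ∈ Finset.range n, (k : ℝ) * Real.log (k + 1) -
    ((n : ℝ) ^ 2 / 2 * Real.log n - (n : ℝ) ^ 2 / 4)) =o[atTop] fun n : ℕ => (n : ℝ) ^ 2 := by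
  set f : ℝ → ℝ := fun x => x ^ 2 / 2 * Real.log x - x ^ 2 / 4 with hf
  have htel : ∀ n : ℕ, ∑ k ∈ Finset.range n, (k : ℝ) * Real.log (k + 1) - f n =
      ∑ k ∈ Finset.range n, ((k : ℝ) * Real.log (k + 1) - (f (k + 1) - f k)) := fun n => by
    rw [Finset.sum_sub_distrib]
    congr 1
    have := Finset.sum_range_sub (fun k : ℕ => f k) n
    push_cast at this
    rw [this]; simp [hf]
  refine Asymptotics.IsLittleO.congr_left (isLittleO_sum_sq ?_) fun n => (htel n).symm
  refine Asymptotics.IsBigO.trans_isLittleO (Asymptotics.IsBigO.of_bound 1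
    (eventually_atTop.2 ⟨1, fun k hk => ?_⟩)) log_succ_isLittleO
  have hk1 : (1 : ℝ) ≤ k := by exact_mod_cast hk
  have hlog : Real.log (k + 1) - Real.log k ≤ 1 / k := by
    rw [← Real.log_div (by positivity) (by positivity)]
    refine (Real.log_le_sub_one_of_pos (by positivity)).trans (le_of_eq ?_)
    field_simp; ring
  have h := abs_sub_le_of_deriv_mono (f := f) (g := fun x => x * Real.log x) (k := k)
    (by
      refine ContinuousOn.sub (ContinuousOn.mul (by fun_prop) (Real.continuousOn_log.mono fun x hx => ?_)) (by fun_prop)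
      have := hx.1
      simp only [Set.mem_compl_iff, Set.mem_singleton_iff]; linarith)
    (fun x hx => by
      have hx0 : x ≠ 0 := by have := hx.1; linarith
      have := (((hasDerivAt_pow 2 x).div_const 2).mul (Real.hasDerivAt_log hx0)).sub
        ((hasDerivAt_pow 2 x).div_const 4)
      refine this.congr_deriv ?_
      field_simp; norm_num; ring)
    (fun x hx => by
      have h1 := hx.1
      have h2 := hx.2
      have := Real.log_nonneg hk1
      have h3 := Real.log_le_log (by linarith) h1.le
      have h4 := Real.log_le_log (by linarith) h2.le
      constructor <;> nlinarith)
  have hl0 : 0 ≤ Real.log ((k : ℝ) + 1) := Real.log_nonneg (by linarith)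
  have hkl : (k : ℝ) * (Real.log (k + 1) - Real.log k) ≤ 1 := by
    rw [le_div_iff₀ (by positivity)] at hlog; linarith
  rw [one_mul, Real.norm_of_nonneg (by positivity : 0 ≤ Real.log ((k : ℝ) + 1) + 1), Real.norm_eq_abs, abs_le]
  constructor <;> linarith [h.1, h.2]

lemma sum_log_isLittleO {m : ℕ} (hm : 0 < m) : (fun n : ℕ => ∑ k ∈ Finset.range n, Real.log ((k : ℝ) + m) -
    ((n : ℝ) * Real.log n - n)) =o[atTop] fun n : ℕ => (n : ℝ) := by
  set f : ℝ → ℝ := fun x => x * Real.log x - x with hf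
  have htel : ∀ n : ℕ, ∑ k ∈ Finset.range n, Real.log ((k : ℝ) + m) - f n =
      ∑ k ∈ Finset.range n, (Real.log ((k : ℝ) + m) - (f (k + 1) - f k)) := fun n => by
    rw [Finset.sum_sub_distrib]
    congr 1
    have := Finset.sum_range_sub (fun k : ℕ => f k) n
    push_cast at this
    rw [this]; simp [hf]
  have hm1 : (1 : ℝ) ≤ m := by exact_mod_cast hm
  have h0 : Tendsto (fun k : ℕ => Real.log ((k : ℝ) + m) - (f (k + 1) - f k)) atTop (nhds 0) := by
    have hlim : Tendsto (fun k : ℕ => (m : ℝ) / k) atTop (nhds 0) := tendsto_const_div_atTop_nhds_zero_nat _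
    refine tendsto_of_tendsto_of_tendsto_of_le_of_le' tendsto_const_nhds hlim ?_ ?_ <;>
    · refine eventually_atTop.2 ⟨1, fun k hk => ?_⟩
      have hk1 : (1 : ℝ) ≤ k := by exact_mod_cast hk
      have hlog : Real.log (k + m) - Real.log k ≤ m / k := by
        rw [← Real.log_div (by positivity) (by positivity)]
        refine (Real.log_le_sub_one_of_pos (by positivity)).trans (le_of_eq ?_)
        field_simp; ring
      have hle := Real.log_le_log (by linarith) (by linarith : (k : ℝ) + 1 ≤ k + m)
      have h := abs_sub_le_of_deriv_mono (f := f) (g := fun x => Real.log x) (k := k)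
        (by
          refine ContinuousOn.sub (ContinuousOn.mul (by fun_prop) (Real.continuousOn_log.mono fun x hx => ?_)) (by fun_prop)
          have := hx.1
          simp only [Set.mem_compl_iff, Set.mem_singleton_iff]; linarith)
        (fun x hx => by
          have hx0 : x ≠ 0 := by have := hx.1; linarith
          have := ((hasDerivAt_id x).mul (Real.hasDerivAt_log hx0)).sub (hasDerivAt_id x)
          refine this.congr_deriv ?_
          simp only [id]
          field_simp; ring)
        (fun x hx => by
          exact ⟨Real.log_le_log (by linarith) hx.1.le, Real.log_le_log (by linarith [hx.1]) hx.2.le⟩)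
      linarith [h.1, h.2]
  refine Asymptotics.IsLittleO.congr_left ?_ fun n => (htel n).symm
  have h1 := h0.cesaro
  rw [Asymptotics.isLittleO_iff_tendsto' (eventually_atTop.2 ⟨1, fun n hn h => by
    have : (1 : ℝ) ≤ n := by exact_mod_cast hn
    linarith⟩)]
  exact h1.congr fun n => by rw [inv_mul_eq_div]

lemma sum_sum_log_isLittleO {m : ℕ} (hm : 0 < m) : (fun n : ℕ => ∑ k ∈ Finset.range n, ∑ i ∈ Finset.range k,
    Real.log ((i : ℝ) + m) - ((n : ℝ) ^ 2 / 2 * Real.log n - 3 / 4 * (n : ℝ) ^ 2)) =o[atTop]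
      fun n : ℕ => (n : ℝ) ^ 2 := by
  have hn2 : (fun n : ℕ => (n : ℝ)) =o[atTop] fun n : ℕ => (n : ℝ) ^ 2 := by
    have := (Asymptotics.isLittleO_pow_pow_atTop_of_lt (𝕜 := ℝ) one_lt_two).comp_tendsto
      (tendsto_natCast_atTop_atTop (R := ℝ))
    simpa [Function.comp_def] using this
  have h3 : (fun k : ℕ => (k : ℝ) * Real.log k - k * Real.log (k + 1)) =o[atTop] fun n : ℕ => (n : ℝ) := by
    refine Asymptotics.IsBigO.trans_isLittleO (g := fun _ => (1 : ℝ)) (Asymptotics.IsBigO.of_bound 1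
      (eventually_atTop.2 ⟨1, fun k hk => ?_⟩)) (Asymptotics.isLittleO_const_left.2 (Or.inr
        (tendsto_norm_atTop_atTop.comp tendsto_natCast_atTop_atTop)))
    have hk1 : (1 : ℝ) ≤ k := by exact_mod_cast hk
    have hlog : Real.log (k + 1) - Real.log k ≤ 1 / k := by
      rw [← Real.log_div (by positivity) (by positivity)]
      refine (Real.log_le_sub_one_of_pos (by positivity)).trans (le_of_eq ?_)
      field_simp; ring
    have hkl : (k : ℝ) * (Real.log (k + 1) - Real.log k) ≤ 1 := by
      rw [le_div_iff₀ (by positivity)] at hlog; linarith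
    have := Real.log_le_log (by linarith) (by linarith : (k : ℝ) ≤ k + 1)
    rw [norm_one, mul_one, Real.norm_eq_abs, abs_le]
    constructor <;> nlinarith
  have h := (((isLittleO_sum_sq (sum_log_isLittleO hm)).add (isLittleO_sum_sq h3)).add
    sum_mul_log_isLittleO).add (hn2.const_mul_left (1 / 2))
  refine h.congr_left fun n => ?_
  have hs : ∑ k ∈ Finset.range n, (k : ℝ) = n * (n - 1) / 2 := by
    induction n with
    | zero => simp
    | succ n ih => rw [Finset.sum_range_succ, ih]; push_cast; ring
  simp only [Finset.sum_sub_distrib, hs]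
  ring

lemma Gamma_add_one_le {t : ℝ} (ht : 0 ≤ t) : Real.Gamma (t + 1) ≤ (t + 1) ^ (t + 1) * Real.exp (-t) := by
  have h1 : 0 < t + 1 := by linarith
  rw [Real.Gamma_eq_integral h1]
  have hI : IntegrableOn (fun x : ℝ => Real.exp (-((t + 1)⁻¹ * x))) (Set.Ioi 0) := by
    simpa using integrableOn_exp_mul_Ioi (a := -(t + 1)⁻¹) (by simpa using h1) 0
  calc ∫ x in Set.Ioi 0, Real.exp (-x) * x ^ (t + 1 - 1)
      ≤ ∫ x in Set.Ioi 0, (t + 1) ^ t * Real.exp (-t) * Real.exp (-((t + 1)⁻¹ * x)) := by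
        refine setIntegral_mono_on (Real.GammaIntegral_convergent h1) (hI.const_mul _) measurableSet_Ioi
          fun x (hx : 0 < x) => ?_
        rw [add_sub_cancel_right, Real.rpow_def_of_pos hx, Real.rpow_def_of_pos h1, ← Real.exp_add,
          ← Real.exp_add, ← Real.exp_add, Real.exp_le_exp]
        have h2 := Real.log_le_sub_one_of_pos (div_pos hx h1)
        rw [Real.log_div hx.ne' h1.ne'] at h2
        have h3 := mul_le_mul_of_nonneg_right h2 ht
        have h4 : x / (t + 1) * t = x - (t + 1)⁻¹ * x := by field_simp; ring
        nlinarith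
    _ = (t + 1) ^ (t + 1) * Real.exp (-t) := by
        rw [integral_const_mul]
        have := Real.integral_rpow_mul_exp_neg_mul_Ioi (a := 1) (r := (t + 1)⁻¹) one_pos (by positivity)
        simp only [sub_self, Real.rpow_zero, one_mul, one_div, inv_inv, Real.rpow_one, Real.Gamma_one,
          mul_one] at this
        rw [this, Real.rpow_add h1, Real.rpow_one]; ring

lemma cast_choose_two_div (n : ℕ) : ((n * (n - 1) / 2 : ℕ) : ℝ) = (n : ℝ) * (n - 1) / 2 := by
  rw [Nat.cast_div_charZero (Nat.even_mul_pred_self n).two_dvd]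
  cases n <;> simp

lemma sum_range_cast (n : ℕ) : ∑ k ∈ Finset.range n, (k : ℝ) = n * (n - 1) / 2 := by
  induction n with
  | zero => simp
  | succ n ih => rw [Finset.sum_range_succ, ih]; push_cast; ring

lemma log_vdmBall_ge {p b : ℝ} (hp : 0 < p) (hb : 0 < b) {n : ℕ} (hn : 1 ≤ n) (htop : vdmBall p b n ≠ ⊤) :
    0 < (vdmBall p b n).toReal ∧
    n * Real.log Real.pi + (b / p * (∑ k ∈ Finset.range n, (k : ℝ) * Real.log (k + 1)) +
      1 / p * (∑ k ∈ Finset.range n, Real.log ((k : ℝ) + (1 : ℕ))) +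
      (Real.log (b * ullmanConst p) / p - Real.log 2) * (b * (n * (n - 1) / 2) + n) -
      b / p * (n * (n + 1) / 2)) -
      ((b / (2 * p) * n ^ 2 + (1 / p + 1) * n) * Real.log (b / (2 * p) * n ^ 2 + (1 / p + 1) * n)
        - (b * (n * (n - 1) / 2) + n) / p) ≤ Real.log (vdmBall p b n).toReal := by
  have hg := ullmanConst_pos hp
  have hn1 : (1 : ℝ) ≤ n := by exact_mod_cast hn
  set t : ℝ := (b * (n * (n - 1) / 2 : ℕ) + n) / p with ht
  have ht' : t = (b * (n * (n - 1) / 2) + n) / p := by rw [ht, cast_choose_two_div]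
  have ht0 : 0 ≤ t := by positivity
  set Pr := ∏ k ∈ Finset.range n, (Real.pi * Real.exp ((b * k + 1) *
      Real.log ((b * ullmanConst p * (k + 1)) ^ (1 / p) / 2) - b * (k + 1) / p)) with hPr
  have hPr0 : 0 < Pr := Finset.prod_pos fun k _ => by have := Real.pi_pos; positivity
  have h1 := le_vdmExp hp hb n
  have hG : 0 < Real.Gamma (t + 1) := Real.Gamma_pos_of_pos (by linarith)
  rw [vdmExp_eq hp hb, ← ENNReal.ofReal_toReal htop, ← ENNReal.ofReal_mul ENNReal.toReal_nonneg,
    ENNReal.ofReal_le_ofReal_iff (by positivity)] at h1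
  change Pr ≤ _ * Real.Gamma (t + 1) at h1
  have hpos : 0 < (vdmBall p b n).toReal := by
    by_contra h
    have := mul_nonpos_of_nonpos_of_nonneg (not_lt.1 h) hG.le
    linarith
  refine ⟨hpos, ?_⟩
  have h2 := Real.log_le_log hPr0 h1
  rw [Real.log_mul hpos.ne' hG.ne'] at h2
  have h3 : Real.log (Real.Gamma (t + 1)) ≤ (b / (2 * p) * n ^ 2 + (1 / p + 1) * n) *
      Real.log (b / (2 * p) * n ^ 2 + (1 / p + 1) * n) - t := by
    have hle : t + 1 ≤ b / (2 * p) * n ^ 2 + (1 / p + 1) * n := by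
      rw [ht']
      have : b / (2 * p) * n ^ 2 + (1 / p + 1) * n - (b * (n * (n - 1) / 2) + n) / p =
        b / (2 * p) * n + n := by field_simp; ring
      have h5 : 0 < b / (2 * p) * n := by positivity
      linarith
    have h4 := Real.log_le_log hG (Gamma_add_one_le ht0)
    rw [Real.log_mul (by positivity) (by positivity), Real.log_exp, Real.log_rpow (by linarith)] at h4
    have h6 : (t + 1) * Real.log (t + 1) ≤ (b / (2 * p) * n ^ 2 + (1 / p + 1) * n) *
      Real.log (b / (2 * p) * n ^ 2 + (1 / p + 1) * n) :=
      mul_le_mul hle (Real.log_le_log (by linarith) hle) (Real.log_nonneg (by linarith)) (by linarith)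
    linarith
  have h7 : Real.log Pr = n * Real.log Real.pi + (b / p * (∑ k ∈ Finset.range n, (k : ℝ) * Real.log (k + 1)) +
      1 / p * (∑ k ∈ Finset.range n, Real.log ((k : ℝ) + (1 : ℕ))) +
      (Real.log (b * ullmanConst p) / p - Real.log 2) * (b * (n * (n - 1) / 2) + n) -
      b / p * (n * (n + 1) / 2)) := by
    have hpi := Real.pi_pos
    rw [hPr, Real.log_prod fun k _ => by positivity]
    have : ∀ k ∈ Finset.range n, Real.log (Real.pi * Real.exp ((b * k + 1) *
        Real.log ((b * ullmanConst p * (k + 1)) ^ (1 / p) / 2) - b * (k + 1) / p)) =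
        Real.log Real.pi + (b / p * (k * Real.log (k + 1)) + 1 / p * Real.log ((k : ℝ) + (1 : ℕ)) +
        (Real.log (b * ullmanConst p) / p - Real.log 2) * b * k +
        (Real.log (b * ullmanConst p) / p - Real.log 2) - b / p * k - b / p) := fun k _ => by
      rw [Real.log_mul (by positivity) (by positivity), Real.log_exp, Real.log_div (by positivity) (by norm_num),
        Real.log_rpow (by positivity), Real.log_mul (by positivity) (by positivity), Nat.cast_one]
      ring
    rw [Finset.sum_congr rfl this]
    simp only [Finset.sum_add_distrib, Finset.sum_sub_distrib, ← Finset.mul_sum, Finset.sum_const,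
      Finset.card_range, nsmul_eq_mul, sum_range_cast]
    ring
  rw [h7] at h2
  rw [← ht']
  linarith

lemma vdmBall_ne_top {p b : ℝ} (hp : 0 < p) (hb : 0 < b) (n : ℕ) : vdmBall p b n ≠ ⊤ :=
  ne_top_of_le_ne_top ENNReal.ofReal_ne_top (vdmBall_le hp hb one_pos one_pos n)

lemma log_vdmBall_le {p b : ℝ} (hp : 0 < p) (hb : 0 < b) {m : ℕ} (hm : 0 < m) {n : ℕ} (hn : 1 ≤ n) :
    Real.log (vdmBall p b n).toReal ≤ b * ((∑ k ∈ Finset.range n, Real.log ((k : ℝ) + (1 : ℕ))) +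
      Real.log 2 * (n * (n - 1) / 2 / m + n) + 1 / p * (∑ k ∈ Finset.range n, ∑ i ∈ Finset.range k,
      Real.log ((i : ℝ) + m)) + (Real.log (b * ullmanConst p) / p - Real.log 2) * (n * (n - 1) / 2)) +
      b / (2 * p) * n ^ 2 - b * (n * (n - 1) / 2) / p * (2 * Real.log n + Real.log (b / (2 * p))) +
      n * Real.log 2 := by
  have hg := ullmanConst_pos hp
  have hn1 : (1 : ℝ) ≤ n := by exact_mod_cast hn
  have hm1 : (1 : ℝ) ≤ m := by exact_mod_cast hm
  set τ : ℝ := b / (2 * p) * n ^ 2 with hτ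
  have hτ0 : 0 < τ := by positivity
  have hpos := (log_vdmBall_ge hp hb hn (vdmBall_ne_top hp hb n)).1
  have hM : 0 < ∏ k ∈ Finset.range n, chebBound p b m k :=
    Finset.prod_pos fun k _ => chebBound_pos hp hb hm k
  have h := vdmBall_le hp hb hτ0 hm n
  rw [← ENNReal.ofReal_toReal (vdmBall_ne_top hp hb n), ENNReal.ofReal_le_ofReal_iff (by positivity)] at h
  refine (Real.log_le_log hpos h).trans ?_
  have hfac : Real.log n.factorial = ∑ k ∈ Finset.range n, Real.log ((k : ℝ) + (1 : ℕ)) := by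
    rw [← Finset.prod_range_add_one_eq_factorial, Nat.cast_prod, Real.log_prod fun k _ => by positivity]
    simp
  have hcheb : ∀ k ∈ Finset.range n, Real.log (chebBound p b m k) ≤ Real.log 2 / m * k + Real.log 2 +
      1 / p * (∑ i ∈ Finset.range k, Real.log ((i : ℝ) + m)) +
      (Real.log (b * ullmanConst p) / p - Real.log 2) * k := fun k _ => by
    rw [chebBound, Real.log_mul (by positivity) (by positivity), Real.log_pow,
      Real.log_prod fun i _ => by positivity]
    have : ∀ i ∈ Finset.range k, Real.log ((b * ullmanConst p * (i + m)) ^ (1 / p) / 2) =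
        1 / p * Real.log ((i : ℝ) + m) + (Real.log (b * ullmanConst p) / p - Real.log 2) := fun i _ => by
      rw [Real.log_div (by positivity) (by norm_num),
        Real.log_rpow (by positivity), Real.log_mul (by positivity) (by positivity)]
      ring
    rw [Finset.sum_congr rfl this, Finset.sum_add_distrib, ← Finset.mul_sum, Finset.sum_const,
      Finset.card_range, nsmul_eq_mul]
    have h1 : ((k / m : ℕ) : ℝ) ≤ k / m := Nat.cast_div_le
    have h2 := Real.log_nonneg (one_le_two (α := ℝ))
    push_cast
    have h3 := mul_le_mul_of_nonneg_right h1 h2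
    have e : (k : ℝ) / m * Real.log 2 = Real.log 2 / m * k := by ring
    linarith
  have hsum := Finset.sum_le_sum hcheb
  simp only [Finset.sum_add_distrib, ← Finset.mul_sum, Finset.sum_const,
      Finset.card_range, nsmul_eq_mul, sum_range_cast] at hsum
  rw [Real.log_mul (by positivity) (by positivity), Real.log_mul (by positivity) (by positivity),
    Real.log_mul (by positivity) (by positivity), Real.log_exp, Real.log_rpow (by positivity),
    Real.log_rpow hτ0, Real.log_pow, Real.log_mul (by positivity) (by positivity), hfac,
    Real.log_prod fun k _ => (chebBound_pos hp hb hm k).ne', cast_choose_two_div]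
  have hlτ : Real.log τ = 2 * Real.log n + Real.log (b / (2 * p)) := by
    rw [hτ, Real.log_mul (by positivity) (by positivity), Real.log_pow]; push_cast; ring
  rw [hlτ]
  have e1 : Real.log 2 / m * (n * (n - 1) / 2) = Real.log 2 * (n * (n - 1) / 2 / m) := by ring
  have e2 : -(b * (n * (n - 1) / 2) / p) * (2 * Real.log n + Real.log (b / (2 * p))) =
    - (b * (n * (n - 1) / 2) / p * (2 * Real.log n + Real.log (b / (2 * p)))) := by ring
  rw [e2]
  have h5 := mul_le_mul_of_nonneg_left hsum hb.le
  rw [e1] at h5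
  nlinarith

lemma tendsto_log_div_natCast : Tendsto (fun n : ℕ => Real.log n / n) atTop (nhds 0) := by
  have := (Real.isLittleO_log_id_atTop.tendsto_div_nhds_zero).comp (tendsto_natCast_atTop_atTop (R := ℝ))
  simpa [Function.comp_def] using this

/-- The limit of the normalised logarithm of `vdmBall`. -/
def vdmLim (p b : ℝ) : ℝ :=
  -(1 / (2 * p)) + (Real.log (b * ullmanConst p) / p - Real.log 2) - 1 / p * Real.log (b / (2 * p))

lemma tendsto_lower {p b : ℝ} (hp : 0 < p) (hb : 0 < b) : Tendsto (fun n : ℕ => 1 / p * Real.log n +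
    2 / (b * n ^ 2) * (n * Real.log Real.pi + (b / p * (∑ k ∈ Finset.range n, (k : ℝ) * Real.log (k + 1)) +
      1 / p * (∑ k ∈ Finset.range n, Real.log ((k : ℝ) + (1 : ℕ))) +
      (Real.log (b * ullmanConst p) / p - Real.log 2) * (b * (n * (n - 1) / 2) + n) -
      b / p * (n * (n + 1) / 2)) -
      ((b / (2 * p) * n ^ 2 + (1 / p + 1) * n) * Real.log (b / (2 * p) * n ^ 2 + (1 / p + 1) * n)
        - (b * (n * (n - 1) / 2) + n) / p))) atTop (nhds (vdmLim p b)) := by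
  have hs := sum_mul_log_isLittleO.tendsto_div_nhds_zero
  have hf := (sum_log_isLittleO one_pos).tendsto_div_nhds_zero
  have hu : Tendsto (fun n : ℕ => 1 / (n : ℝ)) atTop (nhds 0) := tendsto_one_div_atTop_nhds_zero_nat
  have hr := tendsto_log_div_natCast
  set Gp := Real.log (b * ullmanConst p) / p - Real.log 2 with hGp
  set κ := b / (2 * p) with hκ
  have hκ0 : 0 < κ := by positivity
  have hK : Tendsto (fun n : ℕ => Real.log (κ + (1 / p + 1) * (1 / (n : ℝ)))) atTop (nhds (Real.log κ)) := by
    refine Tendsto.log ?_ hκ0.ne'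
    simpa using (hu.const_mul (1 / p + 1)).const_add κ
  have hmain := ((((((hu.const_mul (2 * Real.log Real.pi / b)).add (hs.const_mul (2 / p))).add_const (-(1 / (2 * p)))).add
    (((hf.mul hu).add (hr.sub hu)).const_mul (2 / (b * p)))).add
    (((hu.const_mul (2 / b - 1)).const_add 1).const_mul Gp)).add
    ((hu.const_add 1).const_mul (-(1 / p)))).add
    (((((hK.const_mul κ).add ((hu.mul hK).const_mul (1 / p + 1))).add
      (hr.const_mul (2 * (1 / p + 1)))).const_mul (-(2 / b))).add
      ((hu.const_mul (2 / (b * p) - 1 / p)).const_add (1 / p)))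
  refine (hmain.congr' (eventually_atTop.2 ⟨1, fun n hn => ?_⟩)).trans (le_of_eq ?_)
  · have hn1 : (1 : ℝ) ≤ n := by exact_mod_cast hn
    have e : Real.log (κ * n ^ 2 + (1 / p + 1) * n) = 2 * Real.log n + Real.log (κ + (1 / p + 1) * (1 / (n : ℝ))) := by
      rw [← Real.log_rpow (by positivity), ← Real.log_mul (by positivity) (by positivity)]
      congr 1
      norm_num
      field_simp
    rw [e]
    generalize Real.log (κ + (1 / p + 1) * (1 / (n : ℝ))) = L1
    generalize Real.log (n : ℝ) = L2
    generalize ∑ k ∈ Finset.range n, (k : ℝ) * Real.log (k + 1) = S1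
    generalize ∑ k ∈ Finset.range n, Real.log ((k : ℝ) + (1 : ℕ)) = S2
    generalize Real.log Real.pi = L3
    rw [hκ]
    field_simp
    ring
  · congr 1
    rw [vdmLim, ← hGp, ← hκ]
    have : 2 / b * κ = 1 / p := by rw [hκ]; field_simp
    linear_combination (-Real.log κ) * this

lemma tendsto_upper {p b : ℝ} (hp : 0 < p) (hb : 0 < b) {m : ℕ} (hm : 0 < m) : Tendsto (fun n : ℕ =>
    1 / p * Real.log n + 2 / (b * n ^ 2) * (b * ((∑ k ∈ Finset.range n, Real.log ((k : ℝ) + (1 : ℕ))) +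
      Real.log 2 * (n * (n - 1) / 2 / m + n) + 1 / p * (∑ k ∈ Finset.range n, ∑ i ∈ Finset.range k,
      Real.log ((i : ℝ) + m)) + (Real.log (b * ullmanConst p) / p - Real.log 2) * (n * (n - 1) / 2)) +
      b / (2 * p) * n ^ 2 - b * (n * (n - 1) / 2) / p * (2 * Real.log n + Real.log (b / (2 * p))) +
      n * Real.log 2)) atTop (nhds (vdmLim p b + Real.log 2 / m)) := by
  have hs := (sum_sum_log_isLittleO hm).tendsto_div_nhds_zero
  have hf := (sum_log_isLittleO one_pos).tendsto_div_nhds_zero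
  have hu : Tendsto (fun n : ℕ => 1 / (n : ℝ)) atTop (nhds 0) := tendsto_one_div_atTop_nhds_zero_nat
  have hr := tendsto_log_div_natCast
  have hm1 : (1 : ℝ) ≤ m := by exact_mod_cast hm
  set Gp := Real.log (b * ullmanConst p) / p - Real.log 2 with hGp
  generalize hM : (m : ℝ) = M at *
  have hM0 : 0 < M := by linarith
  have hmain := ((((((hf.mul hu).add (hr.sub hu)).const_mul 2).add
    (((hu.const_mul (2 * M - 1)).const_add 1).const_mul (Real.log 2 / M))).add
    ((hs.const_mul (2 / p)).add_const (-(3 / (2 * p))))).add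
    (((hu.const_mul (-1)).const_add 1).const_mul Gp)).add
    ((((((hu.const_mul (-1)).const_add 1).const_mul (-(1 / p * Real.log (b / (2 * p))))).add (hr.const_mul (2 / p))).const_add
      (1 / p)).add (hu.const_mul (2 * Real.log 2 / b)))
  refine (hmain.congr' (eventually_atTop.2 ⟨1, fun n hn => ?_⟩)).trans (le_of_eq ?_)
  · have hn1 : (1 : ℝ) ≤ n := by exact_mod_cast hn
    generalize Real.log (b / (2 * p)) = L1
    generalize Real.log (n : ℝ) = L2
    generalize ∑ k ∈ Finset.range n, ∑ i ∈ Finset.range k, Real.log ((i : ℝ) + M) = S1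
    generalize ∑ k ∈ Finset.range n, Real.log ((k : ℝ) + (1 : ℕ)) = S2
    generalize Real.log 2 = L3
    field_simp
    ring
  · congr 1
    rw [vdmLim, ← hGp]
    field_simp
    ring

/-- Logarithmic asymptotics of the Vandermonde integral over the unit ball of `ℓ_p^n`. -/
lemma tendsto_log_vdmBall {p b : ℝ} (hp : 0 < p) (hb : 0 < b) : Tendsto (fun n : ℕ =>
    1 / p * Real.log n + 2 / (b * n ^ 2) * Real.log (vdmBall p b n).toReal) atTop (nhds (vdmLim p b)) := by
  rw [tendsto_order]
  constructor
  · intro a ha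
    filter_upwards [(tendsto_lower hp hb).eventually (lt_mem_nhds ha), eventually_ge_atTop 1] with n h hn
    refine h.trans_le ?_
    gcongr
    exact (log_vdmBall_ge hp hb hn (vdmBall_ne_top hp hb n)).2
  · intro a ha
    have h1 : Tendsto (fun m : ℕ => vdmLim p b + Real.log 2 / m) atTop (nhds (vdmLim p b)) := by
      simpa using (tendsto_const_div_atTop_nhds_zero_nat (Real.log 2)).const_add (vdmLim p b)
    obtain ⟨m, hm, hm0⟩ := ((h1.eventually (gt_mem_nhds ha)).and (eventually_ge_atTop 1)).exists
    filter_upwards [(tendsto_upper hp hb hm0).eventually (gt_mem_nhds hm), eventually_ge_atTop 1] with n h hn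
    refine lt_of_le_of_lt ?_ h
    gcongr
    exact log_vdmBall_le hp hb hm0 hn

lemma le_Gamma_add_one {t : ℝ} (ht : 0 ≤ t) : t ^ t * Real.exp (-t) ≤ Real.Gamma (t + 1) := by
  have hc := Real.GammaIntegral_convergent (s := t + 1) (by linarith)
  rw [Real.Gamma_eq_integral (by linarith), ← integral_exp_neg_Ioi t, ← integral_const_mul]
  calc ∫ x in Set.Ioi t, t ^ t * Real.exp (-x) ≤ ∫ x in Set.Ioi t, Real.exp (-x) * x ^ (t + 1 - 1) := by
        refine setIntegral_mono_on ((integrableOn_exp_neg_Ioi t).const_mul _)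
          (hc.mono_set (Set.Ioi_subset_Ioi ht)) measurableSet_Ioi fun x (hx : t < x) => ?_
        rw [mul_comm, add_sub_cancel_right]
        gcongr
    _ ≤ _ := setIntegral_mono_set hc (by
        filter_upwards [ae_restrict_mem measurableSet_Ioi] with x (hx : 0 < x)
        positivity) (Set.Ioi_subset_Ioi ht).eventuallyLE

lemma tendsto_quadratic_mul_log {κ : ℝ} (hκ : 0 < κ) (c d : ℝ) : Tendsto (fun n : ℕ =>
    (κ * n ^ 2 + c * n + d) * Real.log (κ * n ^ 2 + c * n + d) / n ^ 2 - 2 * κ * Real.log n)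
    atTop (nhds (κ * Real.log κ)) := by
  have hu : Tendsto (fun n : ℕ => 1 / (n : ℝ)) atTop (nhds 0) := tendsto_one_div_atTop_nhds_zero_nat
  have hr := tendsto_log_div_natCast
  have hK0 : Tendsto (fun n : ℕ => κ + c * (1 / (n : ℝ)) + d * (1 / (n : ℝ) * (1 / (n : ℝ)))) atTop (nhds κ) := by
    simpa using ((hu.const_mul c).const_add κ).add ((hu.mul hu).const_mul d)
  have hK := hK0.log hκ.ne'
  have hmain := (hK0.mul hK).add ((hr.const_mul (2 * c)).add ((hr.mul hu).const_mul (2 * d)))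
  refine (hmain.congr' ?_).trans (le_of_eq (by congr 1; ring))
  filter_upwards [eventually_ge_atTop 1, hK0.eventually (lt_mem_nhds hκ)] with n hn hpos
  have hn1 : (1 : ℝ) ≤ n := by exact_mod_cast hn
  have e : κ * n ^ 2 + c * n + d = (n : ℝ) ^ 2 * (κ + c * (1 / (n : ℝ)) + d * (1 / (n : ℝ) * (1 / (n : ℝ)))) := by
    field_simp
  rw [e, Real.log_mul (by positivity) hpos.ne', Real.log_pow]
  generalize Real.log (κ + c * (1 / (n : ℝ)) + d * (1 / (n : ℝ) * (1 / (n : ℝ)))) = L1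
  push_cast
  field_simp
  ring

lemma tendsto_log_Gamma {κ : ℝ} (hκ : 0 < κ) (c : ℝ) : Tendsto (fun n : ℕ =>
    Real.log (Real.Gamma (κ * n ^ 2 + c * n + 1)) / n ^ 2 - 2 * κ * Real.log n)
    atTop (nhds (κ * Real.log κ - κ)) := by
  have hu : Tendsto (fun n : ℕ => 1 / (n : ℝ)) atTop (nhds 0) := tendsto_one_div_atTop_nhds_zero_nat
  have hK0 : Tendsto (fun n : ℕ => κ + c * (1 / (n : ℝ))) atTop (nhds κ) := by
    simpa using ((hu.const_mul c).const_add κ)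
  have hev : ∀ᶠ n : ℕ in atTop, 0 < κ * n ^ 2 + c * n := by
    filter_upwards [eventually_ge_atTop 1, hK0.eventually (lt_mem_nhds hκ)] with n hn hpos
    have hn1 : (1 : ℝ) ≤ n := by exact_mod_cast hn
    have e : κ * n ^ 2 + c * n = (n : ℝ) ^ 2 * (κ + c * (1 / (n : ℝ))) := by field_simp
    rw [e]; positivity
  have h1 := (tendsto_quadratic_mul_log hκ c 0).sub hK0
  have h2 := (tendsto_quadratic_mul_log hκ c 1).sub hK0
  refine tendsto_of_tendsto_of_tendsto_of_le_of_le' h1 h2 ?_ ?_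
  · filter_upwards [hev, eventually_ge_atTop 1] with n hn h1
    have hn1 : (1 : ℝ) ≤ n := by exact_mod_cast h1
    have h3 := Real.log_le_log (by positivity) (le_Gamma_add_one hn.le)
    rw [Real.log_mul (by positivity) (by positivity), Real.log_exp, Real.log_rpow hn] at h3
    have h4 := div_le_div_of_nonneg_right h3 (by positivity : (0 : ℝ) ≤ n ^ 2)
    have e : (κ * n ^ 2 + c * n) / (n : ℝ) ^ 2 = κ + c * (1 / n) := by field_simp
    rw [add_zero]
    rw [add_div, neg_div, e] at h4
    linarith
  · filter_upwards [hev, eventually_ge_atTop 1] with n hn h1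
    have hn1 : (1 : ℝ) ≤ n := by exact_mod_cast h1
    have h3 := Real.log_le_log (Real.Gamma_pos_of_pos (by linarith)) (Gamma_add_one_le hn.le)
    rw [Real.log_mul (by positivity) (by positivity), Real.log_exp, Real.log_rpow (by linarith)] at h3
    have h4 := div_le_div_of_nonneg_right h3 (by positivity : (0 : ℝ) ≤ n ^ 2)
    have e : (κ * n ^ 2 + c * n) / (n : ℝ) ^ 2 = κ + c * (1 / n) := by field_simp
    rw [add_div, neg_div, e] at h4
    linarith

lemma tendsto_log_volume_ball {b : ℕ} (hb : 0 < b) : Tendsto (fun n : ℕ => Real.log n + 2 / (b * (n : ℝ) ^ 2) *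
    Real.log (volume (Metric.closedBall (0 : EuclideanSpace ℝ (Fin (b * (n * (n - 1) / 2) + n))) 1)).toReal) atTop
    (nhds (1 / 2 * (Real.log Real.pi + 1 - Real.log (b / 4)))) := by
  have hb' : (0 : ℝ) < b := by exact_mod_cast hb
  have hu : Tendsto (fun n : ℕ => 1 / (n : ℝ)) atTop (nhds 0) := tendsto_one_div_atTop_nhds_zero_nat
  have hG := tendsto_log_Gamma (κ := b / 4) (by positivity) (1 / 2 - b / 4)
  have hmain := (((hu.const_mul (2 / b * (1 / 2 - b / 4) : ℝ)).const_add (1 / 2 : ℝ)).mul_const (Real.log Real.pi)).sub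
    (hG.const_mul (2 / b : ℝ))
  refine (hmain.congr' (eventually_atTop.2 ⟨1, fun n hn => ?_⟩)).trans (le_of_eq ?_)
  · have hn1 : (1 : ℝ) ≤ n := by exact_mod_cast hn
    have : Nonempty (Fin (b * (n * (n - 1) / 2) + n)) := ⟨⟨0, by omega⟩⟩
    rw [EuclideanSpace.volume_closedBall, ENNReal.ofReal_one, one_pow, one_mul, Fintype.card_fin]
    have e : ((b * (n * (n - 1) / 2) + n : ℕ) : ℝ) / 2 = b / 4 * n ^ 2 + (1 / 2 - b / 4) * n := by
      push_cast
      rw [cast_choose_two_div]; ring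
    have hpos : 0 < b / 4 * (n : ℝ) ^ 2 + (1 / 2 - b / 4) * n + 1 := by rw [← e]; positivity
    rw [e, ENNReal.toReal_ofReal (by have := Real.Gamma_pos_of_pos hpos; positivity),
      Real.log_div (by have := Real.pi_pos; positivity) (Real.Gamma_pos_of_pos hpos).ne', Real.log_pow,
      Real.log_sqrt Real.pi_pos.le]
    have e2 : ((b * (n * (n - 1) / 2) + n : ℕ) : ℝ) = 2 * (b / 4 * n ^ 2 + (1 / 2 - b / 4) * n) := by
      rw [← e]; ring
    rw [e2]
    generalize Real.log (Real.Gamma (b / 4 * (n : ℝ) ^ 2 + (1 / 2 - b / 4) * n + 1)) = L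
    generalize Real.log (n : ℝ) = L2
    field_simp
    ring
  · congr 1
    field_simp
    ring

/-- The derivation sending the power sum `X j` to `j X (k + j - 1)`, the effect of the vector field
`x ↦ (x i ^ k)` on power sums. -/
def powDeriv (k : ℕ) : Derivation ℝ (MvPolynomial ℕ ℝ) (MvPolynomial ℕ ℝ) :=
  MvPolynomial.mkDerivation ℝ fun j => (j : ℝ) • MvPolynomial.X (k + j - 1)

/-- The divergence term in the loop equations. -/
def loopTerm (b : ℝ) (k : ℕ) : MvPolynomial ℕ ℝ :=
  ∑ l ∈ Finset.range k, ((b / 2) • (MvPolynomial.X l * MvPolynomial.X (k - 1 - l)) +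
    (1 - b / 2) • MvPolynomial.X (k - 1))

/-- A linear functional solving the loop equations is determined by its value at `1`. -/
lemma eq_zero_of_loop_equations {b c : ℝ} (L : MvPolynomial ℕ ℝ →ₗ[ℝ] ℝ) (h1 : L 1 = 0)
    (h0 : ∀ Q, L (MvPolynomial.X 0 * Q) = c * L Q)
    (hs : ∀ k Q, L (MvPolynomial.X (k + 1) * Q) = L (loopTerm b k * Q + powDeriv k Q)) : L = 0 := by
  have key : ∀ N : ℕ, ∀ s : ℕ →₀ ℕ, Finsupp.weight (fun i => i + 1) s = N → L (MvPolynomial.monomial s 1) = 0 := by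
    intro N
    induction N using Nat.strong_induction_on with
    | _ N ih =>
    intro s hN
    by_cases hs0 : s = 0
    · subst hs0; exact h1
    obtain ⟨k, hk⟩ := Finsupp.ne_iff.1 hs0
    have hk1 : Finsupp.single k 1 ≤ s := Finsupp.single_le_iff.2 (Nat.one_le_iff_ne_zero.2 hk)
    obtain ⟨s', rfl⟩ := exists_add_of_le hk1
    have hmon : ∀ (i : ℕ) (u : ℕ →₀ ℕ), MvPolynomial.X i * MvPolynomial.monomial u (1 : ℝ) =
        MvPolynomial.monomial (Finsupp.single i 1 + u) 1 := fun i u => by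
      rw [MvPolynomial.X, MvPolynomial.monomial_mul, one_mul]
    have hw : ∀ (i : ℕ) (u : ℕ →₀ ℕ), Finsupp.weight (fun i => i + 1) (Finsupp.single i 1 + u) =
        i + 1 + Finsupp.weight (fun i => i + 1) u := fun i u => by
      rw [map_add, Finsupp.weight_single]; simp
    rw [hw] at hN
    rw [← hmon]
    cases k with
    | zero => rw [h0, ih _ (by omega) s' rfl, mul_zero]
    | succ k =>
      rw [hs, map_add, loopTerm, Finset.sum_mul, map_sum, Finset.sum_eq_zero, zero_add]
      · rw [powDeriv, MvPolynomial.mkDerivation_monomial, Finsupp.sum, map_smul, map_sum, Finset.sum_eq_zero, smul_zero]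
        intro i hi
        have hi1 : Finsupp.single i 1 ≤ s' := Finsupp.single_le_iff.2
          (Nat.one_le_iff_ne_zero.2 (Finsupp.mem_support_iff.1 hi))
        obtain ⟨u, rfl⟩ := exists_add_of_le hi1
        rw [hw] at hN
        rw [add_tsub_cancel_left, smul_eq_mul, mul_smul_comm, mul_comm, map_smul]
        rcases Nat.eq_zero_or_pos i with rfl | hi0
        · simp
        · rw [← mul_one ((((Finsupp.single i 1 + u : ℕ →₀ ℕ) i : ℕ) : ℝ)), ← smul_eq_mul (b := (1 : ℝ)),
            ← MvPolynomial.smul_monomial, mul_smul_comm, map_smul, hmon, ih _ ?_ _ (hw _ _)]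
          · simp
          · omega
      · intro l hl
        have hl' := Finset.mem_range.1 hl
        rw [add_mul, map_add, smul_mul_assoc, smul_mul_assoc, map_smul, map_smul, mul_assoc, hmon, hmon, hmon,
          ih _ ?_ _ (hw _ _), ih _ ?_ _ (hw _ _)]
        · simp
        · omega
        · rw [hw]; omega
  refine (MvPolynomial.basisMonomials ℕ ℝ).ext fun s => ?_
  simpa using key _ s rfl

lemma hasDerivAt_eval_mvPolynomial {q : ℕ → ℝ → ℝ} {q' : ℕ → ℝ} {t : ℝ} (hq : ∀ j, HasDerivAt (q j) (q' j) t)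
    (Q : MvPolynomial ℕ ℝ) : HasDerivAt (fun t => MvPolynomial.eval (fun j => q j t) Q)
      (MvPolynomial.eval (fun j => q j t) (MvPolynomial.mkDerivation ℝ (fun j => MvPolynomial.C (q' j)) Q)) t := by
  induction Q using MvPolynomial.induction_on with
  | C a => simpa [MvPolynomial.derivation_C] using hasDerivAt_const t a
  | add P Q hP hQ =>
    simp only [map_add]
    exact hP.add hQ
  | mul_X P j hP =>
    have := hP.mul (hq j)
    simp only [map_mul, MvPolynomial.eval_X, Derivation.leibniz, map_add, smul_eq_mul,
      MvPolynomial.mkDerivation_X, MvPolynomial.eval_C]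
    refine this.congr_deriv ?_
    ring

lemma sum_mul_eval_mkDerivation {ι : Type*} [Fintype ι] {a : ℕ → ℝ} {c : ι → ℝ} {a' : ι → ℕ → ℝ}
    {f : ℕ → MvPolynomial ℕ ℝ} (h : ∀ j, ∑ i, c i * a' i j = MvPolynomial.eval a (f j)) (Q : MvPolynomial ℕ ℝ) :
    ∑ i, c i * MvPolynomial.eval a (MvPolynomial.mkDerivation ℝ (fun j => MvPolynomial.C (a' i j)) Q) =
      MvPolynomial.eval a (MvPolynomial.mkDerivation ℝ f Q) := by
  induction Q using MvPolynomial.induction_on with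
  | C a => simp [MvPolynomial.derivation_C]
  | add P Q hP hQ => simp only [map_add, mul_add, Finset.sum_add_distrib, hP, hQ]
  | mul_X P j hP =>
    simp only [map_mul, MvPolynomial.eval_X, Derivation.leibniz, map_add, smul_eq_mul,
      MvPolynomial.mkDerivation_X, MvPolynomial.eval_C, mul_add, Finset.sum_add_distrib]
    rw [← h j, ← hP, Finset.mul_sum, Finset.mul_sum]
    congr 1 <;> exact Finset.sum_congr rfl fun i _ => by ring

section Kernel

variable {𝕜 : Type} [RCLike 𝕜] {N n : ℕ}

/-- The image of the `b`-th standard basis vector. -/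
def basisMat (T : EuclideanSpace ℝ (Fin N) ≃ₗ[ℝ] HMat 𝕜 n) (b : Fin N) : Matrix (Fin n) (Fin n) 𝕜 :=
  (T (EuclideanSpace.basisFun (Fin N) ℝ b)).val

lemma basisMat_isHermitian (T : EuclideanSpace ℝ (Fin N) ≃ₗ[ℝ] HMat 𝕜 n) (b : Fin N) :
    (basisMat T b)ᴴ = basisMat T b := (T (EuclideanSpace.basisFun (Fin N) ℝ b)).prop

lemma I_mul_I_eq_one_sub_finrank {β : ℕ} (hβ : Module.finrank ℝ 𝕜 = β) :
    (RCLike.I : 𝕜) * RCLike.I = 1 - (β : 𝕜) := by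
  rcases RCLike.I_eq_zero_or_im_I_eq_one (K := 𝕜) with h | h
  · have := (RCLike.realLinearIsometryEquiv h).toLinearEquiv.finrank_eq
    rw [hβ, Module.finrank_self] at this
    simp [h, this]
  · have := (RCLike.complexLinearIsometryEquiv h).toLinearEquiv
    have h2 := (LinearEquiv.restrictScalars ℝ this).finrank_eq
    rw [hβ, Complex.finrank_real_complex] at h2
    rcases RCLike.I_mul_I (K := 𝕜) with h0 | h0
    · rw [h0] at h; simp at h
    · rw [h0, h2]; norm_num

lemma trace_mul_eq_inner {T : EuclideanSpace ℝ (Fin N) ≃ₗ[ℝ] HMat 𝕜 n}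
    (hT : ∀ x y, ⟪x, y⟫ = RCLike.re (Matrix.trace ((T x).val * ((T y).val)ᴴ))) (x y) :
    RCLike.re (Matrix.trace ((T x).val * (T y).val)) = ⟪x, y⟫ := by
  rw [hT, show ((T y).val)ᴴ = (T y).val from (T y).prop]

lemma sum_trace_smul_basisMat {T : EuclideanSpace ℝ (Fin N) ≃ₗ[ℝ] HMat 𝕜 n}
    (hT : ∀ x y, ⟪x, y⟫ = RCLike.re (Matrix.trace ((T x).val * ((T y).val)ᴴ)))
    {H : Matrix (Fin n) (Fin n) 𝕜} (hH : Hᴴ = H) :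
    ∑ b, RCLike.re (Matrix.trace (basisMat T b * H)) • basisMat T b = H := by
  obtain ⟨y, hy⟩ := T.surjective ⟨H, hH⟩
  have h1 := (EuclideanSpace.basisFun (Fin N) ℝ).sum_repr' y
  have h2 := congrArg (fun z => (T z).val) h1
  simp only [map_sum, map_smul, hy, AddSubgroup.val_finsetSum, selfAdjoint.val_smul] at h2
  rw [← h2]
  refine Finset.sum_congr rfl fun b _ => ?_
  congr 1
  rw [← trace_mul_eq_inner hT, hy, h2]; rfl

lemma two_smul_sum_trace_smul_basisMat {T : EuclideanSpace ℝ (Fin N) ≃ₗ[ℝ] HMat 𝕜 n}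
    (hT : ∀ x y, ⟪x, y⟫ = RCLike.re (Matrix.trace ((T x).val * ((T y).val)ᴴ)))
    (M : Matrix (Fin n) (Fin n) 𝕜) :
    (2 : 𝕜) • ∑ b, Matrix.trace (basisMat T b * M) • basisMat T b =
      (1 - RCLike.I * RCLike.I : 𝕜) • M + (1 + RCLike.I * RCLike.I : 𝕜) • Mᴴ := by
  have aux : ∀ M : Matrix (Fin n) (Fin n) 𝕜,
      (2 : 𝕜) • ∑ b, ((RCLike.re (Matrix.trace (basisMat T b * M)) : ℝ) : 𝕜) • basisMat T b = M + Mᴴ := by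
    intro M
    rw [← sum_trace_smul_basisMat hT (H := M + Mᴴ) (by simp [add_comm]), Finset.smul_sum]
    refine Finset.sum_congr rfl fun b _ => ?_
    rw [mul_add, trace_add, map_add]
    have : Matrix.trace (basisMat T b * Mᴴ) = star (Matrix.trace (basisMat T b * M)) := by
      rw [← trace_conjTranspose, conjTranspose_mul, basisMat_isHermitian, trace_mul_comm]
    rw [this, RCLike.star_def, RCLike.conj_re, ← two_mul, smul_smul]
    ext i j
    simp [RCLike.real_smul_eq_coe_mul]
    exact Or.inl (Or.inl (map_ofNat (algebraMap ℝ 𝕜) 2).symm)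
  have h1 := aux M
  have h2 := aux ((RCLike.I : 𝕜) • M)
  have hz : ∀ z : 𝕜, z = ((RCLike.re z : ℝ) : 𝕜) - RCLike.I * ((RCLike.re (RCLike.I * z) : ℝ) : 𝕜) := by
    intro z
    conv_lhs => rw [← RCLike.re_add_im z]
    rw [RCLike.I_mul_re]
    push_cast; ring
  have h3 : ∑ b, Matrix.trace (basisMat T b * M) • basisMat T b =
      ∑ b, ((RCLike.re (Matrix.trace (basisMat T b * M)) : ℝ) : 𝕜) • basisMat T b -
      (RCLike.I : 𝕜) • ∑ b, ((RCLike.re (Matrix.trace (basisMat T b * ((RCLike.I : 𝕜) • M))) : ℝ) : 𝕜) • basisMat T b := by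
    rw [Finset.smul_sum, ← Finset.sum_sub_distrib]
    refine Finset.sum_congr rfl fun b _ => ?_
    rw [smul_smul, ← sub_smul]
    congr 1
    rw [mul_smul_comm, trace_smul, smul_eq_mul]
    exact hz _
  rw [h3, smul_sub, h1, smul_comm, h2, conjTranspose_smul, RCLike.star_def, RCLike.conj_I]
  ext i j
  simp
  ring

/-- The contraction identity for an orthonormal basis of the Hermitian matrices. -/
lemma sum_basisMat_mul_mul_basisMat {β : ℕ} (hβ : Module.finrank ℝ 𝕜 = β)
    {T : EuclideanSpace ℝ (Fin N) ≃ₗ[ℝ] HMat 𝕜 n}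
    (hT : ∀ x y, ⟪x, y⟫ = RCLike.re (Matrix.trace ((T x).val * ((T y).val)ᴴ)))
    {X : Matrix (Fin n) (Fin n) 𝕜} (hX : Xᴴ = X) :
    ∑ b, basisMat T b * X * basisMat T b =
      ((β : 𝕜) / 2) • (Matrix.trace X • (1 : Matrix (Fin n) (Fin n) 𝕜)) + (1 - (β : 𝕜) / 2) • X := by
  have hI := I_mul_I_eq_one_sub_finrank hβ
  have hk : ∀ p r s q, 2 * ∑ b, basisMat T b p r * basisMat T b s q =
      (β : 𝕜) * (if r = s ∧ p = q then 1 else 0) + (2 - β) * (if p = s ∧ r = q then 1 else 0) := by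
    intro p r s q
    have := congrFun (congrFun (two_smul_sum_trace_smul_basisMat hT (Matrix.single r p 1)) s) q
    rw [hI] at this
    simp only [Matrix.smul_apply, Matrix.sum_apply, Matrix.add_apply, smul_eq_mul, conjTranspose_single, star_one,
      Matrix.single_apply] at this
    convert this using 2
    · refine Finset.sum_congr rfl fun b _ => ?_
      congr 1
      rw [trace_mul_comm, trace_single_mul]; simp
    · ring
    · ring
  have hX2 : ∀ p q, (2 - (β : 𝕜)) * X q p = (2 - (β : 𝕜)) * X p q := by
    intro p q
    rcases RCLike.I_mul_I (K := 𝕜) with h0 | h0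
    · conv_rhs => rw [← hX, conjTranspose_apply, RCLike.star_def, RCLike.conj_eq_re_sub_im, h0, mul_zero, sub_zero]
      conv_lhs => rw [← RCLike.re_add_im (X q p), h0, mul_zero, add_zero]
    · have : (2 - (β : 𝕜)) = 0 := by linear_combination h0 - hI
      rw [this, zero_mul, zero_mul]
  ext p q
  have h2 : (2 : 𝕜) * (∑ b, basisMat T b * X * basisMat T b) p q =
      ∑ s, ∑ r, X r s * (2 * ∑ b, basisMat T b p r * basisMat T b s q) := by
    simp only [Matrix.sum_apply, mul_apply, Finset.mul_sum, Finset.sum_mul]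
    rw [Finset.sum_comm]
    refine Finset.sum_congr rfl fun s _ => ?_
    rw [Finset.sum_comm]
    refine Finset.sum_congr rfl fun r _ => Finset.sum_congr rfl fun b _ => ?_
    ring
  have h3 : (2 : 𝕜) * (∑ b, basisMat T b * X * basisMat T b) p q =
      β * (Matrix.trace X * (1 : Matrix (Fin n) (Fin n) 𝕜) p q) + (2 - β) * X q p := by
    rw [h2]
    simp only [hk, mul_add, Finset.sum_add_distrib]
    congr 1
    · by_cases hpq : p = q
      · subst hpq
        simp [Matrix.trace, Finset.mul_sum, mul_comm]
      · simp [hpq]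
    · rw [Finset.sum_eq_single p, Finset.sum_eq_single q]
      · simp [mul_comm]
      · intro b _ hb; simp [hb]
      · simp
      · intro b _ hb; simp [hb.symm]
      · simp
  rw [hX2] at h3
  simp only [Matrix.add_apply, Matrix.smul_apply, smul_eq_mul]
  linear_combination h3 / 2

end Kernel

section Growth

variable {E R : Type*} [NormedAddCommGroup E] [NormedRing R]

/-- Continuous functions of at most polynomial growth. -/
structure PolyGrowth (f : E → R) : Prop where
  cont : Continuous f
  bound : ∃ (C : ℝ) (M : ℕ), 0 ≤ C ∧ ∀ x, ‖f x‖ ≤ C * (1 + ‖x‖) ^ M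

namespace PolyGrowth

lemma of_le {g : E → ℝ} {f : E → R} (hg : PolyGrowth g) (hf : Continuous f) (h : ∀ x, ‖f x‖ ≤ g x) :
    PolyGrowth f := by
  obtain ⟨C, M, hC, hb⟩ := hg.bound
  exact ⟨hf, C, M, hC, fun x => (h x).trans ((le_abs_self _).trans (hb x))⟩

lemma const (c : R) : PolyGrowth (fun _ : E => c) :=
  ⟨continuous_const, ‖c‖, 0, norm_nonneg _, fun x => by simp⟩

lemma add {f g : E → R} (hf : PolyGrowth f) (hg : PolyGrowth g) : PolyGrowth (fun x => f x + g x) := by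
  obtain ⟨C, M, hC, hb⟩ := hf.bound
  obtain ⟨D, K, hD, hb'⟩ := hg.bound
  refine ⟨hf.cont.add hg.cont, C + D, M + K, by positivity, fun x => (norm_add_le _ _).trans ?_⟩
  have h1 : (1 : ℝ) ≤ 1 + ‖x‖ := by simp
  have e1 : (1 + ‖x‖) ^ M ≤ (1 + ‖x‖) ^ (M + K) := pow_le_pow_right₀ h1 (by omega)
  have e2 : (1 + ‖x‖) ^ K ≤ (1 + ‖x‖) ^ (M + K) := pow_le_pow_right₀ h1 (by omega)
  nlinarith [hb x, hb' x, mul_le_mul_of_nonneg_left e1 hC, mul_le_mul_of_nonneg_left e2 hD]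

lemma mul {f g : E → R} (hf : PolyGrowth f) (hg : PolyGrowth g) : PolyGrowth (fun x => f x * g x) := by
  obtain ⟨C, M, hC, hb⟩ := hf.bound
  obtain ⟨D, K, hD, hb'⟩ := hg.bound
  refine ⟨hf.cont.mul hg.cont, C * D, M + K, by positivity, fun x => (norm_mul_le _ _).trans ?_⟩
  refine (mul_le_mul (hb x) (hb' x) (norm_nonneg _) (by positivity)).trans (le_of_eq ?_)
  ring

lemma neg {f : E → R} (hf : PolyGrowth f) : PolyGrowth (fun x => - f x) := by
  obtain ⟨C, M, hC, hb⟩ := hf.bound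
  exact ⟨hf.cont.neg, C, M, hC, fun x => by simpa using hb x⟩

lemma sub {f g : E → R} (hf : PolyGrowth f) (hg : PolyGrowth g) : PolyGrowth (fun x => f x - g x) := by
  simpa only [sub_eq_add_neg] using hf.add hg.neg

lemma sum {ι : Type*} {s : Finset ι} {f : ι → E → R} (hf : ∀ i ∈ s, PolyGrowth (f i)) :
    PolyGrowth (fun x => ∑ i ∈ s, f i x) := by
  classical
  induction s using Finset.induction_on with
  | empty => simpa using const 0
  | insert a s ha ih =>
    simp only [Finset.sum_insert ha]
    exact (hf a (by simp)).add (ih fun i hi => hf i (by simp [hi]))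

lemma prod {R : Type*} [NormedCommRing R] {ι : Type*} {s : Finset ι} {f : ι → E → R}
    (hf : ∀ i ∈ s, PolyGrowth (f i)) : PolyGrowth (fun x => ∏ i ∈ s, f i x) := by
  classical
  induction s using Finset.induction_on with
  | empty => simpa using const 1
  | insert a s ha ih =>
    simp only [Finset.prod_insert ha]
    exact (hf a (by simp)).mul (ih fun i hi => hf i (by simp [hi]))

lemma pow {f : E → R} (hf : PolyGrowth f) (k : ℕ) : PolyGrowth (fun x => f x ^ k) := by
  induction k with
  | zero => simpa using const 1
  | succ k ih => simpa only [pow_succ] using ih.mul hf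

lemma clm [NormedSpace ℝ E] [NormedSpace ℝ R] (f : E →L[ℝ] R) : PolyGrowth (fun x => f x) :=
  ⟨f.continuous, ‖f‖, 1, norm_nonneg _, fun x => (f.le_opNorm x).trans (by
    gcongr; simp)⟩

lemma re {𝕜 : Type*} [RCLike 𝕜] {f : E → 𝕜} (hf : PolyGrowth f) : PolyGrowth (fun x => RCLike.re (f x)) := by
  obtain ⟨C, M, hC, hb⟩ := hf.bound
  exact ⟨RCLike.continuous_re.comp hf.cont, C, M, hC, fun x => (RCLike.norm_re_le_norm _).trans (hb x)⟩

lemma matrix_mul {m : Type*} [Fintype m] {A B : E → Matrix m m R} (hA : ∀ i j, PolyGrowth fun x => A x i j)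
    (hB : ∀ i j, PolyGrowth fun x => B x i j) (i j : m) : PolyGrowth fun x => (A x * B x) i j := by
  simp only [Matrix.mul_apply]
  exact sum fun k _ => (hA i k).mul (hB k j)

lemma matrix_pow {m : Type*} [Fintype m] [DecidableEq m] {A : E → Matrix m m R} (hA : ∀ i j, PolyGrowth fun x => A x i j)
    (k : ℕ) (i j : m) : PolyGrowth fun x => (A x ^ k) i j := by
  induction k generalizing i j with
  | zero => simpa using const _
  | succ k ih => simpa only [pow_succ] using matrix_mul ih hA i j

lemma trace {m : Type*} [Fintype m] {A : E → Matrix m m R} (hA : ∀ i j, PolyGrowth fun x => A x i j) :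
    PolyGrowth fun x => (A x).trace := by
  simp only [Matrix.trace, Matrix.diag]
  exact sum fun i _ => hA i i

lemma eval_mvPolynomial {f : ℕ → E → ℝ} (hf : ∀ j, PolyGrowth (f j)) (Q : MvPolynomial ℕ ℝ) :
    PolyGrowth (fun x => MvPolynomial.eval (fun j => f j x) Q) := by
  induction Q using MvPolynomial.induction_on with
  | C a => simpa using const a
  | add P Q hP hQ => simpa using hP.add hQ
  | mul_X P j hP => simpa using hP.mul (hf j)

lemma eval_mkDerivation {f f' : ℕ → E → ℝ} (hf : ∀ j, PolyGrowth (f j)) (hf' : ∀ j, PolyGrowth (f' j))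
    (Q : MvPolynomial ℕ ℝ) :
    PolyGrowth (fun x => MvPolynomial.eval (fun j => f j x)
      (MvPolynomial.mkDerivation ℝ (fun j => MvPolynomial.C (f' j x)) Q)) := by
  induction Q using MvPolynomial.induction_on with
  | C a => simpa [MvPolynomial.derivation_C] using const (0 : ℝ)
  | add P Q hP hQ => simpa using hP.add hQ
  | mul_X P j hP =>
    simp only [Derivation.leibniz, map_add, smul_eq_mul, map_mul, MvPolynomial.eval_X,
      MvPolynomial.mkDerivation_X, MvPolynomial.eval_C]
    exact ((eval_mvPolynomial hf P).mul (hf' j)).add ((hf j).mul hP)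

variable [NormedSpace ℝ E] [FiniteDimensional ℝ E] [MeasurableSpace E] [BorelSpace E]

/-- Functions of polynomial growth are integrable against Gaussian-type weights, even with an
additional exponential factor. -/
lemma integrable_mul_exp {f φ : E → ℝ} (hf : PolyGrowth f) (hφ : Continuous φ) {a : ℝ} (ha : 0 < a)
    (hle : ∀ x, a * ‖x‖ ^ 2 ≤ φ x) (c : ℝ) (μ : Measure E) [μ.IsAddHaarMeasure] :
    Integrable (fun x => f x * (Real.exp (c * ‖x‖) * Real.exp (- φ x))) μ := by
  obtain ⟨C, M, hC, hb⟩ := hf.bound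
  have h1 : Integrable (fun x : E => (1 + ‖x‖) ^ (-(Module.finrank ℝ E + 1 : ℝ))) μ :=
    integrable_one_add_norm (by simp)
  obtain ⟨K, hK⟩ : ∃ K : ℝ, ∀ r : ℝ, 0 ≤ r →
      (1 + r) ^ (M + (Module.finrank ℝ E + 1)) * Real.exp (c * r - a * r ^ 2) ≤ K := by
    set m := M + (Module.finrank ℝ E + 1)
    refine ⟨m.factorial * Real.exp (1 + (c + 1) ^ 2 / (4 * a)), fun r hr => ?_⟩
    have e1 : (1 + r) ^ m ≤ m.factorial * Real.exp (1 + r) := by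
      have := Real.pow_div_factorial_le_exp (1 + r) (by linarith) m
      rwa [div_le_iff₀ (by positivity), mul_comm] at this
    refine (mul_le_mul_of_nonneg_right e1 (Real.exp_pos _).le).trans ?_
    rw [mul_assoc, ← Real.exp_add]
    refine mul_le_mul_of_nonneg_left (Real.exp_le_exp.2 ?_) (by positivity)
    have : (c + 1) * r - a * r ^ 2 ≤ (c + 1) ^ 2 / (4 * a) := by
      rw [le_div_iff₀ (by positivity)]
      nlinarith [sq_nonneg (2 * a * r - (c + 1))]
    linarith
  refine (h1.const_mul (C * K)).mono' ?_ (ae_of_all _ fun x => ?_)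
  · have := hf.cont
    exact Continuous.aestronglyMeasurable (by fun_prop)
  have hx : (0 : ℝ) < 1 + ‖x‖ := by positivity
  rw [norm_mul, ← Real.exp_add, Real.norm_of_nonneg (Real.exp_pos _).le]
  have h2 := hK ‖x‖ (norm_nonneg _)
  have h3 : Real.exp (c * ‖x‖ + -φ x) ≤ Real.exp (c * ‖x‖ - a * ‖x‖ ^ 2) :=
    Real.exp_le_exp.2 (by linarith [hle x])
  refine (mul_le_mul (hb x) h3 (Real.exp_pos _).le (by positivity)).trans ?_
  rw [Real.rpow_neg hx.le, ← Nat.cast_add_one, Real.rpow_natCast, ← div_eq_mul_inv, le_div_iff₀ (by positivity)]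
  rw [pow_add] at h2
  calc _ = C * ((1 + ‖x‖) ^ M * (1 + ‖x‖) ^ (Module.finrank ℝ E + 1) * Real.exp (c * ‖x‖ - a * ‖x‖ ^ 2)) := by ring
    _ ≤ _ := mul_le_mul_of_nonneg_left h2 hC

lemma integrable_mul_exp_neg {f φ : E → ℝ} (hf : PolyGrowth f) (hφ : Continuous φ) {a : ℝ} (ha : 0 < a)
    (hle : ∀ x, a * ‖x‖ ^ 2 ≤ φ x) (μ : Measure E) [μ.IsAddHaarMeasure] :
    Integrable (fun x => f x * Real.exp (- φ x)) μ := by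
  simpa using hf.integrable_mul_exp hφ ha hle 0 μ

end PolyGrowth

variable [NormedSpace ℝ E] [FiniteDimensional ℝ E] [MeasurableSpace E] [BorelSpace E]

/-- The integral of a divergence against a Gaussian-type weight vanishes. -/
lemma integral_divergence_eq_zero {ι : Type*} [Fintype ι] {v : ι → E} {G G' φ' : ι → E → ℝ} {φ : E → ℝ}
    (hG : ∀ i, PolyGrowth (G i)) (hG' : ∀ i, PolyGrowth (G' i)) (hφ' : ∀ i, PolyGrowth (φ' i))
    (hφ : Continuous φ) {a : ℝ} (ha : 0 < a) (hle : ∀ x, a * ‖x‖ ^ 2 ≤ φ x)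
    (hGd : ∀ i x, HasLineDerivAt ℝ (G i) (G' i x) x (v i))
    (hφd : ∀ i x, HasLineDerivAt ℝ φ (φ' i x) x (v i)) (μ : Measure E) [μ.IsAddHaarMeasure] :
    ∫ x, (∑ i, (G' i x - G i x * φ' i x)) * Real.exp (- φ x) ∂μ = 0 := by
  simp only [Finset.sum_mul]
  rw [integral_finsetSum _ fun i _ => ((hG' i).sub ((hG i).mul (hφ' i))).integrable_mul_exp_neg hφ ha hle μ]
  refine Finset.sum_eq_zero fun i _ => ?_
  have hd : ∀ x, HasLineDerivAt ℝ (fun x => G i x * Real.exp (- φ x))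
      ((G' i x - G i x * φ' i x) * Real.exp (- φ x)) x (v i) := by
    intro x
    have h1 := hGd i x
    have h2 := hφd i x
    unfold HasLineDerivAt at *
    refine (h1.mul h2.neg.exp).congr_deriv ?_
    simp; ring
  have hint1 := ((hG' i).sub ((hG i).mul (hφ' i))).integrable_mul_exp_neg hφ ha hle μ
  have hint2 := (hG i).integrable_mul_exp_neg hφ ha hle μ
  have := integral_bilinear_hasLineDerivAt_right_eq_neg_left_of_integrable (μ := μ) (v := v i)
    (f := fun _ : E => (1 : ℝ)) (f' := fun _ => 0) (B := ContinuousLinearMap.mul ℝ ℝ)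
    (by simp) (by simpa using hint1) (by simpa using hint2) (fun x _ => hasDerivAt_const (0 : ℝ) (1 : ℝ)) fun x _ => hd x
  simpa using this

end Growth

/-- The linear functional `Q ↦ ∫ Q(f) w dμ`. -/
def momentFunctional {E : Type*} [MeasurableSpace E] (μ : Measure E) (f : ℕ → E → ℝ) (w : E → ℝ)
    (h : ∀ Q : MvPolynomial ℕ ℝ, Integrable (fun x => MvPolynomial.eval (fun j => f j x) Q * w x) μ) :
    MvPolynomial ℕ ℝ →ₗ[ℝ] ℝ where
  toFun Q := ∫ x, MvPolynomial.eval (fun j => f j x) Q * w x ∂μ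
  map_add' P Q := by
    simp only [map_add, add_mul]
    exact integral_add (h P) (h Q)
  map_smul' c Q := by
    simp only [MvPolynomial.smul_eval, mul_assoc, integral_const_mul, RingHom.id_apply, smul_eq_mul]

section MatrixDeriv

variable {𝕜 : Type} [RCLike 𝕜] {m : Type*} [Fintype m]

lemma hasDerivAt_matrix_pow [DecidableEq m] {M : ℝ → Matrix m m 𝕜} {M' : Matrix m m 𝕜} {t : ℝ}
    (h : ∀ i j, HasDerivAt (fun t => M t i j) (M' i j) t) (k : ℕ) :
    ∀ i j, HasDerivAt (fun t => (M t ^ k) i j)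
      ((∑ l ∈ Finset.range k, M t ^ l * M' * M t ^ (k - 1 - l)) i j) t := by
  induction k with
  | zero => intro i j; simpa using hasDerivAt_const t _
  | succ k ih =>
    intro i j
    simp only [pow_succ, Matrix.mul_apply]
    refine (HasDerivAt.fun_sum fun r _ => (ih i r).mul (h r j)).congr_deriv ?_
    rw [Finset.sum_range_succ, Finset.sum_add_distrib, ← Matrix.mul_apply, ← Matrix.mul_apply,
      Finset.sum_mul, Matrix.add_apply]
    congr 1
    · refine congrFun (congrFun (Finset.sum_congr rfl fun l hl => ?_) i) j
      have := Finset.mem_range.1 hl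
      rw [show k + 1 - 1 - l = (k - 1 - l) + 1 by omega, pow_succ, mul_assoc, mul_assoc]
    · simp

lemma hasDerivAt_re_trace {M : ℝ → Matrix m m 𝕜} {M' : Matrix m m 𝕜} {t : ℝ}
    (h : ∀ i j, HasDerivAt (fun t => M t i j) (M' i j) t) :
    HasDerivAt (fun t => RCLike.re (M t).trace) (RCLike.re M'.trace) t := by
  simp only [Matrix.trace, Matrix.diag]
  have := HasDerivAt.fun_sum (u := Finset.univ) fun i _ => h i i
  exact (RCLike.reCLM (K := 𝕜)).hasFDerivAt.comp_hasDerivAt t this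

lemma hasDerivAt_const_mul_matrix {M : ℝ → Matrix m m 𝕜} {M' : Matrix m m 𝕜} {t : ℝ} (B : Matrix m m 𝕜)
    (h : ∀ i j, HasDerivAt (fun t => M t i j) (M' i j) t) (i j : m) :
    HasDerivAt (fun t => (B * M t) i j) ((B * M') i j) t := by
  simp only [Matrix.mul_apply]
  exact HasDerivAt.fun_sum fun r _ => (h r j).const_mul _

end MatrixDeriv

lemma HasLineDerivAt.mul_fun {E : Type*} [AddCommGroup E] [Module ℝ E] {f g : E → ℝ} {f' g' : ℝ} {x v : E}
    (hf : HasLineDerivAt ℝ f f' x v) (hg : HasLineDerivAt ℝ g g' x v) :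
    HasLineDerivAt ℝ (fun x => f x * g x) (f' * g x + f x * g') x v := by
  unfold HasLineDerivAt at *
  simpa using HasDerivAt.fun_mul hf hg

lemma hasLineDerivAt_eval_mvPolynomial {E : Type*} [AddCommGroup E] [Module ℝ E] {q : ℕ → E → ℝ} {q' : ℕ → ℝ}
    {x v : E} (hq : ∀ j, HasLineDerivAt ℝ (q j) (q' j) x v) (Q : MvPolynomial ℕ ℝ) :
    HasLineDerivAt ℝ (fun x => MvPolynomial.eval (fun j => q j x) Q)
      (MvPolynomial.eval (fun j => q j x) (MvPolynomial.mkDerivation ℝ (fun j => MvPolynomial.C (q' j)) Q)) x v := by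
  have := hasDerivAt_eval_mvPolynomial hq Q
  simp only [zero_smul, add_zero] at this
  exact this

section GaussianLoop

variable {𝕜 : Type} [RCLike 𝕜] {N n : ℕ} (T : EuclideanSpace ℝ (Fin N) ≃ₗ[ℝ] HMat 𝕜 n)

/-- The trace of the `k`-th power. -/
def trPow (k : ℕ) (x : EuclideanSpace ℝ (Fin N)) : ℝ := RCLike.re ((T x).val ^ k).trace

lemma polyGrowth_entry (i j : Fin n) : PolyGrowth fun x => (T x).val i j := by
  have h : IsLinearMap ℝ fun x => (T x).val i j :=
    ⟨fun x y => by simp, fun c x => by simp⟩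
  exact PolyGrowth.clm (LinearMap.toContinuousLinearMap h.mk')

lemma polyGrowth_trPow (k : ℕ) : PolyGrowth (trPow T k) :=
  (PolyGrowth.trace (PolyGrowth.matrix_pow (polyGrowth_entry T) k)).re

lemma hasDerivAt_entry (x v : EuclideanSpace ℝ (Fin N)) (i j : Fin n) :
    HasDerivAt (fun t : ℝ => (T (x + t • v)).val i j) ((T v).val i j) 0 := by
  have : (fun t : ℝ => (T (x + t • v)).val i j) = fun t : ℝ => (T x).val i j + t • (T v).val i j := by
    ext t; simp
  rw [this]
  simpa using ((hasDerivAt_id (0 : ℝ)).smul_const ((T v).val i j)).const_add ((T x).val i j)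

lemma hasLineDerivAt_trPow (k : ℕ) (b : Fin N) (x : EuclideanSpace ℝ (Fin N)) :
    HasLineDerivAt ℝ (trPow T k) (k * RCLike.re (basisMat T b * (T x).val ^ (k - 1)).trace) x
      (EuclideanSpace.basisFun (Fin N) ℝ b) := by
  refine (hasDerivAt_re_trace (hasDerivAt_matrix_pow (hasDerivAt_entry T x _) k)).congr_deriv ?_
  simp only [zero_smul, add_zero, Matrix.trace_sum, map_sum]
  rw [Finset.sum_congr rfl (g := fun _ => RCLike.re (basisMat T b * (T x).val ^ (k - 1)).trace)]
  · simp
  · intro l hl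
    have := Finset.mem_range.1 hl
    rw [Matrix.trace_mul_comm, ← mul_assoc, ← pow_add, Matrix.trace_mul_comm,
      show k - 1 - l + l = k - 1 by omega]
    rfl

lemma hasLineDerivAt_field (k : ℕ) (b : Fin N) (x : EuclideanSpace ℝ (Fin N)) :
    HasLineDerivAt ℝ (fun x => RCLike.re (basisMat T b * (T x).val ^ k).trace)
      (∑ l ∈ Finset.range k,
        RCLike.re (basisMat T b * (T x).val ^ l * basisMat T b * (T x).val ^ (k - 1 - l)).trace) x
      (EuclideanSpace.basisFun (Fin N) ℝ b) := by
  refine (hasDerivAt_re_trace (hasDerivAt_const_mul_matrix (basisMat T b)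
    (hasDerivAt_matrix_pow (hasDerivAt_entry T x _) k))).congr_deriv ?_
  simp only [zero_smul, add_zero, Finset.mul_sum, Matrix.trace_sum, map_sum, mul_assoc]
  rfl

variable {T}

lemma conjTranspose_pow_val (x : EuclideanSpace ℝ (Fin N)) (k : ℕ) : ((T x).val ^ k)ᴴ = (T x).val ^ k := by
  rw [Matrix.conjTranspose_pow, show ((T x).val)ᴴ = (T x).val from (T x).prop]

lemma trace_pow_eq_trPow (x : EuclideanSpace ℝ (Fin N)) (k : ℕ) : ((T x).val ^ k).trace = (trPow T k x : 𝕜) := by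
  symm
  rw [trPow, ← RCLike.conj_eq_iff_re, ← RCLike.star_def, ← Matrix.trace_conjTranspose, conjTranspose_pow_val]

lemma sum_field_mul (hT : ∀ x y, ⟪x, y⟫ = RCLike.re (Matrix.trace ((T x).val * ((T y).val)ᴴ)))
    (x : EuclideanSpace ℝ (Fin N)) (k l : ℕ) :
    ∑ b, RCLike.re (basisMat T b * (T x).val ^ k).trace * RCLike.re (basisMat T b * (T x).val ^ l).trace =
      trPow T (k + l) x := by
  have h := sum_trace_smul_basisMat hT (conjTranspose_pow_val (T := T) x k)
  have h2 := congrArg (fun M : Matrix (Fin n) (Fin n) 𝕜 => RCLike.re (M * (T x).val ^ l).trace) h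
  simp only [Finset.sum_mul, smul_mul_assoc, Matrix.trace_sum, Matrix.trace_smul, map_sum, RCLike.smul_re] at h2
  rw [h2, trPow, pow_add]

lemma sum_div_field {β : ℕ} (hβ : Module.finrank ℝ 𝕜 = β)
    (hT : ∀ x y, ⟪x, y⟫ = RCLike.re (Matrix.trace ((T x).val * ((T y).val)ᴴ)))
    (x : EuclideanSpace ℝ (Fin N)) (k : ℕ) :
    ∑ b, ∑ l ∈ Finset.range k,
        RCLike.re (basisMat T b * (T x).val ^ l * basisMat T b * (T x).val ^ (k - 1 - l)).trace =
      MvPolynomial.eval (fun j => trPow T j x) (loopTerm β k) := by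
  rw [Finset.sum_comm, loopTerm, map_sum]
  refine Finset.sum_congr rfl fun l hl => ?_
  have hl' := Finset.mem_range.1 hl
  rw [← map_sum, ← Matrix.trace_sum, ← Finset.sum_mul, sum_basisMat_mul_mul_basisMat hβ hT (conjTranspose_pow_val x l),
    add_mul, smul_mul_assoc, smul_mul_assoc, smul_mul_assoc, one_mul, ← pow_add, show l + (k - 1 - l) = k - 1 by omega,
    Matrix.trace_add, Matrix.trace_smul, Matrix.trace_smul, Matrix.trace_smul, trace_pow_eq_trPow, trace_pow_eq_trPow,
    trace_pow_eq_trPow]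
  simp only [map_add, MvPolynomial.smul_eval, map_mul, MvPolynomial.eval_X, smul_eq_mul]
  rw [← map_add, show ((β : 𝕜) / 2 * ((trPow T l x : ℝ) * (trPow T (k - 1 - l) x : ℝ)) + (1 - (β : 𝕜) / 2) * (trPow T (k - 1) x : ℝ)) =
    ((((β : ℝ) / 2 * (trPow T l x * trPow T (k - 1 - l) x) + (1 - (β : ℝ) / 2) * trPow T (k - 1) x) : ℝ) : 𝕜) by
      push_cast; rfl, RCLike.ofReal_re]

lemma integrable_trPow (Q : MvPolynomial ℕ ℝ) : Integrable (fun x =>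
    MvPolynomial.eval (fun j => trPow T j x) Q * Real.exp (-(‖x‖ ^ 2 / 2))) volume :=
  (PolyGrowth.eval_mvPolynomial (polyGrowth_trPow T) Q).integrable_mul_exp_neg (φ := fun x => ‖x‖ ^ 2 / 2) (by fun_prop)
    (a := 1 / 2) (by norm_num) (fun x => by linarith) volume

lemma gaussian_loop_equation {β : ℕ} (hβ : Module.finrank ℝ 𝕜 = β)
    (hT : ∀ x y, ⟪x, y⟫ = RCLike.re (Matrix.trace ((T x).val * ((T y).val)ᴴ))) (k : ℕ) (Q : MvPolynomial ℕ ℝ) :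
    momentFunctional volume (trPow T) (fun x => Real.exp (-(‖x‖ ^ 2 / 2))) integrable_trPow (MvPolynomial.X (k + 1) * Q) =
    momentFunctional volume (trPow T) (fun x => Real.exp (-(‖x‖ ^ 2 / 2))) integrable_trPow
      (loopTerm β k * Q + powDeriv k Q) := by
  have hB : ∀ (b : Fin N) (i j : Fin n), PolyGrowth fun _ : EuclideanSpace ℝ (Fin N) => basisMat T b i j :=
    fun b i j => PolyGrowth.const _
  have hpow := fun k => PolyGrowth.matrix_pow (polyGrowth_entry T) k
  have hF : ∀ (k : ℕ) (b : Fin N), PolyGrowth fun x => RCLike.re (basisMat T b * (T x).val ^ k).trace :=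
    fun k b => (PolyGrowth.trace (PolyGrowth.matrix_mul (hB b) (hpow k))).re
  have hF' : ∀ b : Fin N, PolyGrowth fun x => ∑ l ∈ Finset.range k,
        RCLike.re (basisMat T b * (T x).val ^ l * basisMat T b * (T x).val ^ (k - 1 - l)).trace :=
    fun b => PolyGrowth.sum fun l _ => (PolyGrowth.trace (PolyGrowth.matrix_mul
      (PolyGrowth.matrix_mul (PolyGrowth.matrix_mul (hB b) (hpow l)) (hB b)) (hpow _))).re
  have hQ := PolyGrowth.eval_mvPolynomial (polyGrowth_trPow T) Q
  have hD : ∀ b : Fin N, PolyGrowth fun x => MvPolynomial.eval (fun j => trPow T j x)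
      (MvPolynomial.mkDerivation ℝ (fun j : ℕ => MvPolynomial.C
        ((j : ℝ) * RCLike.re (basisMat T b * (T x).val ^ (j - 1)).trace)) Q) :=
    fun b => PolyGrowth.eval_mkDerivation (polyGrowth_trPow T) (fun j => (PolyGrowth.const _).mul (hF _ b)) Q
  have hcoord : ∀ b : Fin N, PolyGrowth fun x : EuclideanSpace ℝ (Fin N) => ⟪x, EuclideanSpace.basisFun (Fin N) ℝ b⟫ :=
    fun b => by
      have h : (fun x : EuclideanSpace ℝ (Fin N) => ⟪x, EuclideanSpace.basisFun (Fin N) ℝ b⟫) =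
          fun x => innerSL ℝ (EuclideanSpace.basisFun (Fin N) ℝ b) x :=
        funext fun x => by rw [innerSL_apply_apply, real_inner_comm]
      rw [h]
      exact PolyGrowth.clm (innerSL ℝ (EuclideanSpace.basisFun (Fin N) ℝ b))
  have main := integral_divergence_eq_zero (v := fun b => EuclideanSpace.basisFun (Fin N) ℝ b)
    (φ := fun x => ‖x‖ ^ 2 / 2) (a := 1 / 2) (fun b => (hF k b).mul hQ)
    (fun b => ((hF' b).mul hQ).add ((hF k b).mul (hD b))) hcoord (by fun_prop) (by norm_num) (fun x => by linarith)
    (fun b x => (hasLineDerivAt_field T k b x).mul_fun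
      (hasLineDerivAt_eval_mvPolynomial (fun j => hasLineDerivAt_trPow T j b x) Q)) (fun b x => ?_) volume
  rotate_left
  · have h1 := ((hasStrictFDerivAt_norm_sq x).hasFDerivAt).hasLineDerivAt (EuclideanSpace.basisFun (Fin N) ℝ b)
    refine (HasDerivAt.div_const h1 2).congr_deriv ?_
    simp
  have hpt : ∀ x : EuclideanSpace ℝ (Fin N), MvPolynomial.eval (fun j => trPow T j x) (powDeriv k Q) =
      ∑ b, RCLike.re (basisMat T b * (T x).val ^ k).trace * MvPolynomial.eval (fun j => trPow T j x)
      (MvPolynomial.mkDerivation ℝ (fun j : ℕ => MvPolynomial.C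
        ((j : ℝ) * RCLike.re (basisMat T b * (T x).val ^ (j - 1)).trace)) Q) := by
    intro x
    rw [powDeriv, sum_mul_eval_mkDerivation]
    intro j
    simp only [MvPolynomial.smul_eval, MvPolynomial.eval_X]
    rcases Nat.eq_zero_or_pos j with rfl | hj
    · simp
    · rw [Nat.add_sub_assoc hj, ← sum_field_mul hT, Finset.mul_sum]
      exact Finset.sum_congr rfl fun b _ => by ring
  have hin : ∀ x : EuclideanSpace ℝ (Fin N),
      ∑ b, RCLike.re (basisMat T b * (T x).val ^ k).trace * ⟪x, EuclideanSpace.basisFun (Fin N) ℝ b⟫ =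
        trPow T (k + 1) x := by
    intro x
    rw [← sum_field_mul hT]
    refine Finset.sum_congr rfl fun b _ => ?_
    rw [pow_one, ← trace_mul_eq_inner hT, Matrix.trace_mul_comm (T x).val]; rfl
  rw [← sub_eq_zero, ← neg_eq_zero, neg_sub, ← map_sub]
  rw [← main]
  refine integral_congr_ae (ae_of_all _ fun x => ?_)
  beta_reduce
  rw [map_sub, map_add, map_mul, map_mul, MvPolynomial.eval_X]
  simp only [Finset.sum_sub_distrib, Finset.sum_add_distrib]
  congr 1
  rw [hpt, ← hin, ← sum_div_field hβ hT, Finset.sum_mul, Finset.sum_mul]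
  congr 1
  exact Finset.sum_congr rfl fun b _ => by ring

end GaussianLoop

section EigenvalueLoop

variable {n : ℕ}

/-- The power sums. -/
def powSum (k : ℕ) (x : Fin n → ℝ) : ℝ := ∑ i, x i ^ k

/-- The pairs of indices with increasing entries. -/
def ltPairs (n : ℕ) : Finset (Fin n × Fin n) := Finset.univ.filter fun p => p.1 < p.2

lemma det_vandermonde_eq_prod_ltPairs (x : Fin n → ℝ) :
    (vandermonde x).det = ∏ p ∈ ltPairs n, (x p.2 - x p.1) := by
  rw [Matrix.det_vandermonde, ltPairs, Finset.prod_filter, ← Finset.univ_product_univ, Finset.prod_product]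
  refine Finset.prod_congr rfl fun i _ => ?_
  rw [← Finset.prod_filter]
  refine Finset.prod_congr ?_ fun _ _ => rfl
  ext; simp

lemma polyGrowth_coord (i : Fin n) : PolyGrowth fun x : Fin n → ℝ => x i :=
  PolyGrowth.clm (ContinuousLinearMap.proj (R := ℝ) (φ := fun _ : Fin n => ℝ) i)

lemma polyGrowth_powSum (k : ℕ) : PolyGrowth (powSum (n := n) k) :=
  PolyGrowth.sum fun i _ => (polyGrowth_coord i).pow k

lemma polyGrowth_det_vandermonde : PolyGrowth fun x : Fin n → ℝ => (vandermonde x).det := by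
  simp only [det_vandermonde_eq_prod_ltPairs]
  exact PolyGrowth.prod fun p _ => (polyGrowth_coord _).sub (polyGrowth_coord _)

lemma PolyGrowth.abs {E : Type*} [NormedAddCommGroup E] {f : E → ℝ} (hf : PolyGrowth f) : PolyGrowth fun x => |f x| := by
  obtain ⟨C, M, hC, hb⟩ := hf.bound
  exact ⟨hf.cont.abs, C, M, hC, fun x => by simpa using hb x⟩

lemma half_sq_norm_le (x : Fin n → ℝ) : 1 / 2 * ‖x‖ ^ 2 ≤ (∑ i, x i ^ 2) / 2 := by
  have h : ‖x‖ ≤ √(∑ i, x i ^ 2) := by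
    rw [pi_norm_le_iff_of_nonneg (Real.sqrt_nonneg _)]
    intro i
    refine Real.abs_le_sqrt (Finset.single_le_sum (f := fun i => x i ^ 2) (fun j _ => sq_nonneg _) (Finset.mem_univ i))
  have := pow_le_pow_left₀ (norm_nonneg _) h 2
  rw [Real.sq_sqrt (by positivity)] at this
  linarith

lemma integrable_powSum (b : ℕ) (Q : MvPolynomial ℕ ℝ) : Integrable (fun x : Fin n → ℝ =>
    MvPolynomial.eval (fun j => powSum j x) Q * (|(vandermonde x).det| ^ b * Real.exp (-((∑ i, x i ^ 2) / 2)))) volume := by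
  have hp : PolyGrowth fun x : Fin n → ℝ => MvPolynomial.eval (fun j => powSum j x) Q * |(vandermonde x).det| ^ b :=
    (PolyGrowth.eval_mvPolynomial polyGrowth_powSum Q).mul (polyGrowth_det_vandermonde.abs.pow b)
  have hφ : Continuous fun x : Fin n → ℝ => (∑ i, x i ^ 2) / 2 := by fun_prop
  have := hp.integrable_mul_exp_neg hφ (a := 1 / 2) (by norm_num) half_sq_norm_le volume
  refine this.congr (ae_of_all _ fun x => ?_)
  exact mul_assoc _ _ _

lemma hasLineDerivAt_coord (x : Fin n → ℝ) (i j : Fin n) :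
    HasLineDerivAt ℝ (fun x : Fin n → ℝ => x j) (if j = i then 1 else 0) x (Pi.single i 1) := by
  have := ((hasDerivAt_id (0 : ℝ)).mul_const ((Pi.single i (1 : ℝ) : Fin n → ℝ) j)).const_add (x j)
  simpa [HasLineDerivAt, Pi.single_apply] using this

lemma hasLineDerivAt_powSum (k : ℕ) (x : Fin n → ℝ) (i : Fin n) :
    HasLineDerivAt ℝ (powSum k) (k * x i ^ (k - 1)) x (Pi.single i 1) := by
  have hc : ∀ j, HasDerivAt (fun t : ℝ => (x + t • (Pi.single i 1 : Fin n → ℝ)) j) (if j = i then 1 else 0) 0 :=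
    fun j => hasLineDerivAt_coord x i j
  have h := HasDerivAt.fun_sum (u := Finset.univ) fun j _ => HasDerivAt.fun_pow (hc j) k
  unfold HasLineDerivAt powSum
  refine h.congr_deriv ?_
  simp

/-- The partial derivatives of the Vandermonde determinant. -/
def vdmPartial (i : Fin n) (x : Fin n → ℝ) : ℝ :=
  ∑ p ∈ ltPairs n, (∏ q ∈ (ltPairs n).erase p, (x q.2 - x q.1)) *
    ((if p.2 = i then 1 else 0) - (if p.1 = i then 1 else 0))

lemma polyGrowth_vdmPartial (i : Fin n) : PolyGrowth (vdmPartial i) :=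
  PolyGrowth.sum fun _ _ => (PolyGrowth.prod fun _ _ => (polyGrowth_coord _).sub (polyGrowth_coord _)).mul
    (PolyGrowth.const _)

lemma hasLineDerivAt_det_vandermonde (x : Fin n → ℝ) (i : Fin n) :
    HasLineDerivAt ℝ (fun x : Fin n → ℝ => (vandermonde x).det) (vdmPartial i x) x (Pi.single i 1) := by
  simp only [det_vandermonde_eq_prod_ltPairs]
  have := HasDerivAt.fun_finsetProd (u := ltPairs n) fun p _ =>
    HasDerivAt.fun_sub (hasLineDerivAt_coord x i p.2) (hasLineDerivAt_coord x i p.1)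
  refine HasDerivAt.congr_deriv this ?_
  simp [vdmPartial]

/-- Half the off-diagonal part of the divergence. -/
def vdmDiv (k : ℕ) (x : Fin n → ℝ) : ℝ :=
  ∑ p ∈ ltPairs n, ∑ l ∈ Finset.range k, x p.2 ^ l * x p.1 ^ (k - 1 - l)

lemma sum_pow_mul_vdmPartial (k : ℕ) (x : Fin n → ℝ) :
    ∑ i, x i ^ k * vdmPartial i x = (vandermonde x).det * vdmDiv k x := by
  simp only [vdmPartial, vdmDiv, Finset.mul_sum (s := ltPairs n)]
  rw [Finset.sum_comm]
  refine Finset.sum_congr rfl fun p hp => ?_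
  have h1 : ∀ i, x i ^ k * ((∏ q ∈ (ltPairs n).erase p, (x q.2 - x q.1)) *
      ((if p.2 = i then 1 else 0) - (if p.1 = i then 1 else 0))) =
      (∏ q ∈ (ltPairs n).erase p, (x q.2 - x q.1)) *
        ((if p.2 = i then x i ^ k else 0) - (if p.1 = i then x i ^ k else 0)) := by
    intro i
    split_ifs <;> ring
  simp only [h1]
  rw [← Finset.mul_sum, Finset.sum_sub_distrib, Finset.sum_ite_eq, Finset.sum_ite_eq, if_pos (Finset.mem_univ _),
    if_pos (Finset.mem_univ _), ← geom_sum₂_mul, det_vandermonde_eq_prod_ltPairs,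
    ← Finset.mul_prod_erase _ _ hp]
  ring

lemma vdmDiv_eq (k : ℕ) (x : Fin n → ℝ) :
    vdmDiv k x = ∑ l ∈ Finset.range k, 1 / 2 * (powSum l x * powSum (k - 1 - l) x - powSum (k - 1) x) := by
  set h : Fin n × Fin n → ℝ := fun p => ∑ l ∈ Finset.range k, x p.2 ^ l * x p.1 ^ (k - 1 - l) with hh
  have hsymm : ∀ p, h p.swap = h p := by
    intro p
    simp only [hh]
    rw [← Finset.sum_range_reflect]
    refine Finset.sum_congr rfl fun l hl => ?_
    have := Finset.mem_range.1 hl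
    rw [show k - 1 - (k - 1 - l) = l by omega]
    simp [mul_comm]
  have h1 : ∑ p, h p = ∑ l ∈ Finset.range k, powSum l x * powSum (k - 1 - l) x := by
    simp only [hh]
    rw [Finset.sum_comm]
    refine Finset.sum_congr rfl fun l _ => ?_
    rw [← Finset.univ_product_univ, Finset.sum_product_right, powSum, powSum, Finset.sum_mul_sum]
  have h2 : ∑ p, h p = ∑ p ∈ ltPairs n, h p + (∑ p ∈ ltPairs n, h p + ∑ i, h (i, i)) := by
    rw [← Finset.sum_filter_add_sum_filter_not Finset.univ (fun p : Fin n × Fin n => p.1 < p.2)]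
    congr 1
    rw [← Finset.sum_filter_add_sum_filter_not _ (fun p : Fin n × Fin n => p.2 < p.1)]
    congr 1
    · refine Finset.sum_bij' (fun p _ => p.swap) (fun p _ => p.swap) ?_ ?_ ?_ ?_ ?_
      · intro p hp; simp [ltPairs] at hp ⊢; exact hp.2
      · intro p hp; simp [ltPairs] at hp ⊢; exact ⟨hp.le, hp⟩
      · intro p _; simp
      · intro p _; simp
      · intro p _; exact (hsymm p).symm
    · refine Finset.sum_bij' (fun p _ => p.1) (fun i _ => (i, i)) ?_ ?_ ?_ ?_ ?_
      · intro p _; simp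
      · intro i _; simp
      · intro p hp
        simp at hp
        exact Prod.ext rfl (le_antisymm hp.2 hp.1)
      · intro i _; rfl
      · intro p hp
        simp at hp
        congr 1
        exact Prod.ext rfl (le_antisymm hp.1 hp.2)
  have h3 : ∑ i, h (i, i) = ∑ l ∈ Finset.range k, powSum (k - 1) x := by
    simp only [hh, powSum]
    rw [Finset.sum_comm]
    refine Finset.sum_congr rfl fun l hl => Finset.sum_congr rfl fun i _ => ?_
    have := Finset.mem_range.1 hl
    rw [← pow_add, show l + (k - 1 - l) = k - 1 by omega]
  have h4 : vdmDiv k x = ∑ p ∈ ltPairs n, h p := rfl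
  rw [← Finset.mul_sum, Finset.sum_sub_distrib, ← h1, ← h3, h2, h4]
  ring

end EigenvalueLoop

section EigenvalueLoopEquation

variable {n : ℕ}

lemma eval_powSum_powDeriv (x : Fin n → ℝ) (k : ℕ) (Q : MvPolynomial ℕ ℝ) :
    ∑ i, x i ^ k * MvPolynomial.eval (fun j => powSum j x)
      (MvPolynomial.mkDerivation ℝ (fun j : ℕ => MvPolynomial.C ((j : ℝ) * x i ^ (j - 1))) Q) =
    MvPolynomial.eval (fun j => powSum j x) (powDeriv k Q) := by
  rw [powDeriv, sum_mul_eval_mkDerivation]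
  intro j
  simp only [MvPolynomial.smul_eval, MvPolynomial.eval_X, powSum, Finset.mul_sum]
  refine Finset.sum_congr rfl fun i _ => ?_
  rcases Nat.eq_zero_or_pos j with rfl | hj
  · simp
  · rw [Nat.add_sub_assoc hj, pow_add]; ring

lemma eval_powSum_loopTerm (x : Fin n → ℝ) (b : ℝ) (k : ℕ) :
    MvPolynomial.eval (fun j => powSum j x) (loopTerm b k) = k * powSum (k - 1) x + b * vdmDiv k x := by
  have : (k : ℝ) * powSum (k - 1) x = ∑ l ∈ Finset.range k, powSum (k - 1) x := by simp
  rw [this, vdmDiv_eq, loopTerm, map_sum, Finset.mul_sum, ← Finset.sum_add_distrib]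
  refine Finset.sum_congr rfl fun l _ => ?_
  simp only [map_add, map_mul, MvPolynomial.smul_eval, MvPolynomial.eval_X]
  ring

/-- A smooth version of the absolute value of the Vandermonde determinant. -/
def smoothVdm (ε : ℝ) (x : Fin n → ℝ) : ℝ := √((vandermonde x).det ^ 2 + ε)

lemma abs_det_le_smoothVdm {ε : ℝ} (hε : 0 ≤ ε) (x : Fin n → ℝ) : |(vandermonde x).det| ≤ smoothVdm ε x :=
  Real.abs_le_sqrt (by linarith)

lemma smoothVdm_pos {ε : ℝ} (hε : 0 < ε) (x : Fin n → ℝ) : 0 < smoothVdm ε x :=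
  Real.sqrt_pos.2 (by positivity)

lemma smoothVdm_le {ε : ℝ} (hε : ε ≤ 1) (x : Fin n → ℝ) : smoothVdm ε x ≤ |(vandermonde x).det| + 1 := by
  refine Real.sqrt_le_iff.2 ⟨by positivity, ?_⟩
  nlinarith [sq_abs (vandermonde x).det, abs_nonneg (vandermonde x).det]

lemma continuous_smoothVdm (ε : ℝ) : Continuous (smoothVdm (n := n) ε) :=
  ((polyGrowth_det_vandermonde.cont.pow 2).add continuous_const).sqrt

lemma polyGrowth_smoothVdm {ε : ℝ} (hε : 0 < ε) (hε1 : ε ≤ 1) : PolyGrowth (smoothVdm (n := n) ε) :=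
  PolyGrowth.of_le (polyGrowth_det_vandermonde.abs.add (PolyGrowth.const 1)) (continuous_smoothVdm ε) fun x => by
    rw [Real.norm_of_nonneg (smoothVdm_pos hε x).le]; exact smoothVdm_le hε1 x

lemma hasLineDerivAt_smoothVdm_pow {ε : ℝ} (hε : 0 < ε) (b : ℕ) (x : Fin n → ℝ) (i : Fin n) :
    HasLineDerivAt ℝ (fun x => smoothVdm ε x ^ b)
      (b * smoothVdm ε x ^ (b - 1) * ((vandermonde x).det / smoothVdm ε x * vdmPartial i x)) x (Pi.single i 1) := by
  have h0 : HasDerivAt (fun t : ℝ => (vandermonde (x + t • (Pi.single i 1 : Fin n → ℝ))).det) (vdmPartial i x) 0 :=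
    hasLineDerivAt_det_vandermonde x i
  have h1 := (((h0.fun_pow 2).add_const ε).sqrt (by simp; positivity)).fun_pow b
  refine HasDerivAt.congr_deriv h1 ?_
  simp only [smoothVdm, zero_smul, add_zero]
  have : √((vandermonde x).det ^ 2 + ε) ≠ 0 := (smoothVdm_pos hε x).ne'
  field_simp
  push_cast
  ring

lemma polyGrowth_det_div_smoothVdm {ε : ℝ} (hε : 0 < ε) :
    PolyGrowth fun x : Fin n → ℝ => (vandermonde x).det / smoothVdm ε x :=
  PolyGrowth.of_le (PolyGrowth.const 1)
    (polyGrowth_det_vandermonde.cont.div (continuous_smoothVdm ε) fun x => (smoothVdm_pos hε x).ne') fun x => by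
    rw [norm_div, Real.norm_of_nonneg (smoothVdm_pos hε x).le, div_le_one (smoothVdm_pos hε x)]
    exact abs_det_le_smoothVdm hε.le x

lemma integral_smoothVdm_loop {ε : ℝ} (hε : 0 < ε) (hε1 : ε ≤ 1) {b : ℕ} (hb : 0 < b) (k : ℕ) (Q : MvPolynomial ℕ ℝ) :
    ∫ x : Fin n → ℝ, ((k * powSum (k - 1) x - powSum (k + 1) x) * MvPolynomial.eval (fun j => powSum j x) Q
        + MvPolynomial.eval (fun j => powSum j x) (powDeriv k Q)
        + b * vdmDiv k x * MvPolynomial.eval (fun j => powSum j x) Q * ((vandermonde x).det / smoothVdm ε x) ^ 2)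
      * smoothVdm ε x ^ b * Real.exp (-((∑ i, x i ^ 2) / 2)) = 0 := by
  have hQ := PolyGrowth.eval_mvPolynomial (polyGrowth_powSum (n := n)) Q
  have hD : ∀ i : Fin n, PolyGrowth fun x : Fin n → ℝ => MvPolynomial.eval (fun j => powSum j x)
      (MvPolynomial.mkDerivation ℝ (fun j : ℕ => MvPolynomial.C ((j : ℝ) * x i ^ (j - 1))) Q) :=
    fun i => PolyGrowth.eval_mkDerivation polyGrowth_powSum
      (fun j => (PolyGrowth.const _).mul ((polyGrowth_coord i).pow _)) Q
  have hs := fun b => (polyGrowth_smoothVdm (n := n) hε hε1).pow b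
  have hs' : ∀ i : Fin n, PolyGrowth fun x : Fin n → ℝ =>
      (b : ℝ) * smoothVdm ε x ^ (b - 1) * ((vandermonde x).det / smoothVdm ε x * vdmPartial i x) :=
    fun i => ((PolyGrowth.const _).mul (hs _)).mul ((polyGrowth_det_div_smoothVdm hε).mul (polyGrowth_vdmPartial i))
  have hk' : ∀ i : Fin n, PolyGrowth fun x : Fin n → ℝ => (k : ℝ) * x i ^ (k - 1) :=
    fun i => (PolyGrowth.const _).mul ((polyGrowth_coord i).pow _)
  have hkd : ∀ (i : Fin n) (x : Fin n → ℝ), HasLineDerivAt ℝ (fun x : Fin n → ℝ => x i ^ k) ((k : ℝ) * x i ^ (k - 1)) x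
      (Pi.single i 1) := by
    intro i x
    have hc : HasDerivAt (fun t : ℝ => (x + t • (Pi.single i 1 : Fin n → ℝ)) i) (if i = i then 1 else 0) 0 :=
      hasLineDerivAt_coord x i i
    refine HasDerivAt.congr_deriv (hc.fun_pow k) ?_
    simp
  have hφd : ∀ (i : Fin n) (x : Fin n → ℝ), HasLineDerivAt ℝ (fun x : Fin n → ℝ => (∑ i, x i ^ 2) / 2) (x i) x
      (Pi.single i 1) := by
    intro i x
    have h : HasDerivAt (fun t : ℝ => powSum 2 (x + t • (Pi.single i 1 : Fin n → ℝ))) (((2 : ℕ) : ℝ) * x i ^ (2 - 1)) 0 :=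
      hasLineDerivAt_powSum 2 x i
    refine HasDerivAt.congr_deriv (h.div_const 2) ?_
    simp
  have hφ : Continuous fun x : Fin n → ℝ => (∑ i, x i ^ 2) / 2 := by fun_prop
  have main := integral_divergence_eq_zero (v := fun i : Fin n => (Pi.single i 1 : Fin n → ℝ))
    (fun i => ((((polyGrowth_coord i).pow k).mul hQ).mul (hs b)))
    (fun i => (((hk' i).mul hQ).add (((polyGrowth_coord i).pow k).mul (hD i))).mul (hs b) |>.add
      ((((polyGrowth_coord i).pow k).mul hQ).mul (hs' i)))
    (fun i => polyGrowth_coord i) hφ (by norm_num) half_sq_norm_le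
    (fun i x => ((hkd i x).mul_fun (hasLineDerivAt_eval_mvPolynomial (fun j => hasLineDerivAt_powSum j x i) Q)).mul_fun
      (hasLineDerivAt_smoothVdm_pow hε b x i)) hφd volume
  rw [← main]
  refine integral_congr_ae (ae_of_all _ fun x => ?_)
  beta_reduce
  congr 1
  set q := MvPolynomial.eval (fun j => powSum j x) Q
  set s := smoothVdm ε x
  have hs0 : s ≠ 0 := (smoothVdm_pos hε x).ne'
  have e1 : powSum (k - 1) x = ∑ i, x i ^ (k - 1) := rfl
  have e2 : powSum (k + 1) x = ∑ i, x i ^ k * x i := by simp only [powSum, pow_succ]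
  have e4 : (b : ℝ) * vdmDiv k x * q * ((vandermonde x).det / s) ^ 2 * s ^ b =
      b * s ^ (b - 1) * ((vandermonde x).det / s) * q * ((vandermonde x).det * vdmDiv k x) := by
    obtain ⟨c, rfl⟩ := Nat.exists_eq_succ_of_ne_zero hb.ne'
    simp only [Nat.succ_eq_add_one, Nat.add_sub_cancel, pow_succ]
    field_simp
  rw [add_mul, e4, ← sum_pow_mul_vdmPartial, ← eval_powSum_powDeriv, e1, e2]
  simp only [Finset.mul_sum, Finset.sum_mul, ← Finset.sum_sub_distrib, ← Finset.sum_add_distrib]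
  exact Finset.sum_congr rfl fun i _ => by ring

lemma eigenvalue_loop_equation {b : ℕ} (hb : 0 < b) (k : ℕ) (Q : MvPolynomial ℕ ℝ) :
    momentFunctional volume (powSum (n := n))
      (fun x => |(vandermonde x).det| ^ b * Real.exp (-((∑ i, x i ^ 2) / 2))) (integrable_powSum b)
      (MvPolynomial.X (k + 1) * Q) =
    momentFunctional volume (powSum (n := n))
      (fun x => |(vandermonde x).det| ^ b * Real.exp (-((∑ i, x i ^ 2) / 2))) (integrable_powSum b)
      (loopTerm b k * Q + powDeriv k Q) := by
  set A : (Fin n → ℝ) → ℝ := fun x => (k * powSum (k - 1) x - powSum (k + 1) x) * MvPolynomial.eval (fun j => powSum j x) Q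
        + MvPolynomial.eval (fun j => powSum j x) (powDeriv k Q) with hA
  set B : (Fin n → ℝ) → ℝ := fun x => b * vdmDiv k x * MvPolynomial.eval (fun j => powSum j x) Q with hB
  have hQ := PolyGrowth.eval_mvPolynomial (polyGrowth_powSum (n := n)) Q
  have hAg : PolyGrowth A := (((PolyGrowth.const _).mul (polyGrowth_powSum _)).sub (polyGrowth_powSum _)).mul hQ |>.add
    (PolyGrowth.eval_mvPolynomial (polyGrowth_powSum (n := n)) _)
  have hBg : PolyGrowth B := ((PolyGrowth.const _).mul (PolyGrowth.sum fun p _ => PolyGrowth.sum fun l _ =>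
    ((polyGrowth_coord _).pow _).mul ((polyGrowth_coord _).pow _))).mul hQ
  have hφ : Continuous fun x : Fin n → ℝ => (∑ i, x i ^ 2) / 2 := by fun_prop
  have hbound := ((hAg.abs.add hBg.abs).mul ((polyGrowth_det_vandermonde.abs.add (PolyGrowth.const 1)).pow b)).integrable_mul_exp_neg
    hφ (a := 1 / 2) (by norm_num) half_sq_norm_le volume
  have hε : ∀ m : ℕ, (0 : ℝ) < 1 / ((m : ℝ) + 1) := fun m => by positivity
  have hε1 : ∀ m : ℕ, 1 / ((m : ℝ) + 1) ≤ 1 := fun m => by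
    rw [div_le_one (by positivity)]; linarith [(Nat.cast_nonneg m : (0 : ℝ) ≤ m)]
  have hlim := tendsto_integral_of_dominated_convergence (μ := volume) (F := fun (m : ℕ) (x : Fin n → ℝ) =>
    (A x + B x * ((vandermonde x).det / smoothVdm (1 / ((m : ℝ) + 1)) x) ^ 2) * smoothVdm (1 / ((m : ℝ) + 1)) x ^ b *
      Real.exp (-((∑ i, x i ^ 2) / 2))) (f := fun x => (A x + B x) * |(vandermonde x).det| ^ b *
      Real.exp (-((∑ i, x i ^ 2) / 2))) _ ?_ hbound ?_ ?_
  · have h0 := tendsto_nhds_unique hlim (by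
      simp only [hA, hB, integral_smoothVdm_loop (hε _) (hε1 _) hb k Q]; exact tendsto_const_nhds)
    rw [← sub_eq_zero, ← neg_eq_zero, neg_sub, ← map_sub]
    rw [← h0]
    refine integral_congr_ae (ae_of_all _ fun x => ?_)
    beta_reduce
    rw [map_sub, map_add, map_mul, map_mul, MvPolynomial.eval_X, eval_powSum_loopTerm]
    simp only [hA, hB]
    ring
  · intro m
    have h1 := hAg.cont
    have h2 := hBg.cont
    have h3 := (polyGrowth_det_div_smoothVdm (n := n) (hε m)).cont
    have h4 := continuous_smoothVdm (n := n) (1 / ((m : ℝ) + 1))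
    exact Continuous.aestronglyMeasurable (by fun_prop)
  · intro m
    refine ae_of_all _ fun x => ?_
    have hs := smoothVdm_pos (hε m) x
    have hr : ((vandermonde x).det / smoothVdm (1 / ((m : ℝ) + 1)) x) ^ 2 ≤ 1 := by
      rw [sq_le_one_iff_abs_le_one, abs_div, abs_of_pos hs, div_le_one hs]
      exact abs_det_le_smoothVdm (hε m).le x
    rw [norm_mul, norm_mul, Real.norm_of_nonneg (Real.exp_pos _).le, Real.norm_of_nonneg (pow_pos hs _).le]
    refine mul_le_mul_of_nonneg_right (mul_le_mul ?_ (pow_le_pow_left₀ hs.le (smoothVdm_le (hε1 m) x) b)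
      (pow_pos hs _).le (by positivity)) (Real.exp_pos _).le
    refine (norm_add_le _ _).trans (add_le_add le_rfl ?_)
    rw [norm_mul, Real.norm_of_nonneg (sq_nonneg _)]
    exact mul_le_of_le_one_right (norm_nonneg _) hr
  · refine ae_of_all _ fun x => ?_
    have h1 : Tendsto (fun m : ℕ => smoothVdm (1 / ((m : ℝ) + 1)) x) atTop (nhds |(vandermonde x).det|) := by
      have : Tendsto (fun m : ℕ => √((vandermonde x).det ^ 2 + 1 / ((m : ℝ) + 1))) atTop
          (nhds √((vandermonde x).det ^ 2 + 0)) :=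
        (tendsto_const_nhds.add tendsto_one_div_add_atTop_nhds_zero_nat).sqrt
      rwa [add_zero, Real.sqrt_sq_eq_abs] at this
    refine Tendsto.mul ?_ tendsto_const_nhds
    simp only [add_mul]
    refine (tendsto_const_nhds.mul (h1.pow b)).add ?_
    by_cases hV : (vandermonde x).det = 0
    · simp [hV, hb.ne']
    · have : B x * |(vandermonde x).det| ^ b = B x * ((vandermonde x).det / |(vandermonde x).det|) ^ 2 *
          |(vandermonde x).det| ^ b := by
        rw [div_pow, sq_abs, div_self (pow_ne_zero 2 hV), mul_one]
      rw [this]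
      exact ((((tendsto_const_nhds.div h1 (abs_ne_zero.2 hV)).pow 2).const_mul _)).mul (h1.pow b)

end EigenvalueLoopEquation

lemma momentFunctional_apply {E : Type*} [MeasurableSpace E] {μ : Measure E} {f : ℕ → E → ℝ} {w : E → ℝ}
    (h : ∀ Q : MvPolynomial ℕ ℝ, Integrable (fun x => MvPolynomial.eval (fun j => f j x) Q * w x) μ)
    (Q : MvPolynomial ℕ ℝ) :
    momentFunctional μ f w h Q = ∫ x, MvPolynomial.eval (fun j => f j x) Q * w x ∂μ := rfl

lemma momentFunctional_X_mul {E : Type*} [MeasurableSpace E] {μ : Measure E} {f : ℕ → E → ℝ} {w : E → ℝ}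
    (h : ∀ Q : MvPolynomial ℕ ℝ, Integrable (fun x => MvPolynomial.eval (fun j => f j x) Q * w x) μ)
    {k : ℕ} {c : ℝ} (hk : ∀ x, f k x = c) (Q : MvPolynomial ℕ ℝ) :
    momentFunctional μ f w h (MvPolynomial.X k * Q) = c * momentFunctional μ f w h Q := by
  rw [momentFunctional_apply, momentFunctional_apply, ← integral_const_mul]
  refine integral_congr_ae (ae_of_all _ fun x => ?_)
  simp only [map_mul, MvPolynomial.eval_X, hk]
  ring

section MomentComparison

variable {𝕜 : Type} [RCLike 𝕜] {N n : ℕ} {T : EuclideanSpace ℝ (Fin N) ≃ₗ[ℝ] HMat 𝕜 n}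

lemma trPow_zero (x : EuclideanSpace ℝ (Fin N)) : trPow T 0 x = n := by
  simp [trPow]

lemma powSum_zero (x : Fin n → ℝ) : powSum 0 x = n := by
  simp [powSum]

/-- The moments of the power sums agree, up to normalization, for Gaussian matrices and for the
Gaussian ensemble of eigenvalues. -/
lemma moment_proportional {β : ℕ} (hβ : Module.finrank ℝ 𝕜 = β)
    (hT : ∀ x y, ⟪x, y⟫ = RCLike.re (Matrix.trace ((T x).val * ((T y).val)ᴴ))) (Q : MvPolynomial ℕ ℝ) :
    momentFunctional volume (powSum (n := n)) (fun x => |(vandermonde x).det| ^ β * Real.exp (-((∑ i, x i ^ 2) / 2)))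
        (integrable_powSum β) 1 *
      momentFunctional volume (trPow T) (fun x => Real.exp (-(‖x‖ ^ 2 / 2))) integrable_trPow Q =
    momentFunctional volume (trPow T) (fun x => Real.exp (-(‖x‖ ^ 2 / 2))) integrable_trPow 1 *
      momentFunctional volume (powSum (n := n)) (fun x => |(vandermonde x).det| ^ β * Real.exp (-((∑ i, x i ^ 2) / 2)))
        (integrable_powSum β) Q := by
  have hβ0 : 0 < β := hβ ▸ Module.finrank_pos
  set G := momentFunctional volume (trPow T) (fun x => Real.exp (-(‖x‖ ^ 2 / 2))) integrable_trPow with hG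
  set V := momentFunctional volume (powSum (n := n)) (fun x => |(vandermonde x).det| ^ β * Real.exp (-((∑ i, x i ^ 2) / 2)))
        (integrable_powSum β) with hV
  have h0G : ∀ Q, G (MvPolynomial.X 0 * Q) = n * G Q := by
    intro Q
    exact momentFunctional_X_mul _ trPow_zero Q
  have h0V : ∀ Q, V (MvPolynomial.X 0 * Q) = n * V Q := by
    intro Q
    exact momentFunctional_X_mul _ powSum_zero Q
  have h := eq_zero_of_loop_equations (b := β) (c := n) (V 1 • G - G 1 • V)
    (by simp only [LinearMap.sub_apply, LinearMap.smul_apply, smul_eq_mul]; ring)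
    (fun Q => by simp only [LinearMap.sub_apply, LinearMap.smul_apply, smul_eq_mul, h0G, h0V]; ring)
    (fun k Q => by
      simp only [LinearMap.sub_apply, LinearMap.smul_apply, smul_eq_mul]
      rw [hG, gaussian_loop_equation hβ hT, hV, eigenvalue_loop_equation hβ0])
  have := LinearMap.congr_fun h Q
  simp only [LinearMap.sub_apply, LinearMap.smul_apply, smul_eq_mul, LinearMap.zero_apply] at this
  linarith

end MomentComparison

section Eigenvalues

variable {𝕜 : Type} [RCLike 𝕜] {N n : ℕ}

lemma re_trace_pow_eq_powSum (A : HMat 𝕜 n) (k : ℕ) : RCLike.re (A.val ^ k).trace = powSum k (eigs A) := by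
  have hA : A.val.IsHermitian := A.prop
  have h := hA.spectral_theorem
  have h2 : A.val ^ k = Unitary.conjStarAlgAut 𝕜 _ hA.eigenvectorUnitary
      (diagonal ((RCLike.ofReal ∘ hA.eigenvalues) ^ k)) := by
    conv_lhs => rw [h]
    rw [← map_pow, diagonal_pow]
  rw [h2, Unitary.conjStarAlgAut_apply, Matrix.trace_mul_comm, ← mul_assoc, Unitary.coe_star_mul_self, one_mul,
    trace_diagonal, map_sum, powSum]
  refine Finset.sum_congr rfl fun i _ => ?_
  simp only [Pi.pow_apply, Function.comp_apply, ← RCLike.ofReal_pow, RCLike.ofReal_re]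
  rfl

variable {T : EuclideanSpace ℝ (Fin N) ≃ₗ[ℝ] HMat 𝕜 n}

lemma trPow_eq_powSum (k : ℕ) (x : EuclideanSpace ℝ (Fin N)) : trPow T k x = powSum k (eigs (T x)) :=
  re_trace_pow_eq_powSum _ _

lemma sum_sq_eigs (hT : ∀ x y, ⟪x, y⟫ = RCLike.re (Matrix.trace ((T x).val * ((T y).val)ᴴ)))
    (x : EuclideanSpace ℝ (Fin N)) : ∑ i, eigs (T x) i ^ 2 = ‖x‖ ^ 2 := by
  have h := trPow_eq_powSum (T := T) 2 x
  rw [powSum] at h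
  rw [← h, trPow, pow_two, trace_mul_eq_inner hT, real_inner_self_eq_norm_sq]

lemma norm_eigs_le (hT : ∀ x y, ⟪x, y⟫ = RCLike.re (Matrix.trace ((T x).val * ((T y).val)ᴴ)))
    (x : EuclideanSpace ℝ (Fin N)) : ‖eigs (T x)‖ ≤ ‖x‖ := by
  rw [pi_norm_le_iff_of_nonneg (norm_nonneg _)]
  intro i
  refine abs_le_of_sq_le_sq ?_ (norm_nonneg _)
  rw [← sum_sq_eigs hT x]
  exact Finset.single_le_sum (f := fun i => eigs (T x) i ^ 2) (fun j _ => sq_nonneg _) (Finset.mem_univ i)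

lemma measurable_sum_eigs (hT : ∀ x y, ⟪x, y⟫ = RCLike.re (Matrix.trace ((T x).val * ((T y).val)ᴴ)))
    {f : ℝ → ℝ} (hf : Continuous f) : Measurable fun x => ∑ i, f (eigs (T x) i) := by
  have hex : ∀ m : ℕ, ∃ P : Polynomial ℝ, ∀ t ∈ Set.Icc (-(m : ℝ)) m, |P.eval t - f t| < 1 / ((m : ℝ) + 1) := fun m =>
    exists_polynomial_near_of_continuousOn _ _ f hf.continuousOn _ Nat.one_div_pos_of_nat
  choose P hP using hex
  refine measurable_of_tendsto_metrizable (f := fun m x => ∑ i, (P m).eval (eigs (T x) i)) (fun m => ?_) ?_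
  · have : (fun x => ∑ i, (P m).eval (eigs (T x) i)) = fun x =>
        ∑ k ∈ Finset.range ((P m).natDegree + 1), (P m).coeff k * trPow T k x := by
      funext x
      simp only [Polynomial.eval_eq_sum_range, trPow_eq_powSum, powSum, Finset.mul_sum]
      exact Finset.sum_comm
    rw [this]
    exact Finset.measurable_fun_sum _ fun k _ => ((polyGrowth_trPow T k).cont.measurable).const_mul _
  · rw [tendsto_pi_nhds]
    intro x
    refine tendsto_finsetSum _ fun i _ => ?_
    rw [tendsto_iff_norm_sub_tendsto_zero]
    refine squeeze_zero' (Eventually.of_forall fun _ => norm_nonneg _) ?_ tendsto_one_div_add_atTop_nhds_zero_nat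
    obtain ⟨M, hM⟩ := exists_nat_ge ‖x‖
    filter_upwards [eventually_ge_atTop M] with m hm
    refine (hP m _ (abs_le.1 ?_)).le
    exact ((norm_le_pi_norm (eigs (T x)) i).trans (norm_eigs_le hT x)).trans (hM.trans (by exact_mod_cast hm))

lemma measurable_card_eigs_gt (hT : ∀ x y, ⟪x, y⟫ = RCLike.re (Matrix.trace ((T x).val * ((T y).val)ᴴ)))
    (c : ℝ) : Measurable fun x => ∑ i, (if c < eigs (T x) i then (1 : ℝ) else 0) := by
  refine measurable_of_tendsto_metrizable
    (f := fun m x => ∑ i, min 1 ((m : ℕ) * max 0 (eigs (T x) i - c)))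
    (fun m => measurable_sum_eigs hT (f := fun t => min 1 (m * max 0 (t - c))) (by fun_prop)) ?_
  rw [tendsto_pi_nhds]
  intro x
  refine tendsto_finsetSum _ fun i _ => ?_
  split_ifs with h
  · refine tendsto_const_nhds.congr' ?_
    have h0 : 0 < eigs (T x) i - c := sub_pos.2 h
    obtain ⟨M, hM⟩ := exists_nat_ge (1 / (eigs (T x) i - c))
    filter_upwards [eventually_ge_atTop M] with m hm
    rw [max_eq_right h0.le, min_eq_left]
    rw [div_le_iff₀ h0] at hM
    exact hM.trans (mul_le_mul_of_nonneg_right (by exact_mod_cast hm) h0.le)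
  · have h0 : eigs (T x) i - c ≤ 0 := by linarith
    simp [max_eq_left h0]

lemma measurable_eigs (hT : ∀ x y, ⟪x, y⟫ = RCLike.re (Matrix.trace ((T x).val * ((T y).val)ᴴ))) :
    Measurable fun x => eigs (T x) := by
  rw [measurable_pi_iff]
  intro i
  refine measurable_of_Ioi fun c => ?_
  set e : Fin (Fintype.card (Fin n)) ≃ Fin n := Fintype.equivOfCardEq (Fintype.card_fin _) with he
  have key : ((fun x => eigs (T x) i) ⁻¹' Set.Ioi c) =
      {x | (((e.symm i : ℕ) : ℝ) + 1) ≤ ∑ j, (if c < eigs (T x) j then (1 : ℝ) else 0)} := by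
    ext x
    have hA : (T x).val.IsHermitian := (T x).prop
    have hev : ∀ j, eigs (T x) j = hA.eigenvalues₀ (e.symm j) := fun j => rfl
    have hsum : ∑ j, (if c < eigs (T x) j then (1 : ℝ) else 0) =
        ((Finset.univ.filter fun j => c < hA.eigenvalues₀ j).card : ℝ) := by
      rw [← Equiv.sum_comp e, ← Finset.sum_boole]
      simp [hev]
    simp only [Set.mem_preimage, Set.mem_Ioi, Set.mem_ofPred_eq]
    rw [hsum, hev]
    norm_cast
    have anti := hA.eigenvalues₀_antitone
    constructor
    · intro h
      have : Finset.Iic (e.symm i) ⊆ Finset.univ.filter fun j => c < hA.eigenvalues₀ j := by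
        intro j hj
        simp only [Finset.mem_filter, Finset.mem_univ, true_and]
        exact h.trans_le (anti (Finset.mem_Iic.1 hj))
      have := Finset.card_le_card this
      rwa [Fin.card_Iic] at this
    · intro h
      by_contra hc
      have : (Finset.univ.filter fun j => c < hA.eigenvalues₀ j) ⊆ Finset.Iio (e.symm i) := by
        intro j hj
        simp only [Finset.mem_filter, Finset.mem_univ, true_and] at hj
        rw [Finset.mem_Iio]
        by_contra hji
        exact hc (hj.trans_le (anti (not_lt.1 hji)))
      have := Finset.card_le_card this
      rw [Fin.card_Iio] at this
      omega
  rw [key]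
  exact measurableSet_le measurable_const (measurable_card_eigs_gt hT c)

end Eigenvalues

section SymmetricMeasures

variable {n : ℕ}

/-- The average of the powers of a linear form over all maps of the coordinates is a polynomial in the
power sums. -/
lemma exists_eval_powSum_eq (L : StrongDual ℝ (Fin n → ℝ)) (m : ℕ) : ∃ Q : MvPolynomial ℕ ℝ,
    ∀ y : Fin n → ℝ, ∑ φ : Fin n → Fin n, L (y ∘ φ) ^ m = MvPolynomial.eval (fun j => powSum j y) Q := by
  refine ⟨∑ s : Fin m → Fin n, MvPolynomial.C (∏ t, L (Pi.single (s t) 1)) *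
    ∏ i : Fin n, MvPolynomial.X (Finset.univ.filter fun t => s t = i).card, fun y => ?_⟩
  have hL : ∀ z : Fin n → ℝ, L z = ∑ i, z i * L (Pi.single i 1) := fun z => by
    have := LinearMap.pi_apply_eq_sum_univ (L : (Fin n → ℝ) →ₗ[ℝ] ℝ) z
    have hs : ∀ i : Fin n, (fun j => if i = j then (1 : ℝ) else 0) = Pi.single i 1 := fun i => by
      ext j; simp [Pi.single_apply, eq_comm]
    simpa [hs] using this
  simp only [map_sum, map_mul, map_prod, MvPolynomial.eval_C, MvPolynomial.eval_X]
  simp only [hL (y ∘ _), Fintype.sum_pow]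
  rw [Finset.sum_comm]
  refine Finset.sum_congr rfl fun s _ => ?_
  simp only [Finset.prod_mul_distrib, powSum]
  rw [← Finset.sum_mul, mul_comm]
  congr 1
  rw [Finset.prod_univ_sum, Fintype.piFinset_univ]
  refine Finset.sum_congr rfl fun φ _ => ?_
  rw [← Finset.prod_fiberwise (s := Finset.univ) (g := s)]
  refine Finset.prod_congr rfl fun i _ => ?_
  rw [← Finset.prod_const]
  refine Finset.prod_congr rfl fun t ht => ?_
  simp only [Finset.mem_filter, Finset.mem_univ, true_and] at ht
  simp [ht]

/-- The sum of the images of a measure under all maps of the coordinates. -/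
def coordSum (m : Measure (Fin n → ℝ)) : Measure (Fin n → ℝ) :=
  ∑ φ : Fin n → Fin n, m.map fun y => y ∘ φ

lemma measurable_comp_coord (φ : Fin n → Fin n) : Measurable fun y : Fin n → ℝ => y ∘ φ := by
  rw [measurable_pi_iff]
  exact fun i => measurable_pi_apply (φ i)

lemma norm_comp_coord_le (y : Fin n → ℝ) (φ : Fin n → Fin n) : ‖y ∘ φ‖ ≤ ‖y‖ := by
  rw [pi_norm_le_iff_of_nonneg (norm_nonneg _)]
  exact fun i => norm_le_pi_norm y (φ i)

instance isFiniteMeasure_coordSum (m : Measure (Fin n → ℝ)) [IsFiniteMeasure m] : IsFiniteMeasure (coordSum m) := by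
  unfold coordSum
  infer_instance

lemma charFunDual_coordSum (m : Measure (Fin n → ℝ)) [IsFiniteMeasure m]
    (hm : ∀ c : ℝ, Integrable (fun y => Real.exp (c * ‖y‖)) m) (L : StrongDual ℝ (Fin n → ℝ)) :
    HasSum (fun k : ℕ => Complex.I ^ k / (k.factorial : ℂ) *
      ((∫ y, ∑ φ : Fin n → Fin n, L (y ∘ φ) ^ k ∂m : ℝ) : ℂ)) (charFunDual (coordSum m) L) := by
  have hmeas : ∀ φ : Fin n → Fin n, Measurable fun y : Fin n → ℝ => L (y ∘ φ) := fun φ =>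
    L.continuous.measurable.comp (measurable_comp_coord φ)
  have hInt : ∀ φ : Fin n → Fin n, Integrable (fun y : Fin n → ℝ => Complex.exp ((L (y ∘ φ) : ℂ) * Complex.I)) m := by
    intro φ
    refine Integrable.of_bound (C := 1) ((Complex.measurable_ofReal.comp (hmeas φ)).mul_const _).cexp.aestronglyMeasurable
      (ae_of_all _ fun y => ?_)
    rw [Complex.norm_exp_ofReal_mul_I]
  have hchar : charFunDual (coordSum m) L = ∫ y, ∑ φ : Fin n → Fin n, Complex.exp ((L (y ∘ φ) : ℂ) * Complex.I) ∂m := by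
    rw [charFunDual_apply, coordSum, integral_finsetSum_measure, integral_finsetSum]
    · refine Finset.sum_congr rfl fun φ _ => ?_
      rw [integral_map (measurable_comp_coord φ).aemeasurable]
      exact (by fun_prop : Continuous fun v : Fin n → ℝ => Complex.exp ((L v : ℂ) * Complex.I)).aestronglyMeasurable
    · exact fun φ _ => hInt φ
    · intro φ _
      refine Integrable.of_bound (C := 1)
        (by exact (by fun_prop : Continuous fun v : Fin n → ℝ => Complex.exp ((L v : ℂ) * Complex.I)).aestronglyMeasurable)
        (ae_of_all _ fun y => ?_)
      rw [Complex.norm_exp_ofReal_mul_I]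
  rw [hchar]
  have hconv := hasSum_integral_of_dominated_convergence (μ := m)
    (F := fun (k : ℕ) (y : Fin n → ℝ) => Complex.I ^ k / (k.factorial : ℂ) * ((∑ φ : Fin n → Fin n, L (y ∘ φ) ^ k : ℝ) : ℂ))
    (f := fun y => ∑ φ : Fin n → Fin n, Complex.exp ((L (y ∘ φ) : ℂ) * Complex.I))
    (fun k y => Fintype.card (Fin n → Fin n) * ((‖L‖ * ‖y‖) ^ k / k.factorial))
    (fun k => by
      have : Measurable fun y : Fin n → ℝ => ∑ φ : Fin n → Fin n, L (y ∘ φ) ^ k :=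
        Finset.measurable_fun_sum _ fun φ _ => (hmeas φ).pow_const k
      exact (((Complex.measurable_ofReal.comp this)).const_mul _).aestronglyMeasurable)
    (fun k => ae_of_all _ fun y => ?_) (ae_of_all _ fun y => ?_) ?_ (ae_of_all _ fun y => ?_)
  · refine hconv.congr_fun fun k => ?_
    rw [integral_const_mul, integral_complex_ofReal]
  · rw [norm_mul, norm_div, norm_pow, Complex.norm_I, one_pow, Complex.norm_natCast, Complex.norm_real]
    rw [one_div, mul_div_assoc', inv_mul_eq_div]
    refine div_le_div_of_nonneg_right ?_ (by positivity)
    refine (norm_sum_le _ _).trans ?_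
    refine (Finset.sum_le_card_nsmul _ _ ((‖L‖ * ‖y‖) ^ k) fun φ _ => ?_).trans (by simp)
    rw [norm_pow]
    exact pow_le_pow_left₀ (norm_nonneg _) ((L.le_opNorm _).trans
      (mul_le_mul_of_nonneg_left (norm_comp_coord_le y φ) (norm_nonneg _))) k
  · exact (Real.summable_pow_div_factorial _).mul_left _
  · have : (fun y : Fin n → ℝ => ∑' k : ℕ, (Fintype.card (Fin n → Fin n) : ℝ) * ((‖L‖ * ‖y‖) ^ k / k.factorial)) =
        fun y => (Fintype.card (Fin n → Fin n) : ℝ) * Real.exp (‖L‖ * ‖y‖) := by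
      funext y
      rw [tsum_mul_left, Real.exp_eq_exp_ℝ, NormedSpace.exp_eq_tsum_div]
    rw [this]
    exact (hm _).const_mul _
  · have h : ∀ φ : Fin n → Fin n, HasSum (fun k : ℕ => ((L (y ∘ φ) : ℂ) * Complex.I) ^ k / (k.factorial : ℂ))
        (Complex.exp ((L (y ∘ φ) : ℂ) * Complex.I)) := by
      intro φ
      rw [Complex.exp_eq_exp_ℂ]
      exact NormedSpace.expSeries_div_hasSum_exp _
    refine (hasSum_sum fun φ (_ : φ ∈ Finset.univ) => h φ).congr_fun fun k => ?_
    push_cast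
    rw [Finset.mul_sum]
    exact Finset.sum_congr rfl fun φ _ => by rw [mul_pow]; ring

lemma coordSum_eq_of_moments (m₁ m₂ : Measure (Fin n → ℝ)) [IsFiniteMeasure m₁] [IsFiniteMeasure m₂]
    (h₁ : ∀ c : ℝ, Integrable (fun y => Real.exp (c * ‖y‖)) m₁) (h₂ : ∀ c : ℝ, Integrable (fun y => Real.exp (c * ‖y‖)) m₂)
    (h : ∀ Q : MvPolynomial ℕ ℝ, ∫ y, MvPolynomial.eval (fun j => powSum j y) Q ∂m₁ =
      ∫ y, MvPolynomial.eval (fun j => powSum j y) Q ∂m₂) : coordSum m₁ = coordSum m₂ := by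
  refine Measure.ext_of_charFunDual (funext fun L => ?_)
  refine (charFunDual_coordSum m₁ h₁ L).unique ?_
  refine (charFunDual_coordSum m₂ h₂ L).congr_fun fun k => ?_
  obtain ⟨Q, hQ⟩ := exists_eval_powSum_eq L k
  simp only [hQ, h]

lemma lintegral_coordSum (m : Measure (Fin n → ℝ)) {g : (Fin n → ℝ) → ℝ≥0∞} (hg : Measurable g)
    (hsymm : ∀ (y : Fin n → ℝ) (σ : Equiv.Perm (Fin n)), g (y ∘ σ) = g y) :
    ∫⁻ y in {y | (vandermonde y).det ≠ 0}, g y ∂(coordSum m) =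
      (Finset.univ.filter fun φ : Fin n → Fin n => Function.Injective φ).card *
        ∫⁻ y in {y | (vandermonde y).det ≠ 0}, g y ∂m := by
  have hD : MeasurableSet {y : Fin n → ℝ | (vandermonde y).det ≠ 0} :=
    (measurable_det_vandermonde (measurableSet_singleton 0)).compl
  rw [← lintegral_indicator hD, ← lintegral_indicator hD, coordSum, lintegral_finsetSum_measure,
    ← nsmul_eq_mul, ← Finset.sum_const, Finset.sum_filter]
  refine Finset.sum_congr rfl fun φ _ => ?_
  rw [lintegral_map (hg.indicator hD) (measurable_comp_coord φ)]
  split_ifs with hφ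
  · refine lintegral_congr fun y => ?_
    have hy : (vandermonde (y ∘ φ)).det ≠ 0 ↔ (vandermonde y).det ≠ 0 := by
      rw [det_vandermonde_ne_zero_iff, det_vandermonde_ne_zero_iff]
      exact ⟨fun h => h.of_comp_right (Finite.surjective_of_injective hφ), fun h => h.comp hφ⟩
    have hg' := hsymm y (Equiv.ofBijective φ (Finite.injective_iff_bijective.1 hφ))
    change g (y ∘ φ) = g y at hg'
    by_cases h : (vandermonde y).det ≠ 0
    · rw [Set.indicator_of_mem (by exact hy.2 h), Set.indicator_of_mem (by exact h), hg']
    · rw [Set.indicator_of_notMem (by exact fun h' => h (hy.1 h')), Set.indicator_of_notMem (by exact h)]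
  · refine (lintegral_congr fun y => Set.indicator_of_notMem ?_ _).trans lintegral_zero
    simp only [Set.mem_ofPred_eq, det_vandermonde_ne_zero_iff]
    exact fun h => hφ h.of_comp

lemma setLIntegral_eq_of_moments (m₁ m₂ : Measure (Fin n → ℝ)) [IsFiniteMeasure m₁] [IsFiniteMeasure m₂]
    (h₁ : ∀ c : ℝ, Integrable (fun y => Real.exp (c * ‖y‖)) m₁) (h₂ : ∀ c : ℝ, Integrable (fun y => Real.exp (c * ‖y‖)) m₂)
    (h : ∀ Q : MvPolynomial ℕ ℝ, ∫ y, MvPolynomial.eval (fun j => powSum j y) Q ∂m₁ =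
      ∫ y, MvPolynomial.eval (fun j => powSum j y) Q ∂m₂) {g : (Fin n → ℝ) → ℝ≥0∞} (hg : Measurable g)
    (hsymm : ∀ (y : Fin n → ℝ) (σ : Equiv.Perm (Fin n)), g (y ∘ σ) = g y) :
    ∫⁻ y in {y | (vandermonde y).det ≠ 0}, g y ∂m₁ = ∫⁻ y in {y | (vandermonde y).det ≠ 0}, g y ∂m₂ := by
  have e := lintegral_coordSum m₁ hg hsymm
  rw [coordSum_eq_of_moments m₁ m₂ h₁ h₂ h, lintegral_coordSum m₂ hg hsymm] at e
  refine ((ENNReal.mul_right_inj ?_ (ENNReal.natCast_ne_top _)).1 e).symm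
  rw [Nat.cast_ne_zero, Finset.card_ne_zero]
  exact ⟨id, by simp [Function.injective_id]⟩

end SymmetricMeasures

section EigenvalueDistribution

lemma integral_withDensity_ofReal {E : Type*} [MeasurableSpace E] {μ : Measure E} {w : E → ℝ} (hw : Measurable w)
    (h0 : ∀ x, 0 ≤ w x) (f : E → ℝ) :
    ∫ x, f x ∂(μ.withDensity fun x => ENNReal.ofReal (w x)) = ∫ x, f x * w x ∂μ := by
  rw [integral_withDensity_eq_integral_toReal_smul hw.ennreal_ofReal (ae_of_all _ fun x => ENNReal.ofReal_lt_top)]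
  refine integral_congr_ae (ae_of_all _ fun x => ?_)
  simp only [ENNReal.toReal_ofReal (h0 x), smul_eq_mul, mul_comm]

lemma integrable_withDensity_ofReal {E : Type*} [MeasurableSpace E] {μ : Measure E} {w : E → ℝ} (hw : Measurable w)
    (h0 : ∀ x, 0 ≤ w x) {f : E → ℝ} (h : Integrable (fun x => f x * w x) μ) :
    Integrable f (μ.withDensity fun x => ENNReal.ofReal (w x)) := by
  rw [integrable_withDensity_iff_integrable_smul' hw.ennreal_ofReal (ae_of_all _ fun x => ENNReal.ofReal_lt_top)]
  refine h.congr (ae_of_all _ fun x => ?_)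
  simp only [ENNReal.toReal_ofReal (h0 x), smul_eq_mul, mul_comm]

variable {𝕜 : Type} [RCLike 𝕜] {N n β : ℕ} {T : EuclideanSpace ℝ (Fin N) ≃ₗ[ℝ] HMat 𝕜 n}

/-- The distribution of the eigenvalues under the Gaussian weight, scaled by `c`. -/
def eigMeasure (T : EuclideanSpace ℝ (Fin N) ≃ₗ[ℝ] HMat 𝕜 n) (c : ℝ) : Measure (Fin n → ℝ) :=
  ((volume : Measure (EuclideanSpace ℝ (Fin N))).withDensity
    fun x => ENNReal.ofReal (c * Real.exp (-(‖x‖ ^ 2 / 2)))).map fun x => eigs (T x)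

/-- The Gaussian ensemble of eigenvalues, scaled by `c`. -/
def vdmMeasure (n b : ℕ) (c : ℝ) : Measure (Fin n → ℝ) :=
  volume.withDensity fun y => ENNReal.ofReal (c * (|(vandermonde y).det| ^ b * Real.exp (-((∑ i, y i ^ 2) / 2))))

lemma isFiniteMeasure_of_integrable_exp {m : Measure (Fin n → ℝ)}
    (h : ∀ c : ℝ, Integrable (fun y => Real.exp (c * ‖y‖)) m) : IsFiniteMeasure m := by
  have := h 0
  simp only [zero_mul, Real.exp_zero] at this
  exact (integrable_const_iff_isFiniteMeasure one_ne_zero).1 this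

lemma measurable_gaussWeight (c : ℝ) :
    Measurable fun x : EuclideanSpace ℝ (Fin N) => c * Real.exp (-(‖x‖ ^ 2 / 2)) := by fun_prop

lemma measurable_vdmWeight (b : ℕ) (c : ℝ) :
    Measurable fun y : Fin n → ℝ => c * (|(vandermonde y).det| ^ b * Real.exp (-((∑ i, y i ^ 2) / 2))) := by
  have h : Measurable fun y : Fin n → ℝ => |(vandermonde y).det| := measurable_det_vandermonde.abs
  have h2 : Measurable fun y : Fin n → ℝ => Real.exp (-((∑ i, y i ^ 2) / 2)) := by fun_prop
  exact ((h.pow_const b).mul h2).const_mul c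

lemma integrable_exp_vdmMeasure (b : ℕ) {c : ℝ} (hc : 0 ≤ c) (a : ℝ) :
    Integrable (fun y => Real.exp (a * ‖y‖)) (vdmMeasure n b c) := by
  refine integrable_withDensity_ofReal (measurable_vdmWeight b c) (fun y => by positivity) ?_
  have hp : PolyGrowth fun x : Fin n → ℝ => |(vandermonde x).det| ^ b := polyGrowth_det_vandermonde.abs.pow b
  have hφ : Continuous fun x : Fin n → ℝ => (∑ i, x i ^ 2) / 2 := by fun_prop
  have := (hp.integrable_mul_exp hφ (a := 1 / 2) (by norm_num) half_sq_norm_le a volume).const_mul c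
  refine this.congr (ae_of_all _ fun x => ?_)
  beta_reduce
  ring

lemma integrable_exp_eigMeasure (hT : ∀ x y, ⟪x, y⟫ = RCLike.re (Matrix.trace ((T x).val * ((T y).val)ᴴ)))
    {c : ℝ} (hc : 0 ≤ c) (a : ℝ) : Integrable (fun y => Real.exp (a * ‖y‖)) (eigMeasure T c) := by
  have hm : Measurable fun y : Fin n → ℝ => Real.exp (a * ‖y‖) := by fun_prop
  refine (integrable_map_measure hm.aestronglyMeasurable (measurable_eigs hT).aemeasurable).2 ?_
  refine integrable_withDensity_ofReal (measurable_gaussWeight c) (fun y => by positivity) ?_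
  have hp : PolyGrowth fun _ : EuclideanSpace ℝ (Fin N) => c := PolyGrowth.const c
  have hφ : Continuous fun x : EuclideanSpace ℝ (Fin N) => ‖x‖ ^ 2 / 2 := by fun_prop
  have := hp.integrable_mul_exp hφ (a := 1 / 2) (by norm_num) (fun x => by linarith) |a| volume
  refine this.mono' ?_ (ae_of_all _ fun x => ?_)
  · exact ((hm.comp (measurable_eigs hT)).mul (measurable_gaussWeight c)).aestronglyMeasurable
  · rw [Real.norm_of_nonneg (by simp only [Function.comp_apply]; positivity), Function.comp_apply, mul_left_comm]
    refine mul_le_mul_of_nonneg_left (mul_le_mul_of_nonneg_right (Real.exp_le_exp.2 ?_) (Real.exp_pos _).le) hc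
    calc a * ‖eigs (T x)‖ ≤ |a| * ‖eigs (T x)‖ := mul_le_mul_of_nonneg_right (le_abs_self a) (norm_nonneg _)
      _ ≤ _ := mul_le_mul_of_nonneg_left (norm_eigs_le hT x) (abs_nonneg a)

/-- The normalizing constant of Gaussian matrices. -/
def gaussConst (N : ℕ) : ℝ := ∫ x : EuclideanSpace ℝ (Fin N), Real.exp (-(‖x‖ ^ 2 / 2))

/-- The normalizing constant of the Gaussian ensemble of eigenvalues. -/
def vdmConst (n b : ℕ) : ℝ := ∫ y : Fin n → ℝ, |(vandermonde y).det| ^ b * Real.exp (-((∑ i, y i ^ 2) / 2))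

lemma vdmConst_nonneg (n b : ℕ) : 0 ≤ vdmConst n b := integral_nonneg fun y => by positivity

lemma gaussConst_pos (N : ℕ) : 0 < gaussConst N := by
  refine integral_exp_pos ?_
  have h := (PolyGrowth.const (E := EuclideanSpace ℝ (Fin N)) (1 : ℝ)).integrable_mul_exp_neg
    (φ := fun x => ‖x‖ ^ 2 / 2) (by fun_prop) (a := 1 / 2) (by norm_num) (fun x => by linarith) volume
  simpa using h

lemma integral_eigMeasure (hβ : Module.finrank ℝ 𝕜 = β)
    (hT : ∀ x y, ⟪x, y⟫ = RCLike.re (Matrix.trace ((T x).val * ((T y).val)ᴴ))) (Q : MvPolynomial ℕ ℝ) :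
    ∫ y, MvPolynomial.eval (fun j => powSum j y) Q ∂(eigMeasure T (vdmConst n β)) =
      ∫ y, MvPolynomial.eval (fun j => powSum j y) Q ∂(vdmMeasure n β (gaussConst N)) := by
  have h := moment_proportional hβ hT Q
  simp only [momentFunctional_apply, map_one, one_mul] at h
  change vdmConst n β * _ = gaussConst N * _ at h
  have hQ : Measurable fun y : Fin n → ℝ => MvPolynomial.eval (fun j => powSum j y) Q :=
    (PolyGrowth.eval_mvPolynomial polyGrowth_powSum Q).cont.measurable
  rw [eigMeasure, integral_map (measurable_eigs hT).aemeasurable hQ.aestronglyMeasurable,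
    integral_withDensity_ofReal (measurable_gaussWeight _)
      (fun x => mul_nonneg (vdmConst_nonneg _ _) (Real.exp_pos _).le),
    vdmMeasure, integral_withDensity_ofReal (measurable_vdmWeight _ _)
      (fun x => mul_nonneg (gaussConst_pos _).le (by positivity))]
  simp only [mul_left_comm _ (vdmConst n β), mul_left_comm _ (gaussConst N), integral_const_mul]
  simpa only [trPow_eq_powSum] using h

lemma vdmMeasure_ae_det_ne_zero {b : ℕ} (hb : 0 < b) (c : ℝ) :
    ∀ᵐ y ∂(vdmMeasure n b c), y ∈ {y : Fin n → ℝ | (vandermonde y).det ≠ 0} := by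
  rw [vdmMeasure, ae_withDensity_iff (measurable_vdmWeight b c).ennreal_ofReal]
  refine ae_of_all _ fun y hy h => hy ?_
  rw [h, abs_zero, zero_pow hb.ne', zero_mul, mul_zero, ENNReal.ofReal_zero]

/-- The eigenvalue distribution agrees with the Gaussian ensemble on symmetric functions. -/
lemma lintegral_eigMeasure (hβ : Module.finrank ℝ 𝕜 = β)
    (hT : ∀ x y, ⟪x, y⟫ = RCLike.re (Matrix.trace ((T x).val * ((T y).val)ᴴ)))
    {g : (Fin n → ℝ) → ℝ≥0∞} (hg : Measurable g)
    (hsymm : ∀ (y : Fin n → ℝ) (σ : Equiv.Perm (Fin n)), g (y ∘ σ) = g y) :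
    ∫⁻ y, g y ∂(eigMeasure T (vdmConst n β)) = ∫⁻ y, g y ∂(vdmMeasure n β (gaussConst N)) := by
  have hβ0 : 0 < β := hβ ▸ Module.finrank_pos
  have h1 := integrable_exp_eigMeasure hT (vdmConst_nonneg n β)
  have h2 := integrable_exp_vdmMeasure (n := n) β (gaussConst_pos N).le
  have := isFiniteMeasure_of_integrable_exp h1
  have := isFiniteMeasure_of_integrable_exp h2
  have hmom := integral_eigMeasure hβ hT
  have hae2 := vdmMeasure_ae_det_ne_zero (n := n) hβ0 (gaussConst N)
  have hD : MeasurableSet {y : Fin n → ℝ | (vandermonde y).det ≠ 0} :=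
    (measurable_det_vandermonde (measurableSet_singleton 0)).compl
  have hae1 : ∀ᵐ y ∂(eigMeasure T (vdmConst n β)), y ∈ {y : Fin n → ℝ | (vandermonde y).det ≠ 0} := by
    have e := setLIntegral_eq_of_moments _ _ h1 h2 hmom (g := fun _ => 1) measurable_const (fun _ _ => rfl)
    rw [Measure.restrict_eq_self_of_ae_mem hae2, setLIntegral_one, lintegral_one] at e
    have ht := hmom 1
    simp only [map_one, integral_const, smul_eq_mul, mul_one] at ht
    have ht' := (measureReal_eq_measureReal_iff).1 ht
    rw [← ht'] at e
    change (eigMeasure T (vdmConst n β)) {y : Fin n → ℝ | (vandermonde y).det ≠ 0}ᶜ = 0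
    rw [measure_compl hD (measure_ne_top _ _), e, tsub_self]
  have e := setLIntegral_eq_of_moments _ _ h1 h2 hmom hg hsymm
  rwa [Measure.restrict_eq_self_of_ae_mem hae2, Measure.restrict_eq_self_of_ae_mem hae1] at e

lemma measurableSet_lpBall (p : ℝ) : MeasurableSet {y : Fin n → ℝ | ∑ i, |y i| ^ p ≤ 1} := by
  refine measurableSet_le ?_ measurable_const
  fun_prop

/-- The volume of the matrix ball is proportional to the Vandermonde integral over the ball of eigenvalues. -/
lemma volume_preimage_matBall (hβ : Module.finrank ℝ 𝕜 = β)
    (hT : ∀ x y, ⟪x, y⟫ = RCLike.re (Matrix.trace ((T x).val * ((T y).val)ᴴ))) (p : ℝ) :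
    ENNReal.ofReal (vdmConst n β) * volume {x | T x ∈ matBall 𝕜 n p} =
      ENNReal.ofReal (gaussConst N) * vdmBall p β n := by
  set S : Set (Fin n → ℝ) := {y | ∑ i, |y i| ^ p ≤ 1} with hS
  have hSm : MeasurableSet S := measurableSet_lpBall p
  have hem : Measurable fun y : Fin n → ℝ => ENNReal.ofReal (Real.exp ((∑ i, y i ^ 2) / 2)) := by fun_prop
  have hg : Measurable (S.indicator fun y : Fin n → ℝ => ENNReal.ofReal (Real.exp ((∑ i, y i ^ 2) / 2))) :=
    hem.indicator hSm
  have hge : Measurable fun x => S.indicator (fun y : Fin n → ℝ => ENNReal.ofReal (Real.exp ((∑ i, y i ^ 2) / 2)))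
      (eigs (T x)) := hg.comp (measurable_eigs hT)
  have h := lintegral_eigMeasure hβ hT hg (fun y σ => by
    have e1 : y ∘ σ ∈ S ↔ y ∈ S := by
      simp only [hS, Set.mem_ofPred_eq, Function.comp_apply]
      rw [Equiv.sum_comp σ fun i => |y i| ^ p]
    have e2 : ∑ i, (y ∘ σ) i ^ 2 = ∑ i, y i ^ 2 := Equiv.sum_comp σ fun i => y i ^ 2
    by_cases hy : y ∈ S
    · rw [Set.indicator_of_mem (e1.2 hy), Set.indicator_of_mem hy, e2]
    · rw [Set.indicator_of_notMem (fun h => hy (e1.1 h)), Set.indicator_of_notMem hy])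
  rw [eigMeasure, lintegral_map hg (measurable_eigs hT),
    lintegral_withDensity_eq_lintegral_mul _ (measurable_gaussWeight _).ennreal_ofReal hge,
    vdmMeasure, lintegral_withDensity_eq_lintegral_mul _ (measurable_vdmWeight _ _).ennreal_ofReal hg] at h
  have hpre : MeasurableSet {x | T x ∈ matBall 𝕜 n p} := measurable_eigs hT hSm
  convert h using 1
  · rw [← setLIntegral_const, ← lintegral_indicator hpre]
    refine lintegral_congr fun x => ?_
    by_cases hx : T x ∈ matBall 𝕜 n p
    · rw [Set.indicator_of_mem (by exact hx), Pi.mul_apply, Set.indicator_of_mem (by exact hx),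
        ← ENNReal.ofReal_mul (mul_nonneg (vdmConst_nonneg _ _) (Real.exp_pos _).le), sum_sq_eigs hT, mul_assoc,
        ← Real.exp_add, neg_add_cancel, Real.exp_zero, mul_one]
    · rw [Set.indicator_of_notMem (by exact hx), Pi.mul_apply, Set.indicator_of_notMem (by exact hx), mul_zero]
  · rw [vdmBall, ← lintegral_indicator (measurableSet_lpBall p), ← lintegral_const_mul']
    · refine lintegral_congr fun y => ?_
      by_cases hy : y ∈ S
      · rw [Set.indicator_of_mem (by exact hy), Pi.mul_apply, Set.indicator_of_mem hy,
          ← ENNReal.ofReal_mul (gaussConst_pos N).le,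
          ← ENNReal.ofReal_mul (mul_nonneg (gaussConst_pos _).le (by positivity)), mul_assoc, mul_assoc,
          ← Real.exp_add, neg_add_cancel, Real.exp_zero, mul_one, Real.rpow_natCast]
      · rw [Set.indicator_of_notMem (by exact hy), Pi.mul_apply, Set.indicator_of_notMem hy, mul_zero, mul_zero]
    · exact ENNReal.ofReal_ne_top

end EigenvalueDistribution

section MatrixBallVolume

variable {𝕜 : Type} [RCLike 𝕜] {N n β : ℕ} {T : EuclideanSpace ℝ (Fin N) ≃ₗ[ℝ] HMat 𝕜 n}

lemma measurable_toHMat [MeasurableSpace 𝕜] [BorelSpace 𝕜] : Measurable T := by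
  refine Measurable.subtype_mk (f := fun x => (T x).val) ?_
  exact measurable_pi_iff.2 fun i => measurable_pi_iff.2 fun j => (polyGrowth_entry T i j).cont.measurable

lemma measurable_toHMat_symm [MeasurableSpace 𝕜] [BorelSpace 𝕜]
    (hT : ∀ x y, ⟪x, y⟫ = RCLike.re (Matrix.trace ((T x).val * ((T y).val)ᴴ))) : Measurable T.symm := by
  have hentry : ∀ i j, Measurable fun A : HMat 𝕜 n => A.val i j := fun i j =>
    (measurable_pi_apply j).comp ((measurable_pi_apply i).comp measurable_subtype_coe)
  have h : Measurable fun A : HMat 𝕜 n => (T.symm A).ofLp := by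
    refine measurable_pi_iff.2 fun b => ?_
    have he : (fun A : HMat 𝕜 n => T.symm A b) =
        fun A => RCLike.re (∑ i, ∑ j, A.val i j * basisMat T b j i) := by
      funext A
      have h1 := trace_mul_eq_inner hT (T.symm A) (EuclideanSpace.basisFun (Fin N) ℝ b)
      rw [LinearEquiv.apply_symm_apply] at h1
      rw [real_inner_comm, EuclideanSpace.basisFun_inner] at h1
      exact h1.symm
    rw [he]
    exact RCLike.continuous_re.measurable.comp (Finset.measurable_fun_sum _ fun i _ => Finset.measurable_fun_sum _ fun j _ =>
      (hentry i j).mul_const _)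
  exact (WithLp.measurable_toLp 2 _).comp h

lemma map_matBall [MeasurableSpace 𝕜] [BorelSpace 𝕜]
    (hT : ∀ x y, ⟪x, y⟫ = RCLike.re (Matrix.trace ((T x).val * ((T y).val)ᴴ))) (p : ℝ) :
    (volume.map T) (matBall 𝕜 n p) = volume {x | T x ∈ matBall 𝕜 n p} := by
  refine Measure.map_apply measurable_toHMat ?_
  have h : MeasurableSet {x | T x ∈ matBall 𝕜 n p} := measurable_eigs hT (measurableSet_lpBall p)
  have he : matBall 𝕜 n p = T.symm ⁻¹' {x | T x ∈ matBall 𝕜 n p} := by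
    ext A; simp
  rw [he]
  exact measurable_toHMat_symm hT h

lemma preimage_matBall_two (hT : ∀ x y, ⟪x, y⟫ = RCLike.re (Matrix.trace ((T x).val * ((T y).val)ᴴ))) :
    {x | T x ∈ matBall 𝕜 n 2} = Metric.closedBall 0 1 := by
  ext x
  have h : ∑ j, |eigs (T x) j| ^ (2 : ℝ) = ‖x‖ ^ 2 := by
    rw [← sum_sq_eigs hT]
    exact Finset.sum_congr rfl fun j _ => by rw [Real.rpow_two, sq_abs]
  simp only [matBall, Set.mem_ofPred_eq, h, mem_closedBall_zero_iff]
  exact sq_le_one_iff₀ (norm_nonneg _)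

lemma log_volume_matBall (hβ : Module.finrank ℝ 𝕜 = β)
    (hT : ∀ x y, ⟪x, y⟫ = RCLike.re (Matrix.trace ((T x).val * ((T y).val)ᴴ))) {p : ℝ} (hp : 0 < p) (hn : 1 ≤ n) :
    0 < (volume {x | T x ∈ matBall 𝕜 n p}).toReal ∧
    Real.log (volume {x | T x ∈ matBall 𝕜 n p}).toReal =
      Real.log (volume (Metric.closedBall (0 : EuclideanSpace ℝ (Fin N)) 1)).toReal +
        Real.log (vdmBall p β n).toReal - Real.log (vdmBall 2 β n).toReal := by
  have hβ0 : (0 : ℝ) < β := by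
    have : 0 < β := hβ ▸ Module.finrank_pos
    exact_mod_cast this
  have key : ∀ q : ℝ, vdmConst n β * (volume {x | T x ∈ matBall 𝕜 n q}).toReal =
      gaussConst N * (vdmBall q β n).toReal := by
    intro q
    have := congrArg ENNReal.toReal (volume_preimage_matBall hβ hT q)
    rwa [ENNReal.toReal_mul, ENNReal.toReal_mul, ENNReal.toReal_ofReal (vdmConst_nonneg _ _),
      ENNReal.toReal_ofReal (gaussConst_pos _).le] at this
  have hG := gaussConst_pos N
  have hv : ∀ {q : ℝ}, 0 < q → 0 < (vdmBall q β n).toReal := fun hq =>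
    (log_vdmBall_ge hq hβ0 hn (vdmBall_ne_top hq hβ0 n)).1
  have pos : ∀ {q : ℝ}, 0 < q → 0 < vdmConst n β ∧ 0 < (volume {x | T x ∈ matBall 𝕜 n q}).toReal := by
    intro q hq
    have h1 : 0 < vdmConst n β * (volume {x | T x ∈ matBall 𝕜 n q}).toReal := by
      rw [key]; exact mul_pos hG (hv hq)
    exact ⟨pos_of_mul_pos_left h1 ENNReal.toReal_nonneg, pos_of_mul_pos_right h1 (vdmConst_nonneg _ _)⟩
  have logkey : ∀ {q : ℝ}, 0 < q → Real.log (vdmConst n β) + Real.log (volume {x | T x ∈ matBall 𝕜 n q}).toReal =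
      Real.log (gaussConst N) + Real.log (vdmBall q β n).toReal := by
    intro q hq
    rw [← Real.log_mul (pos hq).1.ne' (pos hq).2.ne', key, Real.log_mul hG.ne' (hv hq).ne']
  refine ⟨(pos hp).2, ?_⟩
  have h1 := logkey hp
  have h2 := logkey two_pos
  rw [preimage_matBall_two hT] at h2
  linarith

lemma ullmanConst_two : ullmanConst 2 = 1 := by
  have h : Real.Gamma ((2 + 1) / 2) = √Real.pi / 2 := by
    rw [show ((2 : ℝ) + 1) / 2 = 1 / 2 + 1 by norm_num, Real.Gamma_add_one (by norm_num), Real.Gamma_one_half_eq]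
    ring
  have hpi : √Real.pi ≠ 0 := (Real.sqrt_pos.2 Real.pi_pos).ne'
  rw [ullmanConst, h, div_self two_ne_zero, Real.Gamma_one]
  field_simp

lemma vdmLim_eq {p b : ℝ} (hp : 0 < p) (hb : 0 < b) :
    vdmLim p b = 1 / p * (Real.log (2 * p * ullmanConst p) - 1 / 2) - Real.log 2 := by
  have hu := ullmanConst_pos hp
  rw [vdmLim, Real.log_mul hb.ne' hu.ne', Real.log_div hb.ne' (by positivity), Real.log_mul two_ne_zero hp.ne',
    Real.log_mul (by positivity) hu.ne', Real.log_mul two_ne_zero hp.ne']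
  field_simp
  ring

lemma exp_limit {p b : ℝ} (hp : 0 < p) (hb : 0 < b) :
    Real.exp (1 / 2 * (Real.log Real.pi + 1 - Real.log (b / 4)) + vdmLim p b - vdmLim 2 b) =
    (p * Real.sqrt Real.pi * Real.Gamma (p / 2) / (Real.sqrt (Real.exp 1) * Real.Gamma ((p + 1) / 2))) ^ (1 / p) *
        (Real.pi / b) ^ ((1 : ℝ) / 2) * Real.exp (3 / 4) := by
  have hu := ullmanConst_pos hp
  have hbase : p * Real.sqrt Real.pi * Real.Gamma (p / 2) / (Real.sqrt (Real.exp 1) * Real.Gamma ((p + 1) / 2)) =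
      Real.exp (Real.log (2 * p * ullmanConst p) - 1 / 2) := by
    have hG : 0 < Real.Gamma ((p + 1) / 2) := Real.Gamma_pos_of_pos (by linarith)
    rw [Real.exp_sub, Real.exp_log (by positivity), ← Real.exp_half, ullmanConst]
    field_simp
  rw [hbase, ← Real.exp_mul, Real.rpow_def_of_pos (by positivity), ← Real.exp_add, ← Real.exp_add,
    vdmLim_eq hp hb, vdmLim_eq two_pos hb, ullmanConst_two, mul_one, Real.log_div Real.pi_pos.ne' hb.ne',
    Real.log_div hb.ne' (by norm_num), show (4 : ℝ) = 2 * 2 by norm_num, Real.log_mul two_ne_zero two_ne_zero]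
  congr 1
  ring

end MatrixBallVolume

theorem stmt1 (𝕜 : Type) [RCLike 𝕜] [MeasurableSpace 𝕜] [BorelSpace 𝕜]
    (β : ℕ) (hβ : Module.finrank ℝ 𝕜 = β)
    (p : ℝ) (hp : 0 < p)
    -- `vol n` is the Lebesgue volume on `H_n(F_β)` induced by the inner product
    -- `⟨A,B⟩ = Re Tr (A Bᴴ)`, i.e. the pushforward of the Lebesgue measure on the
    -- Euclidean space of dimension `N = β n(n-1)/2 + n` under any linear isometry `T n`.
    (vol : ∀ n : ℕ, Measure (HMat 𝕜 n))
    (T : ∀ n : ℕ, EuclideanSpace ℝ (Fin (β * (n * (n - 1) / 2) + n)) ≃ₗ[ℝ] HMat 𝕜 n)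
    (hT : ∀ n x y, ⟪x, y⟫ = RCLike.re (Matrix.trace ((T n x).val * ((T n y).val)ᴴ)))
    (hvol : ∀ n, vol n = Measure.map (T n) volume) :
    Tendsto
      (fun n : ℕ => (n : ℝ) ^ (1 / p + 1 / 2) *
        ((vol n) (matBall 𝕜 n p)).toReal ^ (2 / ((β : ℝ) * (n : ℝ) ^ 2)))
      atTop
      (nhds ((p * Real.sqrt Real.pi * Real.Gamma (p / 2) /
          (Real.sqrt (Real.exp 1) * Real.Gamma ((p + 1) / 2))) ^ (1 / p) *
        (Real.pi / (β : ℝ)) ^ ((1 : ℝ) / 2) * Real.exp (3 / 4))) := by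


  have hβ0 : 0 < β := hβ ▸ Module.finrank_pos
  have hβ1 : (0 : ℝ) < β := by exact_mod_cast hβ0
  rw [← exp_limit hp hβ1]
  have h := (((tendsto_log_volume_ball hβ0).add (tendsto_log_vdmBall hp hβ1)).sub
    (tendsto_log_vdmBall two_pos hβ1)).rexp
  refine h.congr' ?_
  filter_upwards [eventually_ge_atTop 1] with n hn
  have hn0 : (0 : ℝ) < n := by exact_mod_cast hn
  obtain ⟨hpos, hlog⟩ := log_volume_matBall hβ (hT n) hp hn
  rw [hvol, map_matBall (hT n), Real.rpow_def_of_pos hn0, Real.rpow_def_of_pos hpos, ← Real.exp_add, hlog]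
  congr 1
  ring

end
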